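/- arXiv:1902.06081 — 3 statements merged into one kernel-verified Lean document; each statement's English description precedes it below -/
import Mathlib

section
/- Let (a,b) ∈ ℝ² satisfy ω*(a,b) < 5. For Q ∈ ℕ and δ > 0 define the dual Bohr set B = {(p₂, q, p₁) ∈ ℤ³ : |p₂| ≤ Q, |q| ≤ Q, |p₂ a + q b − p₁| ≤ δ}. Then there exist constants Q₀ = Q₀(a,b), c = c(a,b) > 0 and C = C(a,b) > 0 such that: whenever Q ≥ Q₀ and c Q^{−1/2} (log Q)^{−3/2} ≤ δ < Q/1000, there exist N₁, N₂, N₃ ∈ ℕ and linearly independent vectors v₁, v₂, v₃ ∈ ℤ³ such that B ⊆ P and #P ≤ C δ Q², where P = {n₁ v₁ + n₂ v₂ + n₃ v₃ : n_i ∈ ℤ, |n_i| ≤ N_i for i = 1,2,3}. In particular #B ≤ C δ Q². -/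
/-!
Outer structure of dual Bohr sets (Chow–Yang, Lemma 4.1): if `ω*(a,b) < 5`,
then for `Q ≥ Q₀(a,b)` and `Q/1000 > δ ≫ Q^{-1/2} (log Q)^{-3/2}`, the dual
Bohr set `B(δ; Q; a, b)` is contained in a generalised arithmetic progression
`P` on three linearly independent generators with `#P ≪ δ Q²`; in particular
`#B ≪ δ Q²`.
-/

open MeasureTheory

noncomputable section

/-- Distance from a real number to the nearest integer, `⟨x⟩`. -/
def distNearestInt (x : ℝ) : ℝ := |x - round x|

/-- `ω*(a,b) < 5`, where `ω*(a,b)` is the dual exponent of `(a,b)`: the supremum of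
`w` such that `⟨xa + yb⟩ ≤ (|x|+|y|)^{-w}` for infinitely many nonzero `(x,y) ∈ ℤ²`. -/
def DualExpLtFive (a b : ℝ) : Prop :=
  ∃ w : ℝ, w < 5 ∧
    {p : ℤ × ℤ | p ≠ 0 ∧
      distNearestInt (p.1 * a + p.2 * b) ≤ ((|p.1| + |p.2| : ℤ) : ℝ) ^ (-w)}.Finite

/-- The dual Bohr set `B(δ; Q; a, b)`, with coordinates `v = (p₂, q, p₁)`. -/
def dualBohrSet (a b : ℝ) (Q : ℕ) (δ : ℝ) : Set (Fin 3 → ℤ) :=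
  {v | |v 0| ≤ (Q : ℤ) ∧ |v 1| ≤ (Q : ℤ) ∧
    |(v 0 : ℝ) * a + (v 1 : ℝ) * b - (v 2 : ℝ)| ≤ δ}

/-- The generalised arithmetic progression on generators `v₁, v₂, v₃` with
side lengths `N₁, N₂, N₃`. -/
def gap (v₁ v₂ v₃ : Fin 3 → ℤ) (N₁ N₂ N₃ : ℕ) : Set (Fin 3 → ℤ) :=
  {x | ∃ n₁ n₂ n₃ : ℤ, |n₁| ≤ (N₁ : ℤ) ∧ |n₂| ≤ (N₂ : ℤ) ∧ |n₃| ≤ (N₃ : ℤ) ∧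
    x = n₁ • v₁ + n₂ • v₂ + n₃ • v₃}

/-- Diophantine lower bound. -/
theorem aux_dioph (a b : ℝ) (hab : DualExpLtFive a b) :
    ∃ w κ : ℝ, 3 ≤ w ∧ w < 5 ∧ 0 < κ ∧ ∀ x y z : ℤ, ¬ (x = 0 ∧ y = 0) →
      κ * ((|x| + |y| : ℤ) : ℝ) ^ (-w) ≤ |(x : ℝ) * a + (y : ℝ) * b - (z : ℝ)| := by
  obtain ⟨w, hw, hfin⟩ := hab
  set S := {p : ℤ × ℤ | p ≠ 0 ∧
      distNearestInt (p.1 * a + p.2 * b) ≤ ((|p.1| + |p.2| : ℤ) : ℝ) ^ (-w)} with hS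
  have hN : ∀ p : ℤ × ℤ, p ≠ 0 → (1 : ℝ) ≤ ((|p.1| + |p.2| : ℤ) : ℝ) := by
    rintro ⟨x, y⟩ hp
    have : 1 ≤ |x| + |y| := by
      by_contra h
      apply hp
      have h1 := abs_nonneg x
      have h2 := abs_nonneg y
      have hx : |x| = 0 := by omega
      have hy : |y| = 0 := by omega
      simp [abs_eq_zero.1 hx, abs_eq_zero.1 hy]
    exact_mod_cast this
  have hpos : ∀ p : ℤ × ℤ, p ≠ 0 → 0 < distNearestInt (p.1 * a + p.2 * b) := by
    rintro ⟨x, y⟩ hp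
    refine lt_of_le_of_ne (abs_nonneg _) ?_
    intro h0
    have h1 : (x : ℝ) * a + y * b = (round ((x : ℝ) * a + y * b) : ℤ) := by
      have := abs_eq_zero.1 h0.symm
      simpa using sub_eq_zero.1 this
    set r := round ((x : ℝ) * a + y * b)
    have hinj : Function.Injective (fun n : ℕ => (((n : ℤ) + 1) * x, ((n : ℤ) + 1) * y)) := by
      intro m n hmn
      simp only [Prod.mk.injEq] at hmn
      by_cases hx : x = 0
      · have hy : y ≠ 0 := fun hy => hp (by simp [hx, hy])
        have := mul_right_cancel₀ hy hmn.2
        omega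
      · have := mul_right_cancel₀ hx hmn.1
        omega
    refine Set.infinite_of_injective_forall_mem (s := S) hinj ?_ hfin
    intro n
    refine ⟨?_, ?_⟩
    · intro h
      simp only [Prod.mk_eq_zero, mul_eq_zero] at h
      have hn : ((n : ℤ) + 1) ≠ 0 := by omega
      apply hp
      simp only [Prod.mk_eq_zero]
      tauto
    · have : ((((n : ℤ) + 1) * x : ℤ) : ℝ) * a + ((((n : ℤ) + 1) * y : ℤ) : ℝ) * b
          = ((((n : ℤ) + 1) * r : ℤ) : ℝ) := by
        push_cast
        rw [← h1]; ring
      have h2 : distNearestInt (((((n : ℤ) + 1) * x : ℤ) : ℝ) * a + ((((n : ℤ) + 1) * y : ℤ) : ℝ) * b) = 0 := by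
        rw [this]
        unfold distNearestInt
        rw [round_intCast]; simp
      change distNearestInt (((((n : ℤ) + 1) * x : ℤ) : ℝ) * a + ((((n : ℤ) + 1) * y : ℤ) : ℝ) * b) ≤ _
      rw [h2]
      positivity
  have hκ : ∃ κ : ℝ, 0 < κ ∧ κ ≤ 1 ∧ ∀ p ∈ S, κ ≤ distNearestInt (p.1 * a + p.2 * b) := by
    rcases S.eq_empty_or_nonempty with he | hne
    · exact ⟨1, one_pos, le_rfl, by simp [he]⟩
    · obtain ⟨p, hp, hmin⟩ := Set.exists_min_image S
        (fun p => distNearestInt (p.1 * a + p.2 * b)) hfin hne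
      refine ⟨min 1 (distNearestInt (p.1 * a + p.2 * b)), lt_min one_pos (hpos p hp.1),
        min_le_left _ _, fun q hq => (min_le_right _ _).trans (hmin q hq)⟩
  obtain ⟨κ, hκ0, hκ1, hκS⟩ := hκ
  refine ⟨max w 3, κ, le_max_right _ _, max_lt hw (by norm_num), hκ0, ?_⟩
  intro x y z hxy
  have hp : ((x, y) : ℤ × ℤ) ≠ 0 := by
    simpa [Prod.mk_eq_zero] using hxy
  have h1 : distNearestInt (x * a + y * b) ≤ |(x : ℝ) * a + (y : ℝ) * b - (z : ℝ)| :=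
    round_le _ _
  refine le_trans ?_ h1
  have hN1 := hN _ hp
  simp only at hN1
  set N : ℝ := ((|x| + |y| : ℤ) : ℝ)
  have hle1 : N ^ (-(max w 3)) ≤ 1 :=
    Real.rpow_le_one_of_one_le_of_nonpos hN1 (by
      have := le_max_right w 3
      linarith)
  have hle0 : 0 ≤ N ^ (-(max w 3)) := by positivity
  by_cases hmem : (x, y) ∈ S
  · have := hκS _ hmem
    simp only at this
    nlinarith
  · have h2 : N ^ (-w) < distNearestInt (x * a + y * b) := by
      by_contra h
      exact hmem ⟨hp, not_lt.1 h⟩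
    have h3 : N ^ (-(max w 3)) ≤ N ^ (-w) :=
      Real.rpow_le_rpow_of_exponent_le hN1 (by
        have := le_max_left w 3
        linarith)
    nlinarith

/-- Gram determinant inequality, ordered, all off-diagonal entries nonpositive. -/
theorem aux_gram_neg (A B C f g h : ℝ) (hA : 0 < A) (hAB : A ≤ B) (hBC : B ≤ C)
    (hf0 : 0 ≤ f) (hg0 : 0 ≤ g) (hh0 : 0 ≤ h)
    (hf : 2 * f ≤ B) (hg : 2 * g ≤ A) (hh : 2 * h ≤ A) (hs : 2 * (f + g + h) ≤ A + B) :
    A * B * C ≤ 16 * (A * B * C - 2 * (f * g * h) - A * f ^ 2 - B * g ^ 2 - C * h ^ 2) := by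
  have hB : 0 < B := by linarith
  have hC : 0 < C := by linarith
  have key : 4 * (2 * (f * g * h) + A * f ^ 2 + B * g ^ 2 + B * h ^ 2) ≤ 2 * (A * B * B) := by
    rcases le_total (2 * (g + h)) A with hS | hS
    · have e1 : f * (g * h) ≤ B / 2 * (g * h) :=
        mul_le_mul_of_nonneg_right (by linarith) (mul_nonneg hg0 hh0)
      have e2 : (2 * (g + h)) ^ 2 ≤ A ^ 2 := by nlinarith
      have e3 : B * (2 * (g + h)) ^ 2 ≤ B * (A * B) :=
        mul_le_mul_of_nonneg_left (by nlinarith) hB.le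
      have e4 : A * (2 * f) ^ 2 ≤ A * B ^ 2 :=
        mul_le_mul_of_nonneg_left (by nlinarith) hA.le
      nlinarith [mul_nonneg hB.le (mul_nonneg hg0 hh0)]
    · obtain ⟨e, he⟩ : ∃ e, e = 2 * (g + h) - A := ⟨_, rfl⟩
      have he0 : 0 ≤ e := by linarith
      have heA : e ≤ A := by linarith
      have e1 : A * e ≤ 4 * (g * h) := by
        rw [he]; nlinarith [mul_nonneg (sub_nonneg.2 hg) (sub_nonneg.2 hh)]
      have e2 : 0 ≤ (2 * B - 2 * f) * (4 * (g * h) - A * e) :=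
        mul_nonneg (by linarith) (by linarith)
      have e3 : 2 * f * (2 * f + e) ≤ (B - e) * B :=
        mul_le_mul (by linarith) (by linarith) (by linarith) (by linarith)
      have e4 : A * (2 * f * (2 * f + e)) ≤ A * ((B - e) * B) :=
        mul_le_mul_of_nonneg_left e3 hA.le
      have e5 : B * (A * A) ≤ B * (A * B) :=
        mul_le_mul_of_nonneg_left (mul_le_mul_of_nonneg_left hAB hA.le) hB.le
      have e6 : 0 ≤ B * (e * (A - e)) := mul_nonneg hB.le (mul_nonneg he0 (by linarith))
      have e7 : B * (4 * g ^ 2 + 4 * h ^ 2) = B * ((A + e) ^ 2 - 2 * (4 * (g * h))) := by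
        rw [he]; ring
      have e8 : 0 ≤ f * (4 * (g * h) - A * e) := mul_nonneg hf0 (by linarith)
      nlinarith
  have hh2 : 4 * h ^ 2 ≤ A * B := by nlinarith
  nlinarith [mul_nonneg (sub_nonneg.2 hBC) (sub_nonneg.2 hh2),
    mul_nonneg (sub_nonneg.2 hBC) (mul_pos hA hB).le, mul_pos (mul_pos hA hB) hB]

theorem aux_gram_ord (A B C f g h : ℝ) (hA : 0 < A) (hAB : A ≤ B) (hBC : B ≤ C)
    (hf : |2 * f| ≤ B) (hg : |2 * g| ≤ A) (hh : |2 * h| ≤ A)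
    (h1 : 0 ≤ A + B + 2 * (f + g + h)) (h2 : 0 ≤ A + B + 2 * (f - g - h))
    (h3 : 0 ≤ A + B + 2 * (-f + g - h)) (h4 : 0 ≤ A + B + 2 * (-f - g + h)) :
    A * B * C ≤ 16 * (A * B * C + 2 * (f * g * h) - A * f ^ 2 - B * g ^ 2 - C * h ^ 2) := by
  rw [abs_le] at hf hg hh
  by_cases hp : 0 ≤ f * g * h
  · have e1 : 4 * f ^ 2 ≤ B ^ 2 := by nlinarith
    have e2 : 4 * g ^ 2 ≤ A ^ 2 := by nlinarith
    have e3 : 4 * h ^ 2 ≤ A ^ 2 := by nlinarith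
    have k1 : A * (4 * f ^ 2) ≤ A * B * C := by nlinarith [mul_pos hA (hA.trans_le hAB)]
    have k2 : B * (4 * g ^ 2) ≤ A * B * C := by nlinarith [mul_pos hA (hA.trans_le hAB)]
    have k3 : C * (4 * h ^ 2) ≤ A * B * C := by
      have : C * (4 * h ^ 2) ≤ C * (A * B) := by
        apply mul_le_mul_of_nonneg_left _ (by linarith)
        nlinarith
      linarith
    linarith [mul_pos (mul_pos hA (hA.trans_le hAB)) (hA.trans_le (hAB.trans hBC))]
  · push Not at hp
    rcases le_total 0 f with hf0 | hf0 <;> rcases le_total 0 g with hg0 | hg0 <;>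
      rcases le_total 0 h with hh0 | hh0
    · exact absurd hp (not_lt.2 (by positivity))
    · have := aux_gram_neg A B C f g (-h) hA hAB hBC (by linarith) (by linarith) (by linarith)
        (by linarith) (by linarith) (by linarith) (by linarith)
      linarith
    · have := aux_gram_neg A B C f (-g) h hA hAB hBC (by linarith) (by linarith) (by linarith)
        (by linarith) (by linarith) (by linarith) (by linarith)
      linarith
    · exact absurd hp (not_lt.2 (by nlinarith [mul_nonneg hf0 (mul_nonneg_of_nonpos_of_nonpos hg0 hh0)]))
    · have := aux_gram_neg A B C (-f) g h hA hAB hBC (by linarith) (by linarith) (by linarith)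
        (by linarith) (by linarith) (by linarith) (by linarith)
      linarith
    · exact absurd hp (not_lt.2 (by nlinarith [mul_nonneg hg0 (mul_nonneg_of_nonpos_of_nonpos hf0 hh0)]))
    · exact absurd hp (not_lt.2 (by nlinarith [mul_nonneg hh0 (mul_nonneg_of_nonpos_of_nonpos hf0 hg0)]))
    · have := aux_gram_neg A B C (-f) (-g) (-h) hA hAB hBC (by linarith) (by linarith) (by linarith)
        (by linarith) (by linarith) (by linarith) (by linarith)
      linarith

theorem aux_gram (A B C f g h : ℝ) (hA : 0 < A) (hB : 0 < B) (hC : 0 < C)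
    (hfB : |2 * f| ≤ B) (hfC : |2 * f| ≤ C) (hgA : |2 * g| ≤ A) (hgC : |2 * g| ≤ C)
    (hhA : |2 * h| ≤ A) (hhB : |2 * h| ≤ B)
    (hs : ∀ M ∈ [A + B, A + C, B + C], 0 ≤ M + 2 * (f + g + h) ∧ 0 ≤ M + 2 * (f - g - h) ∧
      0 ≤ M + 2 * (-f + g - h) ∧ 0 ≤ M + 2 * (-f - g + h)) :
    A * B * C ≤ 16 * (A * B * C + 2 * (f * g * h) - A * f ^ 2 - B * g ^ 2 - C * h ^ 2) := by
  obtain ⟨a1, a2, a3, a4⟩ := hs (A + B) (by simp)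
  obtain ⟨b1, b2, b3, b4⟩ := hs (A + C) (by simp)
  obtain ⟨c1, c2, c3, c4⟩ := hs (B + C) (by simp)
  rcases le_total A B with x | x <;> rcases le_total B C with y | y <;>
    rcases le_total A C with z | z
  · have := aux_gram_ord A B C f g h hA x y (by assumption) (by assumption) (by assumption)
      (by linarith) (by linarith) (by linarith) (by linarith)
    linarith
  · have := aux_gram_ord A B C f g h hA x y (by assumption) (by assumption) (by assumption)
      (by linarith) (by linarith) (by linarith) (by linarith)
    linarith
  · have := aux_gram_ord A C B f h g hA z y (by assumption) (by assumption) (by assumption)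
      (by linarith) (by linarith) (by linarith) (by linarith)
    linarith
  · have := aux_gram_ord C A B h f g hC z x (by assumption) (by assumption) (by assumption)
      (by linarith) (by linarith) (by linarith) (by linarith)
    linarith
  · have := aux_gram_ord B A C g f h hB x z (by assumption) (by assumption) (by assumption)
      (by linarith) (by linarith) (by linarith) (by linarith)
    linarith
  · have := aux_gram_ord B C A g h f hB y z (by assumption) (by assumption) (by assumption)
      (by linarith) (by linarith) (by linarith) (by linarith)
    linarith
  · have := aux_gram_ord B A C g f h hB x z (by assumption) (by assumption) (by assumption)
      (by linarith) (by linarith) (by linarith) (by linarith)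
    linarith
  · have := aux_gram_ord C B A h g f hC y x (by assumption) (by assumption) (by assumption)
      (by linarith) (by linarith) (by linarith) (by linarith)
    linarith

/-- integer determinant -/
def dd (u v w : Fin 3 → ℤ) : ℤ :=
  u 0 * (v 1 * w 2 - v 2 * w 1) - u 1 * (v 0 * w 2 - v 2 * w 0) + u 2 * (v 0 * w 1 - v 1 * w 0)

/-- scaled linear form -/
def zf (a b β : ℝ) (v : Fin 3 → ℤ) : ℝ := β * (v 0 * a + v 1 * b - v 2)

/-- inner product -/
def ip (a b α β : ℝ) (u v : Fin 3 → ℤ) : ℝ :=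
  (α * u 0) * (α * v 0) + (α * u 1) * (α * v 1) + zf a b β u * zf a b β v

theorem ip_pos (a b α β : ℝ) (hα : 0 < α) (hβ : 0 < β) (v : Fin 3 → ℤ) (hv : v ≠ 0) :
    0 < ip a b α β v v := by
  have h0 : 0 ≤ ip a b α β v v := by unfold ip; nlinarith [mul_self_nonneg (α * v 0), mul_self_nonneg (α * v 1), mul_self_nonneg (zf a b β v)]
  refine lt_of_le_of_ne h0 fun h => hv ?_
  unfold ip at h
  have e0 : α * (v 0 : ℝ) = 0 := by
    apply mul_self_eq_zero.1
    nlinarith [mul_self_nonneg (α * v 0), mul_self_nonneg (α * v 1), mul_self_nonneg (zf a b β v)]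
  have e1 : α * (v 1 : ℝ) = 0 := by
    apply mul_self_eq_zero.1
    nlinarith [mul_self_nonneg (α * v 0), mul_self_nonneg (α * v 1), mul_self_nonneg (zf a b β v)]
  have e2 : zf a b β v = 0 := by
    apply mul_self_eq_zero.1
    nlinarith [mul_self_nonneg (α * v 0), mul_self_nonneg (α * v 1), mul_self_nonneg (zf a b β v)]
  have f0 : (v 0 : ℝ) = 0 := (mul_eq_zero.1 e0).resolve_left hα.ne'
  have f1 : (v 1 : ℝ) = 0 := (mul_eq_zero.1 e1).resolve_left hα.ne'
  have f2 : (v 2 : ℝ) = 0 := by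
    have := (mul_eq_zero.1 e2).resolve_left hβ.ne'
    rw [f0, f1] at this; linarith
  ext i
  fin_cases i
  · exact_mod_cast f0
  · exact_mod_cast f1
  · exact_mod_cast f2

theorem ip_finite (a b α β : ℝ) (hα : 0 < α) (hβ : 0 < β) (R : ℝ) :
    {v : Fin 3 → ℤ | ip a b α β v v ≤ R}.Finite := by
  set M : ℝ := Real.sqrt R / α
  set M2 : ℝ := M * |a| + M * |b| + Real.sqrt R / β
  set K : ℤ := ⌈max M M2⌉
  refine (Set.finite_Icc (fun _ : Fin 3 => -K) (fun _ => K)).subset ?_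
  intro v hv
  simp only [Set.mem_ofPred_eq, ip] at hv
  have n0 := mul_self_nonneg (α * v 0)
  have n1 := mul_self_nonneg (α * v 1)
  have n2 := mul_self_nonneg (zf a b β v)
  have k0 : |α * (v 0 : ℝ)| ≤ Real.sqrt R := Real.abs_le_sqrt (by nlinarith)
  have k1 : |α * (v 1 : ℝ)| ≤ Real.sqrt R := Real.abs_le_sqrt (by nlinarith)
  have k2 : |zf a b β v| ≤ Real.sqrt R := Real.abs_le_sqrt (by nlinarith)
  unfold zf at k2
  rw [abs_mul, abs_of_pos hα] at k0 k1
  rw [abs_mul, abs_of_pos hβ] at k2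
  have j0 : |(v 0 : ℝ)| ≤ M := by rw [le_div_iff₀ hα]; linarith
  have j1 : |(v 1 : ℝ)| ≤ M := by rw [le_div_iff₀ hα]; linarith
  have j2' : |(v 0 : ℝ) * a + v 1 * b - v 2| ≤ Real.sqrt R / β := by
    rw [le_div_iff₀ hβ]; linarith
  have j2 : |(v 2 : ℝ)| ≤ M2 := by
    have : (v 2 : ℝ) = v 0 * a + v 1 * b - (v 0 * a + v 1 * b - v 2) := by ring
    rw [this]
    refine (abs_sub _ _).trans ?_
    refine add_le_add ((abs_add_le _ _).trans ?_) j2'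
    rw [abs_mul, abs_mul]
    gcongr
  have hK : ∀ t : ℤ, |(t : ℝ)| ≤ max M M2 → -K ≤ t ∧ t ≤ K := by
    intro t ht
    rw [← abs_le]
    have : ((|t| : ℤ) : ℝ) ≤ K := by
      push_cast
      exact ht.trans (Int.le_ceil _)
    exact_mod_cast this
  have l0 := hK _ (j0.trans (le_max_left _ _))
  have l1 := hK _ (j1.trans (le_max_left _ _))
  have l2 := hK _ (j2.trans (le_max_right _ _))
  constructor
  · intro i; fin_cases i
    · exact l0.1
    · exact l1.1
    · exact l2.1
  · intro i; fin_cases i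
    · exact l0.2
    · exact l1.2
    · exact l2.2

theorem ip_comm' (a b α β : ℝ) (u v : Fin 3 → ℤ) : ip a b α β u v = ip a b α β v u := by
  unfold ip; ring

/-- minimal basis -/
def IsMinB (a b α β : ℝ) (u v w : Fin 3 → ℤ) : Prop :=
  dd u v w ^ 2 = 1 ∧ ∀ u' v' w', dd u' v' w' ^ 2 = 1 →
    ip a b α β u u + ip a b α β v v + ip a b α β w w ≤
    ip a b α β u' u' + ip a b α β v' v' + ip a b α β w' w'

theorem exists_minB (a b α β : ℝ) (hα : 0 < α) (hβ : 0 < β) :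
    ∃ u v w, IsMinB a b α β u v w := by
  have hnn : ∀ v, 0 ≤ ip a b α β v v := by
    intro v
    unfold ip; nlinarith [mul_self_nonneg (α * v 0), mul_self_nonneg (α * v 1), mul_self_nonneg (zf a b β v)]
  let F : (Fin 3 → ℤ) × (Fin 3 → ℤ) × (Fin 3 → ℤ) → ℝ := fun p =>
    ip a b α β p.1 p.1 + ip a b α β p.2.1 p.2.1 + ip a b α β p.2.2 p.2.2
  let e : (Fin 3 → ℤ) × (Fin 3 → ℤ) × (Fin 3 → ℤ) := (![1,0,0], ![0,1,0], ![0,0,1])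
  let S := {p : (Fin 3 → ℤ) × (Fin 3 → ℤ) × (Fin 3 → ℤ) | dd p.1 p.2.1 p.2.2 ^ 2 = 1 ∧ F p ≤ F e}
  have hf := ip_finite a b α β hα hβ (F e)
  have hS : S.Finite := by
    refine (hf.prod (hf.prod hf)).subset ?_
    rintro ⟨u, v, w⟩ ⟨_, h⟩
    have h1 := hnn u
    have h2 := hnn v
    have h3 := hnn w
    simp only [F] at h
    refine ⟨?_, ?_, ?_⟩ <;> simp only [Set.mem_ofPred_eq, F] <;> linarith
  have he : dd e.1 e.2.1 e.2.2 ^ 2 = 1 := by simp [e, dd]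
  obtain ⟨p, hp, hmin⟩ := Set.exists_min_image S F hS ⟨e, he, le_rfl⟩
  refine ⟨p.1, p.2.1, p.2.2, hp.1, ?_⟩
  intro u' v' w' h
  by_cases hle : F (u', v', w') ≤ F e
  · exact hmin (u', v', w') ⟨h, hle⟩
  · exact hp.2.trans (not_le.1 hle).le

theorem IsMinB.rot {a b α β : ℝ} {u v w : Fin 3 → ℤ} (h : IsMinB a b α β u v w) :
    IsMinB a b α β v w u := by
  refine ⟨?_, ?_⟩
  · rw [← h.1]; unfold dd; ring
  · intro u' v' w' h'
    have := h.2 u' v' w' h'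
    linarith

theorem IsMinB.red {a b α β : ℝ} {u v w : Fin 3 → ℤ} (h : IsMinB a b α β u v w) (s t : ℤ) :
    0 ≤ (s : ℝ) ^ 2 * ip a b α β v v + (t : ℝ) ^ 2 * ip a b α β w w + 2 * s * ip a b α β u v
      + 2 * t * ip a b α β u w + 2 * s * t * ip a b α β v w := by
  have h1 := h.2 (u + s • v + t • w) v w (by
    rw [← h.1]; unfold dd; simp only [Pi.add_apply, Pi.smul_apply, smul_eq_mul]; ring)
  have h2 : ip a b α β (u + s • v + t • w) (u + s • v + t • w) = ip a b α β u u +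
     ((s : ℝ) ^ 2 * ip a b α β v v + (t : ℝ) ^ 2 * ip a b α β w w + 2 * s * ip a b α β u v
      + 2 * t * ip a b α β u w + 2 * s * t * ip a b α β v w) := by
    unfold ip zf; simp only [Pi.add_apply, Pi.smul_apply, smul_eq_mul]; push_cast; ring
  linarith

theorem dd_ne {u v w : Fin 3 → ℤ} (h : dd u v w ^ 2 = 1) : u ≠ 0 := by
  rintro rfl
  simp [dd] at h

theorem gram_det (a b α β : ℝ) (u v w : Fin 3 → ℤ) :
    ip a b α β u u * ip a b α β v v * ip a b α β w w + 2 * (ip a b α β v w * ip a b α β u w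
      * ip a b α β u v) - ip a b α β u u * ip a b α β v w ^ 2 - ip a b α β v v * ip a b α β u w ^ 2
      - ip a b α β w w * ip a b α β u v ^ 2 = (dd u v w : ℝ) ^ 2 * (α ^ 2 * β) ^ 2 := by
  unfold ip zf dd; push_cast; ring

theorem cs_real (x1 x2 x3 y1 y2 y3 : ℝ) : (x1 * y1 + x2 * y2 + x3 * y3) ^ 2 ≤
    (x1 * x1 + x2 * x2 + x3 * x3) * (y1 * y1 + y2 * y2 + y3 * y3) := by
  nlinarith [sq_nonneg (x1 * y2 - x2 * y1), sq_nonneg (x1 * y3 - x3 * y1),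
    sq_nonneg (x2 * y3 - x3 * y2)]

theorem had_real (x1 x2 x3 y1 y2 y3 z1 z2 z3 : ℝ) :
    (x1 * (y2 * z3 - y3 * z2) + x2 * (y3 * z1 - y1 * z3) + x3 * (y1 * z2 - y2 * z1)) ^ 2 ≤
    (x1 * x1 + x2 * x2 + x3 * x3) * (y1 * y1 + y2 * y2 + y3 * y3) *
      (z1 * z1 + z2 * z2 + z3 * z3) := by
  refine (cs_real _ _ _ _ _ _).trans ?_
  rw [mul_assoc]
  apply mul_le_mul_of_nonneg_left
  · nlinarith [sq_nonneg (y1 * z1 + y2 * z2 + y3 * z3)]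
  · nlinarith [mul_self_nonneg x1, mul_self_nonneg x2, mul_self_nonneg x3]

theorem had (a b α β : ℝ) (u v w : Fin 3 → ℤ) :
    (dd u v w : ℝ) ^ 2 * (α ^ 2 * β) ^ 2 ≤
      ip a b α β u u * ip a b α β v v * ip a b α β w w := by
  have := had_real (α * u 0) (α * u 1) (zf a b β u) (α * v 0) (α * v 1) (zf a b β v)
    (α * w 0) (α * w 1) (zf a b β w)
  refine le_of_eq_of_le ?_ this
  unfold dd zf; push_cast; ring

theorem IsMinB.defect {a b α β : ℝ} (hα : 0 < α) (hβ : 0 < β) {u v w : Fin 3 → ℤ}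
    (h : IsMinB a b α β u v w) :
    ip a b α β u u * ip a b α β v v * ip a b α β w w ≤ 16 * (α ^ 2 * β) ^ 2 := by
  have hd := gram_det a b α β u v w
  have h1 : (dd u v w : ℝ) ^ 2 = 1 := by exact_mod_cast h.1
  rw [h1, one_mul] at hd
  rw [← hd]
  have r1 := h.red
  have r2 := h.rot.red
  have r3 := h.rot.rot.red
  rw [ip_comm' a b α β v u, ip_comm' a b α β w u] at r2
  rw [ip_comm' a b α β w u, ip_comm' a b α β w v] at r3
  have k (s t : ℤ) := And.intro (r1 s t) (And.intro (r2 s t) (r3 s t))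
  have p10 := k 1 0
  have p01 := k 0 1
  have m10 := k (-1) 0
  have m01 := k 0 (-1)
  have pp := k 1 1
  have pm := k 1 (-1)
  have mp := k (-1) 1
  have mm := k (-1) (-1)
  push_cast at p10 p01 m10 m01 pp pm mp mm
  apply aux_gram
  · exact ip_pos a b α β hα hβ _ (dd_ne h.1)
  · exact ip_pos a b α β hα hβ _ (dd_ne h.rot.1)
  · exact ip_pos a b α β hα hβ _ (dd_ne h.rot.rot.1)
  · rw [abs_le]; constructor <;> linarith
  · rw [abs_le]; constructor <;> linarith
  · rw [abs_le]; constructor <;> linarith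
  · rw [abs_le]; constructor <;> linarith
  · rw [abs_le]; constructor <;> linarith
  · rw [abs_le]; constructor <;> linarith
  · intro M hM
    simp only [List.mem_cons, List.not_mem_nil, or_false] at hM
    rcases hM with rfl | rfl | rfl
    · refine ⟨?_, ?_, ?_, ?_⟩ <;> linarith
    · refine ⟨?_, ?_, ?_, ?_⟩ <;> linarith
    · refine ⟨?_, ?_, ?_, ?_⟩ <;> linarith

theorem expand (v u1 u2 u3 : Fin 3 → ℤ) (h : dd u1 u2 u3 ^ 2 = 1) :
    v = (dd u1 u2 u3 * dd v u2 u3) • u1 + (dd u1 u2 u3 * dd v u3 u1) • u2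
      + (dd u1 u2 u3 * dd v u1 u2) • u3 := by
  ext i
  simp only [Pi.add_apply, Pi.smul_apply, smul_eq_mul]
  have : v i * dd u1 u2 u3 = dd v u2 u3 * u1 i + dd v u3 u1 * u2 i + dd v u1 u2 * u3 i := by
    unfold dd; fin_cases i <;> simp <;> ring
  linear_combination (-(v i)) * h + dd u1 u2 u3 * this

theorem gap_finite_card (v₁ v₂ v₃ : Fin 3 → ℤ) (N₁ N₂ N₃ : ℕ) :
    (gap v₁ v₂ v₃ N₁ N₂ N₃).Finite ∧
      (gap v₁ v₂ v₃ N₁ N₂ N₃).ncard ≤ (2 * N₁ + 1) * (2 * N₂ + 1) * (2 * N₃ + 1) := by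
  classical
  let s : Finset (ℤ × ℤ × ℤ) := Finset.Icc (-(N₁ : ℤ)) N₁ ×ˢ Finset.Icc (-(N₂ : ℤ)) N₂ ×ˢ
    Finset.Icc (-(N₃ : ℤ)) N₃
  let t : Finset (Fin 3 → ℤ) := s.image fun p => p.1 • v₁ + p.2.1 • v₂ + p.2.2 • v₃
  have hsub : gap v₁ v₂ v₃ N₁ N₂ N₃ ⊆ (t : Set (Fin 3 → ℤ)) := by
    rintro x ⟨n₁, n₂, n₃, h1, h2, h3, rfl⟩
    simp only [t, s, Finset.coe_image, Set.mem_image]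
    refine ⟨(n₁, n₂, n₃), ?_, rfl⟩
    simp [Finset.mem_Icc, abs_le.1 h1, abs_le.1 h2, abs_le.1 h3]
  refine ⟨t.finite_toSet.subset hsub, ?_⟩
  refine (Set.ncard_le_ncard hsub t.finite_toSet).trans ?_
  rw [Set.ncard_coe_finset]
  refine Finset.card_image_le.trans ?_
  simp only [s, Finset.card_product, Int.card_Icc]
  rw [mul_assoc]
  apply le_of_eq
  congr 1
  · omega
  · congr 1 <;> omega

theorem side_bound (q n X : ℝ) (hq : 0 < q) (hX : q * X ≤ 48) (hn : n ^ 2 ≤ X) :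
    |n| ≤ 7 / Real.sqrt q := by
  rw [le_div_iff₀ (Real.sqrt_pos.2 hq)]
  apply abs_le_of_sq_le_sq' _ (by norm_num) |>.2
  rw [mul_pow, Real.sq_sqrt hq.le, sq_abs]
  nlinarith

/-- all structure, given lower bound for the shortest vector -/
theorem main_aux (a b : ℝ) (Q : ℕ) (δ : ℝ) (hQ : 0 < Q) (hδ : 0 < δ)
    (hlow : ∀ v : Fin 3 → ℤ, v ≠ 0 →
      4 * ((1 / (Q : ℝ)) ^ 2 * (1 / δ)) ≤ ip a b (1 / (Q : ℝ)) (1 / δ) v v) :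
    ∃ (N₁ N₂ N₃ : ℕ) (v₁ v₂ v₃ : Fin 3 → ℤ),
          0 < N₁ ∧ 0 < N₂ ∧ 0 < N₃ ∧
          LinearIndependent ℤ ![v₁, v₂, v₃] ∧
          dualBohrSet a b Q δ ⊆ gap v₁ v₂ v₃ N₁ N₂ N₃ ∧
          ((gap v₁ v₂ v₃ N₁ N₂ N₃).ncard : ℝ) ≤ 13824 * δ * (Q : ℝ) ^ 2 ∧
          ((dualBohrSet a b Q δ).ncard : ℝ) ≤ 13824 * δ * (Q : ℝ) ^ 2 := by
  have hQ' : (0 : ℝ) < Q := by exact_mod_cast hQ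
  set α : ℝ := 1 / Q with hα'
  set β : ℝ := 1 / δ with hβ'
  have hα : 0 < α := by positivity
  have hβ : 0 < β := by positivity
  obtain ⟨u, v, w, h⟩ := exists_minB a b α β hα hβ
  have hdef := h.defect hα hβ
  have hhad := had a b α β u v w
  have hd1 : (dd u v w : ℝ) ^ 2 = 1 := by exact_mod_cast h.1
  rw [hd1, one_mul] at hhad
  have hu := ip_pos a b α β hα hβ _ (dd_ne h.1)
  have hv := ip_pos a b α β hα hβ _ (dd_ne h.rot.1)
  have hw := ip_pos a b α β hα hβ _ (dd_ne h.rot.rot.1)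
  have lu := hlow _ (dd_ne h.1)
  have lv := hlow _ (dd_ne h.rot.1)
  have lw := hlow _ (dd_ne h.rot.rot.1)
  have hsub0 : ∀ x ∈ dualBohrSet a b Q δ, ip a b α β x x ≤ 3 := by
    rintro x ⟨h0, h1, h2⟩
    have e0 : |α * (x 0 : ℝ)| ≤ 1 := by
      have : |(x 0 : ℝ)| ≤ Q := by exact_mod_cast h0
      rw [abs_mul, abs_of_pos hα, hα', one_div_mul_eq_div, div_le_one hQ']; exact this
    have e1 : |α * (x 1 : ℝ)| ≤ 1 := by
      have : |(x 1 : ℝ)| ≤ Q := by exact_mod_cast h1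
      rw [abs_mul, abs_of_pos hα, hα', one_div_mul_eq_div, div_le_one hQ']; exact this
    have e2 : |zf a b β x| ≤ 1 := by
      unfold zf
      rw [abs_mul, abs_of_pos hβ, hβ', one_div_mul_eq_div, div_le_one hδ]; exact h2
    unfold ip
    rw [abs_le] at e0 e1 e2
    nlinarith
  set D := α ^ 2 * β with hD'
  have hD : 0 < D := by positivity
  have hco : ∀ x p q r : Fin 3 → ℤ, ip a b α β x x ≤ 3 → 0 < ip a b α β p p →
      0 < ip a b α β q q → 0 < ip a b α β r r →
      ip a b α β r r * ip a b α β p p * ip a b α β q q ≤ 16 * D ^ 2 →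
      |((dd u v w * dd x p q : ℤ) : ℝ)| ≤ 7 / Real.sqrt (ip a b α β r r) := by
    intro x p q r hx hp hq hr hpr
    have hh := had a b α β x p q
    rw [← hD'] at hh
    apply side_bound _ _ ((dd x p q : ℝ) ^ 2) hr
    · have hpq := mul_pos hp hq
      have : (dd x p q : ℝ) ^ 2 * D ^ 2 ≤ 3 * (ip a b α β p p * ip a b α β q q) := by nlinarith
      have h3 : ip a b α β r r * (dd x p q : ℝ) ^ 2 * D ^ 2 ≤ 48 * D ^ 2 := by nlinarith
      exact le_of_mul_le_mul_right h3 (by positivity)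
    · push_cast
      rw [mul_pow, hd1, one_mul]
  have hsmall : ∀ x y z : ℝ, 4 * D ≤ y → 4 * D ≤ z → 0 < x → x * y * z ≤ 16 * D ^ 2 → x ≤ 1 := by
    intro x y z hy hz hx hxyz
    have : 16 * D ^ 2 ≤ y * z := by nlinarith
    have h2 : x * (16 * D ^ 2) ≤ 1 * (16 * D ^ 2) := by nlinarith
    exact le_of_mul_le_mul_right h2 (by positivity)
  have su := hsmall _ _ _ lv lw hu hdef
  have sv := hsmall _ _ _ lw lu hv (by linarith)
  have sw := hsmall _ _ _ lu lv hw (by linarith)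
  have hN : ∀ q : ℝ, 0 < q → q ≤ 1 → 0 < ⌈7 / Real.sqrt q⌉₊ ∧
      (2 * (⌈7 / Real.sqrt q⌉₊ : ℝ) + 1) ≤ 24 / Real.sqrt q := by
    intro q hq hq1
    have hs := Real.sqrt_pos.2 hq
    have hs1 : Real.sqrt q ≤ 1 := Real.sqrt_le_one.2 hq1
    refine ⟨Nat.ceil_pos.2 (by positivity), ?_⟩
    have h1 := (Nat.ceil_lt_add_one (a := 7 / Real.sqrt q) (by positivity)).le
    have h2 : 1 ≤ 1 / Real.sqrt q := by rw [le_div_iff₀ hs]; linarith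
    have e1 : 7 / Real.sqrt q = 7 * (1 / Real.sqrt q) := by ring
    have e2 : 24 / Real.sqrt q = 24 * (1 / Real.sqrt q) := by ring
    rw [e2]; rw [e1] at h1 ⊢
    linarith
  have hint : ∀ (n : ℤ) (y : ℝ), |(n : ℝ)| ≤ y → |n| ≤ ((⌈y⌉₊ : ℕ) : ℤ) := by
    intro n y hn
    have : ((|n| : ℤ) : ℝ) ≤ (⌈y⌉₊ : ℝ) := by push_cast; exact hn.trans (Nat.le_ceil _)
    exact_mod_cast this
  obtain ⟨pu, bu⟩ := hN _ hu su
  obtain ⟨pv, bv⟩ := hN _ hv sv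
  obtain ⟨pw, bw⟩ := hN _ hw sw
  set qu := ip a b α β u u
  set qv := ip a b α β v v
  set qw := ip a b α β w w
  obtain ⟨gf, gc⟩ := gap_finite_card u v w ⌈7 / Real.sqrt qu⌉₊ ⌈7 / Real.sqrt qv⌉₊ ⌈7 / Real.sqrt qw⌉₊
  have hsub : dualBohrSet a b Q δ ⊆ gap u v w ⌈7 / Real.sqrt qu⌉₊ ⌈7 / Real.sqrt qv⌉₊ ⌈7 / Real.sqrt qw⌉₊ := by
    intro x hx
    have hx3 := hsub0 x hx
    exact ⟨_, _, _, hint _ _ (hco x v w u hx3 hv hw hu hdef),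
      hint _ _ (hco x w u v hx3 hw hu hv (by linarith)),
      hint _ _ (hco x u v w hx3 hu hv hw (by linarith)), expand x u v w h.1⟩
  have hcard : ((gap u v w ⌈7 / Real.sqrt qu⌉₊ ⌈7 / Real.sqrt qv⌉₊ ⌈7 / Real.sqrt qw⌉₊).ncard : ℝ)
      ≤ 13824 * δ * (Q : ℝ) ^ 2 := by
    have hDle : D ≤ Real.sqrt qu * Real.sqrt qv * Real.sqrt qw := by
      rw [← Real.sqrt_mul hu.le, ← Real.sqrt_mul (by positivity)]
      exact Real.le_sqrt_of_sq_le hhad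
    have hsu := Real.sqrt_pos.2 hu
    have hsv := Real.sqrt_pos.2 hv
    have hsw := Real.sqrt_pos.2 hw
    calc ((gap u v w ⌈7 / Real.sqrt qu⌉₊ ⌈7 / Real.sqrt qv⌉₊ ⌈7 / Real.sqrt qw⌉₊).ncard : ℝ)
        ≤ (2 * (⌈7 / Real.sqrt qu⌉₊ : ℝ) + 1) * (2 * (⌈7 / Real.sqrt qv⌉₊ : ℝ) + 1)
          * (2 * (⌈7 / Real.sqrt qw⌉₊ : ℝ) + 1) := by exact_mod_cast gc
      _ ≤ (24 / Real.sqrt qu) * (24 / Real.sqrt qv) * (24 / Real.sqrt qw) := by gcongr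
      _ = 13824 / (Real.sqrt qu * Real.sqrt qv * Real.sqrt qw) := by field_simp; norm_num
      _ ≤ 13824 / D := by gcongr
      _ = 13824 * δ * (Q : ℝ) ^ 2 := by rw [hD', hα', hβ']; field_simp
  refine ⟨_, _, _, u, v, w, pu, pv, pw, ?_, hsub, hcard, ?_⟩
  · have hdet : (Matrix.of ![u, v, w]).det ≠ 0 := by
      rw [Matrix.det_fin_three]
      have hne : dd u v w ≠ 0 := by
        intro h0
        have := h.1
        rw [h0] at this
        norm_num at this
      intro h0
      apply hne
      rw [← h0]
      simp [dd]
      ring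
    exact Matrix.linearIndependent_rows_of_det_ne_zero hdet
  · refine le_trans ?_ hcard
    exact_mod_cast Set.ncard_le_ncard hsub gf

theorem low_aux (a b : ℝ) (hab : DualExpLtFive a b) :
    ∃ Q₀ : ℕ, ∀ Q : ℕ, Q₀ ≤ Q → ∀ δ : ℝ,
        1 * (Q : ℝ) ^ (-(1 / 2) : ℝ) * (Real.log Q) ^ (-(3 / 2) : ℝ) ≤ δ →
        δ < (Q : ℝ) / 1000 → 0 < Q ∧ 0 < δ ∧ ∀ v : Fin 3 → ℤ, v ≠ 0 →
      4 * ((1 / (Q : ℝ)) ^ 2 * (1 / δ)) ≤ ip a b (1 / (Q : ℝ)) (1 / δ) v v := by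
  obtain ⟨w, κ, hw3, hw5, hκ, hdio⟩ := aux_dioph a b hab
  set η : ℝ := (5 - w) / 16 with hη'
  have hη : 0 < η := by rw [hη']; linarith
  set θ : ℝ := 1 - (1 / 2 + η) * ((w - 1) / 2) with hθ'
  have hθ : 0 < θ := by rw [hθ', hη']; nlinarith
  have hlog : ∀ᶠ Q : ℕ in Filter.atTop, (Real.log Q) ^ (3 / 2 : ℝ) ≤ (Q : ℝ) ^ η := by
    have h1 := (isLittleO_log_rpow_rpow_atTop (3 / 2) hη).bound one_pos
    have h2 := tendsto_natCast_atTop_atTop (R := ℝ) |>.eventually h1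
    filter_upwards [h2] with Q hQ
    rw [one_mul, Real.norm_eq_abs, Real.norm_eq_abs] at hQ
    exact (le_abs_self _).trans (hQ.trans_eq (abs_of_nonneg (by positivity)))
  have hbig : ∀ᶠ Q : ℕ in Filter.atTop, 2 * 4 ^ w / κ < (Q : ℝ) ^ θ :=
    ((tendsto_rpow_atTop hθ).comp (tendsto_natCast_atTop_atTop (R := ℝ))).eventually_gt_atTop _
  obtain ⟨Q₀, hQ₀⟩ := Filter.eventually_atTop.1
    (hlog.and (hbig.and (Filter.eventually_ge_atTop 3)))
  refine ⟨Q₀, fun Q hQ δ hδ1 hδ2 => ?_⟩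
  obtain ⟨hl, hb, hQ3⟩ := hQ₀ Q hQ
  have hQ3' : (3 : ℝ) ≤ Q := by exact_mod_cast hQ3
  have hQ0 : (0 : ℝ) < Q := by linarith
  have hlogpos : 0 < Real.log Q := Real.log_pos (by linarith)
  have hδlow : (Q : ℝ) ^ (-(1 / 2 + η)) ≤ δ := by
    refine le_trans ?_ hδ1
    rw [one_mul, neg_add, Real.rpow_add hQ0]
    apply mul_le_mul_of_nonneg_left _ (by positivity)
    rw [Real.rpow_neg hQ0.le, Real.rpow_neg hlogpos.le]
    exact inv_anti₀ (by positivity) hl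
  have hδ : 0 < δ := lt_of_lt_of_le (by positivity) hδlow
  refine ⟨by omega, hδ, fun v hv => ?_⟩
  by_cases hxy : v 0 = 0 ∧ v 1 = 0
  · have hz : v 2 ≠ 0 := by
      intro hz; apply hv; ext i; fin_cases i
      · exact hxy.1
      · exact hxy.2
      · exact hz
    have hz2 : (1 : ℝ) ≤ (v 2 : ℝ) ^ 2 := by
      have : 1 ≤ (v 2) ^ 2 := by have := pow_pos (abs_pos.2 hz) 2; rw [sq_abs] at this; omega
      exact_mod_cast this
    have : ip a b (1 / (Q : ℝ)) (1 / δ) v v = (v 2 : ℝ) ^ 2 / δ ^ 2 := by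
      unfold ip zf; rw [hxy.1, hxy.2]; push_cast; field_simp; ring
    rw [this]
    have e : 4 * ((1 / (Q : ℝ)) ^ 2 * (1 / δ)) = (4 * δ / Q ^ 2) / δ ^ 2 := by field_simp
    rw [e]
    apply div_le_div_of_nonneg_right _ (by positivity)
    refine le_trans ?_ hz2
    rw [div_le_one (by positivity)]
    nlinarith
  · by_contra hlt
    push Not at hlt
    have hd := hdio (v 0) (v 1) (v 2) hxy
    set L : ℝ := |(v 0 : ℝ) * a + v 1 * b - v 2| with hL
    have hip : ip a b (1 / (Q : ℝ)) (1 / δ) v v =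
        (v 0 : ℝ) ^ 2 / Q ^ 2 + (v 1 : ℝ) ^ 2 / Q ^ 2 + L ^ 2 / δ ^ 2 := by
      rw [hL, sq_abs]; unfold ip zf; field_simp
    rw [hip] at hlt
    have n0 : 0 ≤ (v 0 : ℝ) ^ 2 / Q ^ 2 := by positivity
    have n1 : 0 ≤ (v 1 : ℝ) ^ 2 / Q ^ 2 := by positivity
    have n2 : 0 ≤ L ^ 2 / δ ^ 2 := by positivity
    have e : 4 * ((1 / (Q : ℝ)) ^ 2 * (1 / δ)) = (4 / δ) / Q ^ 2 := by field_simp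
    have e' : 4 * ((1 / (Q : ℝ)) ^ 2 * (1 / δ)) = (4 * δ / Q ^ 2) / δ ^ 2 := by field_simp
    have b0 : (v 0 : ℝ) ^ 2 ≤ 4 / δ := by
      have : (v 0 : ℝ) ^ 2 / Q ^ 2 ≤ (4 / δ) / Q ^ 2 := by linarith
      exact (div_le_div_iff_of_pos_right (by positivity)).1 this
    have b1 : (v 1 : ℝ) ^ 2 ≤ 4 / δ := by
      have : (v 1 : ℝ) ^ 2 / Q ^ 2 ≤ (4 / δ) / Q ^ 2 := by linarith
      exact (div_le_div_iff_of_pos_right (by positivity)).1 this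
    have b2 : L ^ 2 ≤ 4 * δ / Q ^ 2 := by
      have : L ^ 2 / δ ^ 2 ≤ (4 * δ / Q ^ 2) / δ ^ 2 := by linarith
      exact (div_le_div_iff_of_pos_right (by positivity)).1 this
    set s : ℝ := δ ^ (1 / 2 : ℝ) with hs
    have hspos : 0 < s := by positivity
    have hss : s ^ 2 = δ := by
      rw [hs, ← Real.rpow_natCast, ← Real.rpow_mul hδ.le]; norm_num
    have c0 : |(v 0 : ℝ)| ≤ 2 / s := by
      apply abs_le_of_sq_le_sq _ (by positivity)
      rw [div_pow, hss]; linarith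
    have c1 : |(v 1 : ℝ)| ≤ 2 / s := by
      apply abs_le_of_sq_le_sq _ (by positivity)
      rw [div_pow, hss]; linarith
    have c2 : L ≤ 2 * s / Q := by
      refine (le_abs_self L).trans (abs_le_of_sq_le_sq ?_ (by positivity))
      rw [div_pow, mul_pow, hss]; linarith
    set N : ℝ := ((|v 0| + |v 1| : ℤ) : ℝ) with hN
    have hN1 : 1 ≤ N := by
      have : 1 ≤ |v 0| + |v 1| := by
        by_contra h
        apply hxy
        have h1 := abs_nonneg (v 0)
        have h2 := abs_nonneg (v 1)
        exact ⟨abs_eq_zero.1 (by omega), abs_eq_zero.1 (by omega)⟩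
      rw [hN]
      exact_mod_cast this
    have hN2 : N ≤ 4 / s := by
      rw [hN]; push_cast
      have : 4 / s = 2 / s + 2 / s := by ring
      linarith
    have d1 : (4 / s) ^ (-w) ≤ N ^ (-w) :=
      Real.rpow_le_rpow_of_nonpos (by linarith) hN2 (by linarith)
    have d2 : (4 / s) ^ (-w) = s ^ w / 4 ^ w := by
      rw [Real.rpow_neg (by positivity), Real.div_rpow (by norm_num) hspos.le, inv_div]
    have d3 : κ * (s ^ w / 4 ^ w) ≤ 2 * s / Q := by
      rw [← d2]
      exact (mul_le_mul_of_nonneg_left d1 hκ.le).trans (hd.trans c2)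
    have d4 : s ^ w = s ^ (w - 1) * s := by
      rw [Real.rpow_sub_one hspos.ne']; field_simp
    have d5 : (Q : ℝ) * s ^ (w - 1) ≤ 2 * 4 ^ w / κ := by
      rw [d4] at d3
      have h4 : (0 : ℝ) < 4 ^ w := by positivity
      rw [le_div_iff₀ hκ]
      rw [le_div_iff₀ hQ0] at d3
      have : (Q * s ^ (w - 1) * κ) * (s / 4 ^ w) ≤ (2 * 4 ^ w) * (s / 4 ^ w) := by
        calc (Q * s ^ (w - 1) * κ) * (s / 4 ^ w) = κ * (s ^ (w - 1) * s / 4 ^ w) * Q := by ring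
          _ ≤ 2 * s := d3
          _ = (2 * 4 ^ w) * (s / 4 ^ w) := by field_simp
      exact le_of_mul_le_mul_right this (by positivity)
    have d6 : (Q : ℝ) ^ (-((1 / 2 + η) * ((w - 1) / 2))) ≤ s ^ (w - 1) := by
      have := Real.rpow_le_rpow (by positivity) hδlow (show 0 ≤ (w - 1) / 2 by linarith)
      rw [← Real.rpow_mul hQ0.le] at this
      rw [hs, ← Real.rpow_mul hδ.le]
      convert this using 2 <;> ring
    have d7 : (Q : ℝ) ^ θ = Q * (Q : ℝ) ^ (-((1 / 2 + η) * ((w - 1) / 2))) := by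
      rw [hθ', sub_eq_add_neg, Real.rpow_add hQ0, Real.rpow_one]
    have d8 : (Q : ℝ) ^ θ ≤ Q * s ^ (w - 1) := by
      rw [d7]; exact mul_le_mul_of_nonneg_left d6 hQ0.le
    linarith

/-- **Outer structure of dual Bohr sets** (Chow–Yang, Lemma 4.1). -/
theorem dual_bohr_set_structure (a b : ℝ) (hab : DualExpLtFive a b) :
    ∃ Q₀ : ℕ, ∃ c C : ℝ, 0 < c ∧ 0 < C ∧
      ∀ Q : ℕ, Q₀ ≤ Q → ∀ δ : ℝ,
        c * (Q : ℝ) ^ (-(1 / 2) : ℝ) * (Real.log Q) ^ (-(3 / 2) : ℝ) ≤ δ →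
        δ < (Q : ℝ) / 1000 →
        ∃ (N₁ N₂ N₃ : ℕ) (v₁ v₂ v₃ : Fin 3 → ℤ),
          0 < N₁ ∧ 0 < N₂ ∧ 0 < N₃ ∧
          LinearIndependent ℤ ![v₁, v₂, v₃] ∧
          dualBohrSet a b Q δ ⊆ gap v₁ v₂ v₃ N₁ N₂ N₃ ∧
          ((gap v₁ v₂ v₃ N₁ N₂ N₃).ncard : ℝ) ≤ C * δ * (Q : ℝ) ^ 2 ∧
          ((dualBohrSet a b Q δ).ncard : ℝ) ≤ C * δ * (Q : ℝ) ^ 2 := by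
  obtain ⟨Q₀, h⟩ := low_aux a b hab
  refine ⟨Q₀, 1, 13824, one_pos, by norm_num, fun Q hQ δ h1 h2 => ?_⟩
  obtain ⟨hQ0, hδ, hlow⟩ := h Q hQ δ h1 h2
  exact main_aux a b Q δ hQ0 hδ hlow

end
end

section
/- Let (a,b) ∈ ℝ² satisfy ω*(a,b) < 5, let I ⊂ ℝ be a bounded interval, and let ψ : ℕ → ℝ_{≥0} be a decreasing function with q^{−1}(log q)^{−3} < ψ(q) < q^{−1}(log q)^{−1} for all sufficiently large q. For t ∈ ℕ and m ∈ ℤ, let N(t,m) be the number of integer triples (q, p₁, p₂) with 2^t ≤ q < 2^{t+1} for which there exists β ∈ I such that |aβ + b − p₁/q| < 2^m √(2ψ(2^t)) / 2^t and |β − p₂/q| < 2^{−m} √(2ψ(2^t)) / 2^t. Then there is a constant C = C(a,b,I,ψ) such that, for all sufficiently large t and all m ∈ ℤ with 2^{|m|} t √(ψ(2^t)) ≤ 1, one has N(t,m) ≤ C · 2^{|m|} · 2^{2t} · √(ψ(2^t)). -/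
/-!
Counting rational points near general lines (Chow–Yang, Corollary 4.2):
under `ω*(a,b) < 5` and the standing assumptions on `ψ`, for large `t` and
`m ∈ ℤ` with `2^{|m|} t √ψ(2^t) ≤ 1`, the count `N(t,m)` satisfies
`N(t,m) ≪ 2^{|m|} 2^{2t} √ψ(2^t)`.
-/

open MeasureTheory

noncomputable section

/-- The set of triples `(q, p₁, p₂)` counted by `N(t,m)`, for the line
`α = aβ + b`, `β` ranging over the interval `I`. -/
def countedTriples (a b : ℝ) (I : Set ℝ) (ψ : ℕ → ℝ) (t : ℕ) (m : ℤ) :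
    Set (ℤ × ℤ × ℤ) :=
  {v | (2 : ℤ) ^ t ≤ v.1 ∧ v.1 < (2 : ℤ) ^ (t + 1) ∧
    ∃ β ∈ I,
      |a * β + b - (v.2.1 : ℝ) / (v.1 : ℝ)|
        < (2 : ℝ) ^ m * Real.sqrt (2 * ψ (2 ^ t)) / 2 ^ t ∧
      |β - (v.2.2 : ℝ) / (v.1 : ℝ)|
        < (2 : ℝ) ^ (-m) * Real.sqrt (2 * ψ (2 ^ t)) / 2 ^ t}

lemma one_le_norm1 (p : ℤ × ℤ) (hp : p ≠ 0) : (1:ℝ) ≤ ((|p.1| + |p.2| : ℤ) : ℝ) := by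
  have : (1:ℤ) ≤ |p.1| + |p.2| := by
    by_contra h
    apply hp
    have h1 := abs_nonneg p.1
    have h2 := abs_nonneg p.2
    have h3 : |p.1| = 0 := by omega
    have h4 : |p.2| = 0 := by omega
    exact Prod.ext (abs_eq_zero.mp h3) (abs_eq_zero.mp h4)
  exact_mod_cast this

lemma dual_lower (a b : ℝ) (hab : DualExpLtFive a b) :
    ∃ w : ℝ, 1 ≤ w ∧ w < 5 ∧ ∃ c : ℝ, 0 < c ∧ ∀ p : ℤ × ℤ, p ≠ 0 → ∀ z : ℤ,
      c * ((|p.1| + |p.2| : ℤ) : ℝ) ^ (-w) ≤ |p.1 * a + p.2 * b - z| := by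
  obtain ⟨w, hw, hfin⟩ := hab
  set S := {p : ℤ × ℤ | p ≠ 0 ∧
      distNearestInt (p.1 * a + p.2 * b) ≤ ((|p.1| + |p.2| : ℤ) : ℝ) ^ (-w)} with hS
  have hpos : ∀ p ∈ S, 0 < distNearestInt (p.1 * a + p.2 * b) := by
    intro p hp
    rcases (abs_nonneg ((p.1 * a + p.2 * b) - round ((p.1:ℝ) * a + p.2 * b))).lt_or_eq with h | h
    · exact h
    exfalso
    have h0 : (p.1 * a + p.2 * b) - round ((p.1:ℝ) * a + p.2 * b) = 0 := abs_eq_zero.mp h.symm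
    set r := round ((p.1:ℝ) * a + p.2 * b)
    have hinj : Function.Injective (fun k : ℕ => (((k:ℤ)+1) * p.1, ((k:ℤ)+1) * p.2)) := by
      intro k l hkl
      simp only [Prod.mk.injEq] at hkl
      have hne : p.1 ≠ 0 ∨ p.2 ≠ 0 := by
        by_contra hc
        push Not at hc
        exact hp.1 (Prod.ext hc.1 hc.2)
      rcases hne with hne | hne
      · have := mul_right_cancel₀ hne hkl.1
        omega
      · have := mul_right_cancel₀ hne hkl.2
        omega
    refine (Set.infinite_of_injective_forall_mem hinj (s := S) ?_) hfin
    intro k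
    have hne0 : ((((k:ℤ)+1) * p.1, ((k:ℤ)+1) * p.2) : ℤ × ℤ) ≠ 0 := by
      intro hc
      have h1 := congrArg Prod.fst hc
      have h2 := congrArg Prod.snd hc
      simp only [Prod.fst_zero, Prod.snd_zero, mul_eq_zero] at h1 h2
      apply hp.1
      refine Prod.ext ?_ ?_
      · rcases h1 with h1 | h1
        · omega
        · exact h1
      · rcases h2 with h1 | h1
        · omega
        · exact h1
    refine ⟨hne0, ?_⟩
    have : distNearestInt (((((k:ℤ)+1) * p.1 : ℤ):ℝ) * a + ((((k:ℤ)+1) * p.2 : ℤ):ℝ) * b) ≤ 0 := by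
      refine (round_le _ (((k:ℤ)+1) * r)).trans ?_
      push_cast
      rw [show ((k:ℝ)+1) * p.1 * a + ((k:ℝ)+1)*p.2*b - ((k:ℝ)+1)*r = (k+1) * (p.1 * a + p.2*b - r) by ring, h0]
      simp
    refine this.trans ?_
    have := one_le_norm1 _ hne0
    positivity
  obtain ⟨c0, hc0, hc⟩ : ∃ c0 : ℝ, 0 < c0 ∧ ∀ p ∈ S, c0 ≤ distNearestInt (p.1 * a + p.2 * b) := by
    rcases S.eq_empty_or_nonempty with h | h
    · exact ⟨1, one_pos, by simp [h]⟩
    · obtain ⟨p, hp, hmin⟩ := Set.exists_min_image S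
        (fun p : ℤ × ℤ => distNearestInt (p.1 * a + p.2 * b)) hfin h
      exact ⟨_, hpos p hp, hmin⟩
  refine ⟨max w 1, le_max_right _ _, max_lt hw (by norm_num), min c0 1, lt_min hc0 one_pos, ?_⟩
  intro p hp z
  have h1 := one_le_norm1 p hp
  refine le_trans ?_ (round_le _ z)
  set X := ((|p.1| + |p.2| : ℤ) : ℝ)
  have hX : X ^ (-max w 1) ≤ 1 := Real.rpow_le_one_of_one_le_of_nonpos h1
    (by have := le_max_right w 1; linarith)
  have hX0 : 0 ≤ X ^ (-max w 1) := by positivity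
  have hXw : X ^ (-max w 1) ≤ X ^ (-w) := Real.rpow_le_rpow_of_exponent_le h1
    (by have := le_max_left w 1; linarith)
  by_cases hpS : p ∈ S
  · refine le_trans ?_ (hc p hpS)
    calc min c0 1 * X ^ (-max w 1) ≤ c0 * 1 := by
          apply mul_le_mul (min_le_left _ _) hX hX0 hc0.le
      _ = c0 := mul_one _
  · have : X ^ (-w) < distNearestInt (p.1 * a + p.2 * b) := by
      by_contra hcon
      exact hpS ⟨hp, not_lt.mp hcon⟩
    refine le_trans ?_ (hXw.trans this.le)
    calc min c0 1 * X ^ (-max w 1) ≤ 1 * X ^ (-max w 1) := by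
          gcongr
          exact min_le_right _ _
      _ = _ := one_mul _

lemma thue (n : ℕ) (hn : 1 ≤ n) (r₁ r₂ : ℤ) : ∃ p : ℤ × ℤ, p ≠ 0 ∧
    |p.1| ≤ Nat.sqrt n ∧ |p.2| ≤ Nat.sqrt n ∧ (n:ℤ) ∣ p.1 * r₁ + p.2 * r₂ := by
  set k := Nat.sqrt n
  have hk : n < (k+1)*(k+1) := Nat.lt_succ_sqrt n
  obtain ⟨x, hx, y, hy, hxy, he⟩ := Finset.exists_ne_map_eq_of_card_lt_of_maps_to
    (s := Finset.range (k+1) ×ˢ Finset.range (k+1)) (t := Finset.Ico (0:ℤ) n)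
    (by simpa using hk) (f := fun x : ℕ × ℕ => ((x.1:ℤ) * r₁ + x.2 * r₂) % n)
    (by
      intro x _
      simp only [Finset.coe_Ico, Set.mem_Ico]
      exact ⟨Int.emod_nonneg _ (by omega), Int.emod_lt_of_pos _ (by omega)⟩)
  simp only [Finset.mem_product, Finset.mem_range] at hx hy
  refine ⟨((x.1:ℤ) - y.1, (x.2:ℤ) - y.2), ?_, ?_, ?_, ?_⟩
  · intro h
    have h1 := congrArg Prod.fst h
    have h2 := congrArg Prod.snd h
    simp only [Prod.fst_zero, Prod.snd_zero] at h1 h2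
    exact hxy (Prod.ext (by omega) (by omega))
  · simp only; rw [abs_le]; omega
  · simp only; rw [abs_le]; omega
  · have := Int.ModEq.dvd (show (x.1:ℤ) * r₁ + x.2 * r₂ ≡ (y.1:ℤ) * r₁ + y.2 * r₂ [ZMOD n] from he)
    rw [← dvd_neg]
    have e : -(((x.1:ℤ) - y.1) * r₁ + ((x.2:ℤ) - y.2) * r₂) = (y.1:ℤ) * r₁ + y.2 * r₂ - ((x.1:ℤ) * r₁ + x.2 * r₂) := by ring
    rw [e]
    exact this

lemma transference (a b : ℝ) (hab : DualExpLtFive a b) :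
    ∃ κ : ℝ, 0 ≤ κ ∧ κ < 2 ∧ ∃ c : ℝ, 0 < c ∧ ∀ n : ℕ, 1 ≤ n → ∀ (r₁ r₂ : ℤ) (η : ℝ),
      |n * a - r₁| ≤ η → |n * b - r₂| ≤ η → c * (n:ℝ) ^ (-κ) ≤ η := by
  obtain ⟨w, hw1, hw5, c, hc, h⟩ := dual_lower a b hab
  refine ⟨(w-1)/2, by linarith, by linarith, c / 2 * 2 ^ (-w), by positivity, ?_⟩
  intro n hn r₁ r₂ η h1 h2
  obtain ⟨p, hp, hp1, hp2, z, hz⟩ := thue n hn r₁ r₂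
  have hη : 0 ≤ η := (abs_nonneg _).trans h1
  have hn0 : (0:ℝ) < n := by exact_mod_cast hn
  have hX1 := one_le_norm1 p hp
  have hlow := h p hp z
  set X := ((|p.1| + |p.2| : ℤ) : ℝ) with hX
  set s := Real.sqrt n with hs
  have hs0 : 0 < s := Real.sqrt_pos.mpr hn0
  have hss : s * s = n := Real.mul_self_sqrt hn0.le
  have hks : ((Nat.sqrt n : ℕ):ℝ) ≤ s := Real.nat_sqrt_le_real_sqrt
  have hXs : X ≤ 2 * s := by
    have : X ≤ 2 * ((Nat.sqrt n : ℕ):ℝ) := by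
      rw [hX]
      have : |p.1| + |p.2| ≤ 2 * (Nat.sqrt n : ℤ) := by linarith
      exact_mod_cast this
    linarith
  have hup : n * |p.1 * a + p.2 * b - z| ≤ X * η := by
    have hz' : (p.1:ℝ) * r₁ + p.2 * r₂ = n * z := by exact_mod_cast hz
    have habs : (n:ℝ) * |p.1 * a + p.2 * b - z| = |(n:ℝ) * (p.1 * a + p.2 * b - z)| := by
      rw [abs_mul, abs_of_pos hn0]
    rw [habs]
    rw [show (n:ℝ) * (p.1 * a + p.2 * b - z) = p.1 * (n * a - r₁) + p.2 * (n * b - r₂) by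
      linear_combination hz']
    refine (abs_add_le _ _).trans ?_
    rw [abs_mul, abs_mul, hX]
    push_cast
    rw [add_mul]
    gcongr
  have hXw : (2 * s) ^ (-w) ≤ X ^ (-w) :=
    Real.rpow_le_rpow_of_nonpos (by linarith) hXs (by linarith)
  have key : (n:ℝ) * (c * (2 * s) ^ (-w)) ≤ 2 * s * η := by
    calc (n:ℝ) * (c * (2 * s) ^ (-w)) ≤ n * (c * X ^ (-w)) := by gcongr
      _ ≤ n * |p.1 * a + p.2 * b - z| := by gcongr
      _ ≤ X * η := hup
      _ ≤ _ := by gcongr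
  have hpow : (n:ℝ) ^ (-((w-1)/2)) = s * s ^ (-w) := by
    rw [hs, Real.sqrt_eq_rpow, ← Real.rpow_mul hn0.le, ← Real.rpow_add hn0]
    congr 1; ring
  rw [hpow]
  rw [Real.mul_rpow (by norm_num) hs0.le, ← hss] at key
  have : s * (c / 2 * 2 ^ (-w) * (s * s ^ (-w))) ≤ s * η := by linarith
  exact le_of_mul_le_mul_left this hs0

def ee (x : ℝ) : ℂ := Complex.exp (Complex.I * ((2 * Real.pi * x : ℝ) : ℂ))

lemma ee_add (x y : ℝ) : ee (x + y) = ee x * ee y := by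
  unfold ee
  rw [← Complex.exp_add]
  congr 1
  push_cast
  ring

lemma ee_conj (x : ℝ) : (starRingEnd ℂ) (ee x) = ee (-x) := by
  unfold ee
  rw [← Complex.exp_conj]
  congr 1
  rw [map_mul, Complex.conj_I, Complex.conj_ofReal]
  push_cast
  ring

lemma ee_norm (x : ℝ) : ‖ee x‖ = 1 := by
  unfold ee
  rw [mul_comm]
  exact Complex.norm_exp_ofReal_mul_I _

lemma ee_int (z : ℤ) : ee z = 1 := by
  unfold ee
  rw [Complex.exp_eq_one_iff]
  exact ⟨z, by push_cast; ring⟩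

lemma ee_nat (n : ℕ) (x : ℝ) : ee (n * x) = ee x ^ n := by
  unfold ee
  rw [← Complex.exp_nat_mul]
  congr 1
  push_cast
  ring

lemma ee_add_int (x : ℝ) (z : ℤ) : ee (x + z) = ee x := by
  rw [ee_add, ee_int, mul_one]

lemma ee_re (x : ℝ) : (ee x).re = Real.cos (2 * Real.pi * x) := by
  unfold ee
  rw [mul_comm, Complex.exp_ofReal_mul_I_re]

def SS (L : ℕ) (x : ℝ) : ℂ := ∑ i ∈ Finset.range L, ee (i * x)

lemma SS_norm_le (L : ℕ) (x : ℝ) : ‖SS L x‖ ≤ L := by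
  unfold SS
  refine (norm_sum_le _ _).trans ?_
  simp [ee_norm]

lemma SS_norm_mul (L : ℕ) (x : ℝ) : ‖SS L x‖ * |x - round x| ≤ 1 / 2 := by
  have h1 : (ee x - 1) * SS L x = ee x ^ L - 1 := by
    unfold SS
    simp_rw [ee_nat]
    exact mul_geom_sum _ _
  have h2 : ‖ee x - 1‖ * ‖SS L x‖ ≤ 2 := by
    rw [← norm_mul, h1]
    refine (norm_sub_le _ _).trans ?_
    rw [norm_pow, ee_norm]
    norm_num
  have h3 : 4 * |x - round x| ≤ ‖ee x - 1‖ := by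
    have : ee x = ee (x - round x) := by
      rw [← ee_add_int (x - round x) (round x)]
      congr 1; ring
    rw [this]
    have hy := abs_sub_round x
    set y := x - round x
    unfold ee
    rw [Complex.norm_exp_I_mul_ofReal_sub_one]
    have hpi := Real.pi_pos
    rw [show 2 * Real.pi * y / 2 = Real.pi * y by ring, norm_mul, Real.norm_eq_abs, Real.norm_eq_abs]
    have h4 := Real.mul_abs_le_abs_sin (x := Real.pi * y) (by
      rw [abs_mul, abs_of_pos hpi]; nlinarith)
    rw [abs_mul Real.pi, abs_of_pos hpi] at h4
    have h5 : 2 / Real.pi * (Real.pi * |y|) = 2 * |y| := by field_simp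
    rw [h5] at h4
    rw [abs_two]
    linarith
  have := norm_nonneg (SS L x)
  nlinarith

lemma SS_bound (L : ℕ) (x : ℝ) :
    ‖SS L x‖ ^ 2 * (1 + (L * (x - round x)) ^ 2) ≤ 2 * (L:ℝ) ^ 2 := by
  have h1 := SS_norm_le L x
  have h2 := SS_norm_mul L x
  have h0 := norm_nonneg (SS L x)
  have h3 : ‖SS L x‖ ^ 2 ≤ (L:ℝ) ^ 2 := by gcongr
  have h4 : (‖SS L x‖ * |x - round x|) ^ 2 ≤ (1/2)^2 := by gcongr
  rw [mul_pow, sq_abs] at h4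
  have hL : (0:ℝ) ≤ (L:ℝ)^2 := by positivity
  nlinarith

lemma SS_bound' (L : ℕ) (x : ℝ) :
    ‖SS L x‖ ^ 2 ≤ 6 * (L:ℝ) ^ 2 * (1 / (1 + (⌊(L:ℝ) * (x - round x)⌋ : ℝ) ^ 2)) := by
  have h := SS_bound L x
  set u := (L:ℝ) * (x - round x)
  have h1 := Int.floor_le u
  have h2 := Int.lt_floor_add_one u
  set i : ℝ := (⌊u⌋ : ℝ)
  rw [mul_one_div, le_div_iff₀ (by positivity)]
  have : 1 + i ^ 2 ≤ 3 * (1 + u ^ 2) := by nlinarith [sq_nonneg (i + u), sq_nonneg (i-2*u)]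
  have h0 : 0 ≤ ‖SS L x‖ ^ 2 := by positivity
  nlinarith

lemma summ : Summable (fun i : ℤ => 1 / (1 + (i:ℝ) ^ 2)) := by
  refine Summable.of_norm_bounded_eventually
    (Real.summable_one_div_int_pow.mpr (show 1 < 2 by norm_num)) ?_
  have : ∀ᶠ i : ℤ in Filter.cofinite, i ≠ 0 := by
    rw [Filter.eventually_cofinite]
    simp
  filter_upwards [this] with i hi
  have hi' : (0:ℝ) < (i:ℝ) ^ 2 := by positivity
  rw [Real.norm_of_nonneg (by positivity)]
  gcongr
  linarith

lemma expand_s12 (a b : ℝ) (L H : ℕ) :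
    ∑ x ∈ (Finset.range L ×ˢ Finset.range L) ×ˢ (Finset.range L ×ˢ Finset.range L),
      ‖SS H (((x.1.1:ℝ) - x.2.1) * a + ((x.1.2:ℝ) - x.2.2) * b)‖ ^ 2
    = ∑ h ∈ Finset.range H, ∑ k ∈ Finset.range H,
      ‖SS L (((h:ℝ) - k) * a)‖ ^ 2 * ‖SS L (((h:ℝ) - k) * b)‖ ^ 2 := by
  have hn : ∀ z : ℂ, ((‖z‖ ^ 2 : ℝ) : ℂ) = z * (starRingEnd ℂ) z := by
    intro z
    rw [Complex.mul_conj, Complex.normSq_eq_norm_sq]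
  have hsq : ∀ (N : ℕ) (y : ℝ), ((‖SS N y‖ ^ 2 : ℝ) : ℂ) =
      ∑ h ∈ Finset.range N, ∑ k ∈ Finset.range N, ee (h * y) * ee (-(k * y)) := by
    intro N y
    rw [hn]
    unfold SS
    rw [map_sum, Finset.sum_mul_sum]
    simp_rw [ee_conj]
  apply Complex.ofReal_injective
  rw [Complex.ofReal_sum]
  simp_rw [hsq H]
  rw [Finset.sum_comm, Complex.ofReal_sum]
  refine Finset.sum_congr rfl fun h _ => ?_
  rw [Finset.sum_comm, Complex.ofReal_sum]
  refine Finset.sum_congr rfl fun k _ => ?_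
  rw [Complex.ofReal_mul, hsq, hsq]
  simp_rw [← Finset.sum_product']
  rw [Finset.sum_mul_sum, ← Finset.sum_product']
  refine Finset.sum_nbij' (fun x => ((x.1.1, x.2.1), (x.1.2, x.2.2)))
    (fun x => ((x.1.1, x.2.1), (x.1.2, x.2.2))) ?_ ?_ ?_ ?_ ?_
  · intro x; simp only [Finset.mem_product]; tauto
  · intro x; simp only [Finset.mem_product]; tauto
  · intro x _; rfl
  · intro x _; rfl
  · intro x _
    simp only [← ee_add]
    congr 1
    ring

lemma SS_lower (H : ℕ) (x δ : ℝ) (z : ℤ) (hx : |x - z| ≤ δ) (hδ : H * δ ≤ 1 / 8) :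
    (H:ℝ) ^ 2 / 4 ≤ ‖SS H x‖ ^ 2 := by
  have h1 : (H:ℝ) / 2 ≤ ‖SS H x‖ := by
    refine le_trans ?_ (Complex.re_le_norm _)
    unfold SS
    rw [Complex.re_sum]
    have : ∀ h ∈ Finset.range H, (1/2 : ℝ) ≤ (ee (h * x)).re := by
      intro h hh
      rw [Finset.mem_range] at hh
      have : ee (h * x) = ee (h * (x - z)) := by
        rw [← ee_add_int (h * (x - z)) (h * z)]
        congr 1; push_cast; ring
      rw [this, ee_re]
      refine le_trans ?_ Real.one_sub_sq_div_two_le_cos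
      have h2 : |(h:ℝ) * (x - z)| ≤ 1 / 8 := by
        rw [abs_mul, Nat.abs_cast]
        refine le_trans ?_ hδ
        have : (h:ℝ) ≤ H := by exact_mod_cast hh.le
        gcongr
      have h3 : ((h:ℝ) * (x - z)) ^ 2 ≤ (1/8)^2 := by
        rw [← sq_abs]; gcongr
      have hp : Real.pi ^ 2 ≤ 16 := by
        nlinarith [Real.pi_pos, Real.pi_le_four]
      nlinarith [sq_nonneg ((h:ℝ) * (x - z)), sq_nonneg Real.pi]
    have h4 := Finset.card_nsmul_le_sum _ _ _ this
    simp only [Finset.card_range, nsmul_eq_mul] at h4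
    linarith
  have : ((H:ℝ)/2)^2 ≤ ‖SS H x‖ ^ 2 := by gcongr
  linarith

lemma upper (a b : ℝ) (L H : ℕ) (hL : 1 ≤ L)
    (hsep : ∀ n : ℕ, 1 ≤ n → n < H → ∀ r₁ r₂ : ℤ,
      ¬ (|n * a - r₁| < 1 / (L:ℝ) ∧ |n * b - r₂| < 1 / (L:ℝ))) (k : ℕ) :
    ∑ h ∈ Finset.range H,
      ‖SS L (((h:ℝ) - k) * a)‖ ^ 2 * ‖SS L (((h:ℝ) - k) * b)‖ ^ 2
    ≤ 36 * (L:ℝ) ^ 4 * (∑' i : ℤ, 1 / (1 + (i:ℝ) ^ 2)) ^ 2 := by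
  have hL0 : (0:ℝ) < L := by exact_mod_cast hL
  let F : ℝ → ℕ → ℤ := fun a h => ⌊(L:ℝ) * (((h:ℝ) - k) * a - round (((h:ℝ) - k) * a))⌋
  have hF : ∀ a : ℝ, ∀ h₁ h₂ : ℕ, h₂ < h₁ → F a h₁ = F a h₂ →
      ∃ r : ℤ, |((h₁ - h₂ : ℕ):ℝ) * a - r| < 1 / (L:ℝ) := by
    intro a h₁ h₂ h12 he
    refine ⟨round (((h₁:ℝ) - k) * a) - round (((h₂:ℝ) - k) * a), ?_⟩
    have := Int.abs_sub_lt_one_of_floor_eq_floor he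
    rw [← mul_sub, abs_mul, abs_of_pos hL0] at this
    rw [lt_div_iff₀' hL0]
    have e : ((h₁ - h₂ : ℕ):ℝ) * a - ((round (((h₁:ℝ) - k) * a) - round (((h₂:ℝ) - k) * a) : ℤ) : ℝ)
      = ((h₁:ℝ) - k) * a - round (((h₁:ℝ) - k) * a) -
        (((h₂:ℝ) - k) * a - round (((h₂:ℝ) - k) * a)) := by
      rw [Nat.cast_sub h12.le]
      push_cast
      ring
    rw [e]
    exact this
  have key : ∀ h₁ h₂ : ℕ, h₁ < H → h₂ < h₁ → F a h₁ = F a h₂ → F b h₁ = F b h₂ → False := by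
    intro h₁ h₂ h1 h12 ha hb
    obtain ⟨r₁, hr₁⟩ := hF a h₁ h₂ h12 ha
    obtain ⟨r₂, hr₂⟩ := hF b h₁ h₂ h12 hb
    exact hsep (h₁ - h₂) (by omega) (by omega) r₁ r₂ ⟨hr₁, hr₂⟩
  have hinj : Set.InjOn (fun h => (F a h, F b h)) (Finset.range H : Set ℕ) := by
    intro h₁ hh₁ h₂ hh₂ he
    simp only [Finset.coe_range, Set.mem_Iio] at hh₁ hh₂
    simp only [Prod.mk.injEq] at he
    rcases lt_trichotomy h₁ h₂ with h | h | h
    · exact (key h₂ h₁ hh₂ h he.1.symm he.2.symm).elim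
    · exact h
    · exact (key h₁ h₂ hh₁ h he.1 he.2).elim
  let g : ℤ → ℝ := fun i => 1 / (1 + (i:ℝ) ^ 2)
  have hg : ∀ i, 0 ≤ g i := fun i => by positivity
  calc _ ≤ ∑ h ∈ Finset.range H, 36 * (L:ℝ) ^ 4 * (g (F a h) * g (F b h)) := by
        refine Finset.sum_le_sum fun h _ => ?_
        have h1 := SS_bound' L (((h:ℝ) - k) * a)
        have h2 := SS_bound' L (((h:ℝ) - k) * b)
        refine (mul_le_mul h1 h2 (by positivity) (by positivity)).trans (le_of_eq ?_)
        simp only [g, F]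
        ring
    _ = 36 * (L:ℝ) ^ 4 * ∑ h ∈ Finset.range H, (fun p : ℤ × ℤ => g p.1 * g p.2) (F a h, F b h) := by
        rw [Finset.mul_sum]
    _ ≤ 36 * (L:ℝ) ^ 4 * (∑' i : ℤ, g i) ^ 2 := by
        gcongr
        rw [← Finset.sum_image (f := fun p : ℤ × ℤ => g p.1 * g p.2) hinj]
        set W := Finset.image (fun h => (F a h, F b h)) (Finset.range H)
        calc _ ≤ ∑ p ∈ W.image Prod.fst ×ˢ W.image Prod.snd, g p.1 * g p.2 := by
              refine Finset.sum_le_sum_of_subset_of_nonneg Finset.subset_product ?_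
              intro p _ _
              exact mul_nonneg (hg _) (hg _)
          _ = (∑ i ∈ W.image Prod.fst, g i) * ∑ i ∈ W.image Prod.snd, g i := by
              rw [Finset.sum_mul_sum, ← Finset.sum_product']
          _ ≤ _ := by
              rw [sq]
              have hs := fun s : Finset ℤ => Summable.sum_le_tsum s (fun i _ => hg i) summ
              exact mul_le_mul (hs _) (hs _) (Finset.sum_nonneg fun i _ => hg i)
                (tsum_nonneg hg)

lemma count (a b : ℝ) (M H : ℕ) (hM : 1 ≤ M) (hH : 1 ≤ H) (δ : ℝ) (hδ : H * δ ≤ 1 / 8)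
    (hsep : ∀ n : ℕ, 1 ≤ n → n < H → ∀ r₁ r₂ : ℤ,
      ¬ (|n * a - r₁| < 1 / ((3 * M : ℕ):ℝ) ∧ |n * b - r₂| < 1 / ((3 * M : ℕ):ℝ)))
    (E : Finset (ℤ × ℤ)) (hE : ∀ p ∈ E, -(M:ℤ) ≤ p.1 ∧ p.1 < M ∧ -(M:ℤ) ≤ p.2 ∧ p.2 < M ∧
      ∃ z : ℤ, |p.1 * a + p.2 * b - z| ≤ δ) :
    (E.card : ℝ) * H ≤ 11664 * (∑' i : ℤ, 1 / (1 + (i:ℝ) ^ 2)) ^ 2 * (M:ℝ) ^ 2 := by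
  set T := ∑' i : ℤ, 1 / (1 + (i:ℝ) ^ 2)
  set L := 3 * M with hLdef
  have hup : ∑ x ∈ (Finset.range L ×ˢ Finset.range L) ×ˢ (Finset.range L ×ˢ Finset.range L),
      ‖SS H (((x.1.1:ℝ) - x.2.1) * a + ((x.1.2:ℝ) - x.2.2) * b)‖ ^ 2
      ≤ H * (36 * (L:ℝ) ^ 4 * T ^ 2) := by
    rw [expand_s12, Finset.sum_comm]
    refine (Finset.sum_le_sum fun k _ => upper a b L H (by omega) hsep k).trans ?_
    simp [T]
  have hlow : (M:ℝ) ^ 2 * (E.card * (H ^ 2 / 4)) ≤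
      ∑ x ∈ (Finset.range L ×ˢ Finset.range L) ×ˢ (Finset.range L ×ˢ Finset.range L),
      ‖SS H (((x.1.1:ℝ) - x.2.1) * a + ((x.1.2:ℝ) - x.2.2) * b)‖ ^ 2 := by
    rw [Finset.sum_product_right]
    have hsub : Finset.Ico M (2*M) ×ˢ Finset.Ico M (2*M) ⊆ Finset.range L ×ˢ Finset.range L := by
      intro x
      simp only [Finset.mem_product, Finset.mem_Ico, Finset.mem_range]
      omega
    refine le_trans ?_ (Finset.sum_le_sum_of_subset_of_nonneg hsub
      (fun y _ _ => Finset.sum_nonneg fun x _ => by positivity))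
    have : ∀ y ∈ Finset.Ico M (2*M) ×ˢ Finset.Ico M (2*M), (E.card * (H ^ 2 / 4) : ℝ) ≤
        ∑ x ∈ Finset.range L ×ˢ Finset.range L,
          ‖SS H (((x.1:ℝ) - y.1) * a + ((x.2:ℝ) - y.2) * b)‖ ^ 2 := by
      intro y hy
      simp only [Finset.mem_product, Finset.mem_Ico] at hy
      let φ : ℤ × ℤ → ℕ × ℕ := fun p => ((p.1 + y.1).toNat, (p.2 + y.2).toNat)
      have hinj : Set.InjOn φ (E : Set (ℤ × ℤ)) := by
        intro p hp p' hp' he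
        have h1 := hE p hp
        have h2 := hE p' hp'
        simp only [φ, Prod.mk.injEq] at he
        exact Prod.ext (by omega) (by omega)
      have himg : E.image φ ⊆ Finset.range L ×ˢ Finset.range L := by
        intro x hx
        rw [Finset.mem_image] at hx
        obtain ⟨p, hp, rfl⟩ := hx
        have h1 := hE p hp
        simp only [Finset.mem_product, Finset.mem_range, φ]
        omega
      refine le_trans ?_ (Finset.sum_le_sum_of_subset_of_nonneg himg
        (fun x _ _ => by positivity))
      rw [Finset.sum_image hinj, ← nsmul_eq_mul]
      refine Finset.card_nsmul_le_sum _ _ _ ?_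
      intro p hp
      obtain ⟨h1, h2, h3, h4, z, hz⟩ := hE p hp
      have e1 : (((p.1 + y.1).toNat : ℕ) : ℝ) = p.1 + y.1 := by
        have : (((p.1 + y.1).toNat : ℕ) : ℤ) = p.1 + y.1 := by omega
        exact_mod_cast this
      have e2 : (((p.2 + y.2).toNat : ℕ) : ℝ) = p.2 + y.2 := by
        have : (((p.2 + y.2).toNat : ℕ) : ℤ) = p.2 + y.2 := by omega
        exact_mod_cast this
      simp only [φ, e1, e2, add_sub_cancel_right]
      exact SS_lower H _ δ z hz hδ
    have h5 := Finset.card_nsmul_le_sum _ _ _ this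
    rw [nsmul_eq_mul] at h5
    convert h5 using 2
    simp
    rw [show 2 * M - M = M by omega]
    ring
  have h := hlow.trans hup
  have hM0 : (0:ℝ) < M := by exact_mod_cast hM
  have hH0 : (0:ℝ) < H := by exact_mod_cast hH
  have hL : (L:ℝ) = 3 * M := by rw [hLdef]; push_cast; ring
  rw [hL] at h
  have h6 : ((M:ℝ)^2 * H / 4) * (E.card * H) ≤ ((M:ℝ)^2 * H / 4) * (11664 * T ^ 2 * (M:ℝ) ^ 2) := by
    linarith
  exact le_of_mul_le_mul_left h6 (by positivity)

lemma growth (κ c : ℝ) (h0 : 0 ≤ κ) (h2 : κ < 2) (hc : 0 < c) :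
    ∃ T : ℕ, ∀ t : ℕ, T ≤ t → ((2:ℝ) ^ t)⁻¹ ≤ c * ((2:ℝ) ^ t * (t:ℝ) ^ 3) ^ (-(κ / 2)) := by
  set μ := κ / 2 with hμ
  have hμ0 : 0 ≤ μ := by linarith
  have hμ1 : μ < 1 := by linarith
  have hr : (1:ℝ) < 2 ^ (1 - μ) := Real.one_lt_rpow (by norm_num) (by linarith)
  have ht := tendsto_pow_const_div_const_pow_of_one_lt 3 hr
  have hev := (ht.eventually (gt_mem_nhds hc)).and (Filter.eventually_ge_atTop 1)
  obtain ⟨T, hT⟩ := Filter.eventually_atTop.mp hev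
  refine ⟨T, fun t htT => ?_⟩
  obtain ⟨h1, ht1⟩ := hT t htT
  have ht0 : (1:ℝ) ≤ t := by exact_mod_cast ht1
  set r : ℝ := 2 ^ (1 - μ)
  have hrt : 0 < r ^ t := by positivity
  rw [div_lt_iff₀ hrt] at h1
  have hmul : r ^ t * ((2:ℝ) ^ t) ^ μ = 2 ^ t := by
    have e1 : r ^ t = ((2:ℝ) ^ t) ^ (1 - μ) := by
      rw [← Real.rpow_natCast, ← Real.rpow_natCast, ← Real.rpow_mul (by norm_num),
        ← Real.rpow_mul (by norm_num)]
      congr 1; ring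
    rw [e1, ← Real.rpow_add (by positivity)]
    simp
  have ht3 : ((t:ℝ) ^ 3) ^ μ ≤ (t:ℝ) ^ 3 := by
    conv_rhs => rw [← Real.rpow_one ((t:ℝ) ^ 3)]
    exact Real.rpow_le_rpow_of_exponent_le (one_le_pow₀ ht0) hμ1.le
  rw [Real.rpow_neg (by positivity), Real.mul_rpow (by positivity) (by positivity),
    ← div_eq_mul_inv, inv_eq_one_div, div_le_div_iff₀ (by positivity) (by positivity), one_mul]
  have h4 : (0:ℝ) < ((2:ℝ)^t)^μ := by positivity
  calc ((2:ℝ)^t)^μ * ((t:ℝ)^3)^μ ≤ ((2:ℝ)^t)^μ * (c * r ^ t) := by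
        gcongr
        linarith
    _ = c * (r ^ t * ((2:ℝ)^t)^μ) := by ring
    _ = _ := by rw [hmul]

set_option maxHeartbeats 2000000 in
/-- **Counting rational points near general lines** (Chow–Yang, Corollary 4.2). -/
theorem counting_rational_points_near_lines (a b : ℝ) (hab : DualExpLtFive a b)
    (A B : ℝ) (hAB : A ≤ B)
    (ψ : ℕ → ℝ) (hψ0 : ∀ n, 0 ≤ ψ n) (hψmono : Antitone ψ)
    (hψbounds : ∃ q₀ : ℕ, ∀ q : ℕ, q₀ ≤ q →
      ((q : ℝ) * Real.log q ^ 3)⁻¹ < ψ q ∧ ψ q < ((q : ℝ) * Real.log q)⁻¹) :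
    ∃ C : ℝ, 0 < C ∧ ∃ T : ℕ, ∀ t : ℕ, T ≤ t → ∀ m : ℤ,
      (2 : ℝ) ^ |m| * t * Real.sqrt (ψ (2 ^ t)) ≤ 1 →
      ((countedTriples a b (Set.Icc A B) ψ t m).ncard : ℝ)
        ≤ C * (2 : ℝ) ^ |m| * (2 : ℝ) ^ (2 * t) * Real.sqrt (ψ (2 ^ t)) := by
  obtain ⟨κ, hκ0, hκ2, c, hc, htr⟩ := transference a b hab
  obtain ⟨q₀, hq⟩ := hψbounds
  obtain ⟨T₁, hT₁⟩ := growth κ c hκ0 hκ2 hc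
  obtain ⟨K, hK⟩ := exists_nat_ge (2 * max |A| |B| + 4)
  set C0 := 11664 * (∑' i : ℤ, 1 / (1 + (i:ℝ) ^ 2)) ^ 2 with hC0
  have hC0n : 0 ≤ C0 := by positivity
  set D := 3 * (1 + |a|) with hD
  have hD3 : 3 ≤ D := by have := abs_nonneg a; linarith
  obtain ⟨T₂, hT₂⟩ := exists_nat_ge (16 * D)
  have hmax : 0 ≤ max |A| |B| := (abs_nonneg A).trans (le_max_left _ _)
  have hK4 : (4:ℝ) ≤ K := by linarith
  refine ⟨16 * (C0 + 1) * K ^ 2 * D, by positivity, q₀ + T₁ + T₂ + 2, ?_⟩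
  intro t ht m hm
  have ht2 : (2:ℝ) ≤ t := by exact_mod_cast (by omega : 2 ≤ t)
  have htD : 16 * D ≤ t := hT₂.trans (by exact_mod_cast (by omega : T₂ ≤ t))
  have hQq : q₀ ≤ 2 ^ t := by
    have := Nat.lt_two_pow_self (n := t)
    omega
  have hψl := (hq _ hQq).1
  have hgr := hT₁ t (by omega)
  set s := Real.sqrt (ψ (2 ^ t)) with hs
  set Q : ℝ := (2:ℝ) ^ t with hQ
  have hQ1 : 1 ≤ Q := one_le_pow₀ (by norm_num)
  have hcast : (((2 ^ t : ℕ)) : ℝ) = Q := by rw [hQ]; push_cast; rfl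
  rw [hcast] at hψl
  have hlog : Real.log Q = t * Real.log 2 := by rw [hQ, Real.log_pow]
  have hlog0 : 0 < Real.log Q := by
    rw [hlog]; have := Real.log_pos (show (1:ℝ) < 2 by norm_num); positivity
  have hlogt : Real.log Q ≤ t := by
    rw [hlog]; have := Real.log_two_lt_d9
    exact mul_le_of_le_one_right (by linarith) (by linarith)
  have hψlow : (Q * (t:ℝ) ^ 3)⁻¹ ≤ ψ (2 ^ t) := by
    refine le_trans ?_ hψl.le
    gcongr
  have hψpos : 0 < ψ (2 ^ t) := lt_of_lt_of_le (by positivity) hψlow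
  have hspos : 0 < s := Real.sqrt_pos.mpr hψpos
  set R : ℝ := (2:ℝ) ^ |m| with hR
  have hR1 : 1 ≤ R := one_le_zpow₀ (by norm_num) (abs_nonneg m)
  set P := R * s with hP
  have hPpos : 0 < P := by positivity
  have hPt : P * t ≤ 1 := by rw [hP]; linarith
  have hPs : s ≤ P := le_mul_of_one_le_left hspos.le hR1
  set δ := D * P with hδ
  have hδpos : 0 < δ := by positivity
  have hδ16 : δ ≤ 1 / 16 := by
    have h1 := mul_le_mul_of_nonneg_left htD hPpos.le
    rw [hδ]; linarith
  have hsδ : s ≤ δ := hPs.trans (le_mul_of_one_le_left hPpos.le (by linarith))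
  set H := ⌊1 / (8 * δ)⌋₊ with hH
  have hHle : (H:ℝ) ≤ 1 / (8 * δ) := Nat.floor_le (by positivity)
  have hHδ : (H:ℝ) * δ ≤ 1 / 8 := by
    rw [le_div_iff₀ (by positivity)] at hHle
    linarith
  have hHge : 1 ≤ 16 * δ * H := by
    have h1 := Nat.lt_floor_add_one (1 / (8 * δ))
    rw [← hH, div_lt_iff₀ (by positivity)] at h1
    linarith
  have hH1 : 1 ≤ H := by
    by_contra h
    have : H = 0 := by omega
    rw [this] at hHge
    norm_num at hHge
  set M := K * 2 ^ t with hM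
  have hMR : (M:ℝ) = K * Q := by rw [hM]; push_cast; rfl
  have hMQ : Q ≤ M := by
    rw [hMR]
    exact le_mul_of_one_le_left (by linarith) (by linarith)
  have hM1 : 1 ≤ M := by
    have : (1:ℝ) ≤ M := hQ1.trans hMQ
    exact_mod_cast this
  have hsep : ∀ n : ℕ, 1 ≤ n → n < H → ∀ r₁ r₂ : ℤ,
      ¬ (|n * a - r₁| < 1 / ((3 * M : ℕ):ℝ) ∧ |n * b - r₂| < 1 / ((3 * M : ℕ):ℝ)) := by
    rintro n hn hnH r₁ r₂ ⟨h1, h2⟩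
    have h3 := htr n hn r₁ r₂ _ h1.le h2.le
    have hn0 : (0:ℝ) < n := by exact_mod_cast hn
    have hns : (n:ℝ) ≤ s⁻¹ := by
      have : (n:ℝ) ≤ H := by exact_mod_cast hnH.le
      rw [← one_div, le_div_iff₀ hspos]
      have h9 := mul_le_mul this hsδ hspos.le (Nat.cast_nonneg H)
      linarith
    have h4 : (Q * (t:ℝ) ^ 3) ^ (-(κ / 2)) ≤ (n:ℝ) ^ (-κ) := by
      calc (Q * (t:ℝ) ^ 3) ^ (-(κ / 2)) = ((Q * (t:ℝ) ^ 3)⁻¹) ^ (κ / 2) := by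
            rw [Real.rpow_neg (by positivity), Real.inv_rpow (by positivity)]
        _ ≤ (ψ (2 ^ t)) ^ (κ / 2) :=
            Real.rpow_le_rpow (by positivity) hψlow (by linarith)
        _ = s ^ κ := by
            rw [hs, Real.sqrt_eq_rpow, ← Real.rpow_mul hψpos.le]
            congr 1; ring
        _ = (s⁻¹) ^ (-κ) := by
            rw [Real.rpow_neg (by positivity), Real.inv_rpow hspos.le, inv_inv]
        _ ≤ (n:ℝ) ^ (-κ) := Real.rpow_le_rpow_of_nonpos hn0 hns (by linarith)
    have h5 : Q⁻¹ ≤ 1 / ((3 * M : ℕ):ℝ) := by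
      refine hgr.trans (le_trans ?_ h3)
      gcongr
    rw [← one_div, div_le_div_iff₀ (by positivity) (by positivity)] at h5
    push_cast at h5
    linarith
  classical
  set E : Finset (ℤ × ℤ) := ((Finset.Ico (-(M:ℤ)) M) ×ˢ (Finset.Ico (-(M:ℤ)) M)).filter
    (fun p => ∃ z : ℤ, |p.1 * a + p.2 * b - z| ≤ δ) with hE
  have hcount := count a b M H hM1 hH1 δ hHδ hsep E (by
    intro p hp
    rw [hE, Finset.mem_filter, Finset.mem_product, Finset.mem_Ico, Finset.mem_Ico] at hp
    tauto)
  rw [← hC0] at hcount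
  have hsq : Real.sqrt (2 * ψ (2 ^ t)) ≤ 3 / 2 * s := by
    rw [hs]
    apply Real.sqrt_le_iff.mpr
    refine ⟨by positivity, ?_⟩
    rw [mul_pow, Real.sq_sqrt hψpos.le]
    linarith
  have hR2 : (2:ℝ) ^ m ≤ R := zpow_le_zpow_right₀ (by norm_num) (le_abs_self m)
  have hR3 : (2:ℝ) ^ (-m) ≤ R := zpow_le_zpow_right₀ (by norm_num) (neg_le_abs m)
  have hmem : ∀ v ∈ countedTriples a b (Set.Icc A B) ψ t m,
      |(v.2.2:ℝ) * a + v.1 * b - v.2.1| ≤ δ ∧ (v.2.2, v.1) ∈ E := by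
    rintro ⟨q, p₁, p₂⟩ ⟨hq1, hq2, β, ⟨hβA, hβB⟩, hb1, hb2⟩
    simp only at hq1 hq2 hb1 hb2 ⊢
    have hq1' : Q ≤ q := by rw [hQ]; exact_mod_cast hq1
    have hq2' : (q:ℝ) ≤ 2 * Q := by
      have : (q:ℝ) < 2 ^ (t+1) := by exact_mod_cast hq2
      rw [pow_succ] at this
      linarith
    have hqpos : (0:ℝ) < q := by linarith
    have hgen : ∀ (x : ℝ) (p : ℤ) (e : ℝ), e ≤ R →
        |x - (p:ℝ) / q| < e * Real.sqrt (2 * ψ (2 ^ t)) / Q → |q * x - p| ≤ 3 * P := by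
      intro x p e he hx
      have h1 : |q * x - p| = q * |x - (p:ℝ) / q| := by
        rw [← abs_of_pos hqpos, ← abs_mul, abs_of_pos hqpos]
        congr 1
        field_simp
      have h2 : e * Real.sqrt (2 * ψ (2 ^ t)) / Q ≤ (3 / 2 * P) / Q := by
        refine div_le_div_of_nonneg_right ?_ (by linarith)
        calc e * Real.sqrt (2 * ψ (2 ^ t)) ≤ R * (3 / 2 * s) := by gcongr
          _ = 3 / 2 * P := by rw [hP]; ring
      rw [h1]
      calc q * |x - (p:ℝ) / q| ≤ (2 * Q) * ((3 / 2 * P) / Q) := by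
            gcongr
            linarith
        _ = 3 * P := by field_simp
    have g1 := hgen _ _ _ hR2 hb1
    have g2 := hgen _ _ _ hR3 hb2
    have hclose : |(p₂:ℝ) * a + q * b - p₁| ≤ δ := by
      rw [show (p₂:ℝ) * a + q * b - p₁ = (q * (a * β + b) - p₁) - a * (q * β - p₂) by ring]
      refine (abs_sub _ _).trans ?_
      rw [abs_mul, hδ, hD]
      have := mul_le_mul_of_nonneg_left g2 (abs_nonneg a)
      linarith
    refine ⟨hclose, ?_⟩
    have hβ : |β| ≤ max |A| |B| := abs_le_max_abs_abs hβA hβB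
    have hp2 : |(p₂:ℝ)| < M := by
      have h1 : |(p₂:ℝ)| ≤ q * |β| + 3 * P := by
        have h2 : |(p₂:ℝ)| ≤ |q * β| + |q * β - p₂| := by
          have := abs_sub (q * β) (q * β - p₂)
          rwa [sub_sub_cancel] at this
        rw [abs_mul, abs_of_pos hqpos] at h2
        linarith
      have h3 : q * |β| ≤ 2 * Q * max |A| |B| := by gcongr
      rw [hMR]
      have h4 := mul_le_mul_of_nonneg_left ht2 hPpos.le
      have h5 := mul_le_mul_of_nonneg_right hK (by linarith : (0:ℝ) ≤ Q)
      linarith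
    have hqM : (q:ℝ) < M := by
      have h5 := mul_le_mul_of_nonneg_right hK4 (by linarith : (0:ℝ) ≤ Q)
      rw [hMR]; linarith
    rw [abs_lt] at hp2
    rw [hE, Finset.mem_filter, Finset.mem_product, Finset.mem_Ico, Finset.mem_Ico]
    refine ⟨⟨⟨?_, ?_⟩, ⟨?_, ?_⟩⟩, p₁, hclose⟩
    · exact_mod_cast hp2.1.le
    · exact_mod_cast hp2.2
    · have : (0:ℤ) < q := by exact_mod_cast hqpos
      simp only; omega
    · exact_mod_cast hqM
  have hcard : (countedTriples a b (Set.Icc A B) ψ t m).ncard ≤ E.card := by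
    rw [← Set.ncard_coe_finset E]
    refine Set.ncard_le_ncard_of_injOn (fun v => (v.2.2, v.1)) (fun v hv => (hmem v hv).2) ?_
      (Finset.finite_toSet E)
    rintro ⟨q, p₁, p₂⟩ hv ⟨q', p₁', p₂'⟩ hv' he
    simp only [Prod.mk.injEq] at he
    obtain ⟨rfl, rfl⟩ := he
    have h1 := (hmem _ hv).1
    have h2 := (hmem _ hv').1
    simp only at h1 h2
    rw [abs_le] at h1 h2
    have h3 : (p₁:ℝ) - p₁' < 1 := by linarith
    have h4 : (p₁':ℝ) - p₁ < 1 := by linarith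
    have h5 : p₁ - p₁' < 1 := by exact_mod_cast h3
    have h6 : p₁' - p₁ < 1 := by exact_mod_cast h4
    have : p₁ = p₁' := by omega
    rw [this]
  have hfin : (E.card : ℝ) ≤ 16 * δ * (C0 * M ^ 2) := by
    calc (E.card : ℝ) ≤ E.card * (16 * δ * H) := le_mul_of_one_le_right (by positivity) hHge
      _ = 16 * δ * (E.card * H) := by ring
      _ ≤ _ := by gcongr
  calc ((countedTriples a b (Set.Icc A B) ψ t m).ncard : ℝ) ≤ E.card := by exact_mod_cast hcard
    _ ≤ 16 * δ * (C0 * M ^ 2) := hfin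
    _ ≤ 16 * δ * ((C0 + 1) * M ^ 2) := by gcongr; linarith
    _ = _ := by
      rw [hMR, hδ, hP, pow_mul', ← hQ]
      ring

end
end

section
/- The set {(a,b) ∈ ℝ² : ω*(a,b) ≥ 5} has Hausdorff dimension 3/2. -/
/-!
The exceptional set `{(a,b) ∈ ℝ² : ω*(a,b) ≥ 5}` has Hausdorff dimension `3/2`
(Chow–Yang, §1.2).
-/

open MeasureTheory
open scoped ENNReal

noncomputable section

/-- `ω*(a,b) ≥ 5`, where `ω*(a,b)` is the dual exponent of `(a,b)`: the supremum of
`w` such that `⟨xa + yb⟩ ≤ (|x|+|y|)^{-w}` for infinitely many nonzero `(x,y) ∈ ℤ²`.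
Since the set of such `w` is an interval unbounded below, `ω*(a,b) ≥ 5` is
equivalent to: for every `w < 5` there are infinitely many nonzero `(x,y)`
satisfying the inequality. -/
def DualExpGeFive (a b : ℝ) : Prop :=
  ∀ w : ℝ, w < 5 →
    {p : ℤ × ℤ | p ≠ 0 ∧
      distNearestInt (p.1 * a + p.2 * b) ≤ ((|p.1| + |p.2| : ℤ) : ℝ) ^ (-w)}.Infinite


def par (k : ℕ) (c : ℕ × ℕ) : ℕ × ℕ := (c.1 / 2 ^ k, c.2 / 2 ^ k)

def idx (n : ℕ) : Finset (ℕ × ℕ) := Finset.range (2 ^ n) ×ˢ Finset.range (2 ^ n)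

def coarse (n : ℕ) (μ : ℕ × ℕ → ℝ) (m : ℕ) (D : ℕ × ℕ) : ℝ :=
  ∑ c ∈ (idx n).filter (fun c => par (n - m) c = D), μ c

lemma par_par (k l : ℕ) (c : ℕ × ℕ) : par k (par l c) = par (l + k) c := by
  simp [par, Nat.div_div_eq_div_mul, pow_add]

lemma par_zero (c : ℕ × ℕ) : par 0 c = c := by simp [par]

lemma mem_idx {n : ℕ} {c : ℕ × ℕ} : c ∈ idx n ↔ c.1 < 2 ^ n ∧ c.2 < 2 ^ n := by
  simp [idx]

lemma par_mem {n m : ℕ} (h : m ≤ n) {c : ℕ × ℕ} (hc : c ∈ idx n) : par (n - m) c ∈ idx m := by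
  rw [mem_idx] at *
  have e : 2 ^ n = 2 ^ m * 2 ^ (n - m) := by rw [← pow_add]; congr 1; omega
  rw [e] at hc
  exact ⟨Nat.div_lt_of_lt_mul (by rw [mul_comm]; exact hc.1),
    Nat.div_lt_of_lt_mul (by rw [mul_comm]; exact hc.2)⟩

lemma coarse_self {n : ℕ} {μ : ℕ × ℕ → ℝ} {c : ℕ × ℕ} (hc : c ∈ idx n) :
    coarse n μ n c = μ c := by
  have : (idx n).filter (fun d => par (n - n) d = c) = {c} := by
    ext d
    simp only [Nat.sub_self, par_zero, Finset.mem_filter, Finset.mem_singleton]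
    constructor
    · exact fun h => h.2
    · rintro rfl; exact ⟨hc, rfl⟩
  rw [coarse, this, Finset.sum_singleton]

lemma coarse_congr {n : ℕ} {μ ν : ℕ × ℕ → ℝ} (h : ∀ c ∈ idx n, μ c = ν c) (m : ℕ) (D : ℕ × ℕ) :
    coarse n μ m D = coarse n ν m D :=
  Finset.sum_congr rfl (fun c hc => h c (Finset.mem_filter.1 hc).1)

lemma coarse_coarse {n k m : ℕ} (hmk : m ≤ k) (hkn : k ≤ n) (μ : ℕ × ℕ → ℝ) (D : ℕ × ℕ) :
    coarse k (coarse n μ k) m D = coarse n μ m D := by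
  unfold coarse
  symm
  have key : ∀ c ∈ (idx n).filter (fun c => par (n - m) c = D),
      par (n - k) c ∈ (idx k).filter (fun c => par (k - m) c = D) := by
    intro c hc
    rw [Finset.mem_filter] at *
    refine ⟨par_mem hkn hc.1, ?_⟩
    rw [par_par, ← hc.2]
    congr 1; omega
  rw [← Finset.sum_fiberwise_of_maps_to key]
  refine Finset.sum_congr rfl fun E hE => ?_
  refine Finset.sum_congr ?_ fun _ _ => rfl
  ext c
  simp only [Finset.mem_filter] at *
  constructor
  · rintro ⟨⟨h1, h2⟩, h3⟩; exact ⟨h1, h3⟩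
  · rintro ⟨h1, h3⟩
    refine ⟨⟨h1, ?_⟩, h3⟩
    rw [← hE.2, ← h3, par_par]
    congr 1; omega

lemma coarse_sum {n m : ℕ} (h : m ≤ n) (μ : ℕ × ℕ → ℝ) :
    ∑ D ∈ idx m, coarse n μ m D = ∑ c ∈ idx n, μ c := by
  unfold coarse
  exact Finset.sum_fiberwise_of_maps_to (fun c hc => par_mem h hc) _

lemma coarse_nonneg {n m : ℕ} {μ : ℕ × ℕ → ℝ} (h : ∀ c, 0 ≤ μ c) (D : ℕ × ℕ) :
    0 ≤ coarse n μ m D := Finset.sum_nonneg fun c _ => h c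

lemma fiber_card {n m : ℕ} (h : n ≤ m) {c : ℕ × ℕ} (hc : c ∈ idx n) :
    ((idx m).filter (fun D => par (m - n) D = c)).card = 4 ^ (m - n) := by
  have : (idx m).filter (fun D => par (m - n) D = c) =
      Finset.Ico (c.1 * 2 ^ (m - n)) ((c.1 + 1) * 2 ^ (m - n)) ×ˢ
      Finset.Ico (c.2 * 2 ^ (m - n)) ((c.2 + 1) * 2 ^ (m - n)) := by
    ext D
    have e : 2 ^ m = 2 ^ n * 2 ^ (m - n) := by rw [← pow_add]; congr 1; omega
    have hp : 0 < 2 ^ (m - n) := by positivity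
    rw [mem_idx] at hc
    rw [Finset.mem_filter, mem_idx, Finset.mem_product, Finset.mem_Ico, Finset.mem_Ico, Prod.ext_iff]
    simp only [par, Nat.div_eq_iff hp]
    have h1 : (c.1 + 1) * 2 ^ (m - n) ≤ 2 ^ m := by rw [e]; exact Nat.mul_le_mul_right _ hc.1
    have h2 : (c.2 + 1) * 2 ^ (m - n) ≤ 2 ^ m := by rw [e]; exact Nat.mul_le_mul_right _ hc.2
    clear e
    simp only [add_mul, one_mul] at h1 h2 ⊢
    generalize 2 ^ (m - n) = r at *
    generalize c.1 * r = r1 at *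
    generalize c.2 * r = r2 at *
    generalize 2 ^ m = r3 at *
    constructor
    · rintro ⟨_, h3, h4⟩; omega
    · rintro ⟨h3, h4⟩; omega
  rw [this, Finset.card_product]
  simp only [Nat.card_Ico, add_mul, one_mul, Nat.add_sub_cancel_left]
  rw [← mul_pow]; norm_num

lemma sum_par {n m : ℕ} (h : n ≤ m) (F : ℕ × ℕ → ℝ) :
    ∑ D ∈ idx m, F (par (m - n) D) = 4 ^ (m - n) * ∑ c ∈ idx n, F c := by
  rw [← Finset.sum_fiberwise_of_maps_to (t := idx n) (fun c hc => par_mem h hc), Finset.mul_sum]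
  refine Finset.sum_congr rfl fun c hc => ?_
  rw [Finset.sum_congr rfl (g := fun _ => F c)]
  · rw [Finset.sum_const, fiber_card h hc]; simp
  · intro D hD; rw [(Finset.mem_filter.1 hD).2]

/-- Closed dyadic square. -/
def csq (n : ℕ) (c : ℕ × ℕ) : Set (ℝ × ℝ) :=
  Set.Icc ((c.1 : ℝ) / 2 ^ n) ((c.1 + 1 : ℝ) / 2 ^ n) ×ˢ
  Set.Icc ((c.2 : ℝ) / 2 ^ n) ((c.2 + 1 : ℝ) / 2 ^ n)

/-- points with one good approximation -/
def Eset (w : ℝ) (k : ℕ) : Set (ℝ × ℝ) :=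
  {q | ∃ x y : ℕ, k ≤ y ∧ 1 ≤ y ∧ distNearestInt (x * q.1 + y * q.2) ≤ ((x : ℝ) + y) ^ (-w)}

/-- one step -/
structure Good (s : ℝ) (n : ℕ) (μ : ℕ × ℕ → ℝ) : Prop where
  nonneg : ∀ c, 0 ≤ μ c
  total : ∑ c ∈ idx n, μ c = 1
  energy : ∀ m ≤ n, ∑ D ∈ idx m, coarse n μ m D ^ 2 ≤ (2 : ℝ) ^ (-(s * m))

def LemG : Prop := ∀ (M : ℕ) (w : ℝ) (k : ℕ), 0 < w → w < 5 → ∃ n' : ℕ, M < n' ∧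
  ∃ γ : ℕ × ℕ → ℝ, (∀ c, 0 ≤ γ c) ∧
    (∀ m ≤ M, ∀ D ∈ idx m, coarse n' γ m D = (4 : ℝ) ^ (-(m : ℝ))) ∧
    (∀ m ≤ n', ∑ D ∈ idx m, coarse n' γ m D ^ 2 ≤ 6 * (2 : ℝ) ^ (-(3 / 2 * m : ℝ))) ∧
    (∀ c ∈ idx n', γ c ≠ 0 → csq n' c ⊆ Eset w k)

lemma Good.le_one {s : ℝ} {n : ℕ} {μ : ℕ × ℕ → ℝ} (h : Good s n μ) {c : ℕ × ℕ} (hc : c ∈ idx n) :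
    μ c ≤ 1 := by
  rw [← h.total]
  exact Finset.single_le_sum (fun c _ => h.nonneg c) hc

lemma step (hG : LemG) {s : ℝ} (hs : s < 3 / 2) {n : ℕ} {μ : ℕ × ℕ → ℝ} (h : Good s n μ)
    {w : ℝ} (hw0 : 0 < w) (hw : w < 5) (k : ℕ) :
    ∃ n' > n, ∃ μ', Good s n' μ' ∧ ∀ c ∈ idx n', μ' c ≠ 0 →
      μ (par (n' - n) c) ≠ 0 ∧ csq n' c ⊆ Eset w k := by
  obtain ⟨M, hM⟩ : ∃ M : ℕ, n ≤ M ∧ (16 : ℝ) ^ n * 6 ≤ (2 : ℝ) ^ ((3 / 2 - s) * M) := by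
    have ht : Filter.Tendsto (fun M : ℕ => ((2 : ℝ) ^ (3 / 2 - s)) ^ M) Filter.atTop Filter.atTop :=
      tendsto_pow_atTop_atTop_of_one_lt (Real.one_lt_rpow (by norm_num) (by linarith))
    obtain ⟨M, h1, h2⟩ := ((ht.eventually_ge_atTop ((16 : ℝ) ^ n * 6)).and
      (Filter.eventually_ge_atTop n)).exists
    refine ⟨M, h2, ?_⟩
    rw [Real.rpow_mul (by norm_num), Real.rpow_natCast]
    exact h1
  obtain ⟨hnM, hM⟩ := hM
  obtain ⟨n', hn', γ, γ0, G1, G2, G3⟩ := hG M w k hw0 hw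
  have hnn' : n < n' := by omega
  set μ' : ℕ × ℕ → ℝ := fun c => μ (par (n' - n) c) * (4 : ℝ) ^ n * γ c with hμ'
  have C1 : ∀ m, n ≤ m → m ≤ n' → ∀ D, coarse n' μ' m D =
      μ (par (m - n) D) * (4 : ℝ) ^ n * coarse n' γ m D := by
    intro m h1 h2 D
    unfold coarse
    rw [Finset.mul_sum]
    refine Finset.sum_congr rfl fun c hc => ?_
    rw [Finset.mem_filter] at hc
    simp only [hμ']
    rw [← hc.2, par_par]
    congr 4; omega
  have C2 : ∀ D ∈ idx n, coarse n' μ' n D = μ D := by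
    intro D hD
    rw [C1 n le_rfl hnn'.le, G1 n hnM D hD, Nat.sub_self, par_zero, Real.rpow_neg (by norm_num),
      Real.rpow_natCast]
    field_simp
  have C3 : ∀ m ≤ n, ∀ D, coarse n' μ' m D = coarse n μ m D := by
    intro m hm D
    rw [← coarse_coarse hm hnn'.le]
    exact coarse_congr C2 m D
  refine ⟨n', hnn', μ', ⟨?_, ?_, ?_⟩, ?_⟩
  · intro c
    have := h.nonneg (par (n' - n) c)
    have := γ0 c
    positivity
  · rw [← coarse_sum hnn'.le, ← h.total]
    exact Finset.sum_congr rfl C2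
  · intro m hm
    rcases le_total m n with hmn | hmn
    · simp only [C3 m hmn]; exact h.energy m hmn
    rcases le_total m M with hmM | hmM
    · have e1 : ∑ D ∈ idx m, coarse n' μ' m D ^ 2 =
          ∑ D ∈ idx m, (fun c => (μ c * (4 : ℝ) ^ n * (4 : ℝ) ^ (-(m : ℝ))) ^ 2) (par (m - n) D) := by
        refine Finset.sum_congr rfl fun D hD => ?_
        rw [C1 m hmn hm, G1 m hmM D hD]
      rw [e1, sum_par hmn (fun c => (μ c * (4 : ℝ) ^ n * (4 : ℝ) ^ (-(m : ℝ))) ^ 2)]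
      have e2 : ∑ c ∈ idx n, (μ c * (4 : ℝ) ^ n * (4 : ℝ) ^ (-(m : ℝ))) ^ 2 =
          ((4 : ℝ) ^ n * (4 : ℝ) ^ (-(m : ℝ))) ^ 2 * ∑ c ∈ idx n, coarse n μ n c ^ 2 := by
        rw [Finset.mul_sum]
        refine Finset.sum_congr rfl fun D hD => ?_
        rw [coarse_self hD]; ring
      rw [e2]
      have e3 := h.energy n le_rfl
      have e4 : (4 : ℝ) ^ (m - n) * (((4 : ℝ) ^ n * (4 : ℝ) ^ (-(m : ℝ))) ^ 2) =
          (2 : ℝ) ^ (-(2 * ((m : ℝ) - n))) := by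
        have : (4 : ℝ) ^ (m - n) = (4 : ℝ) ^ m / (4 : ℝ) ^ n := by
          rw [pow_sub₀ _ (by norm_num) hmn]; rfl
        rw [this, Real.rpow_neg (by norm_num), Real.rpow_natCast, Real.rpow_neg (by norm_num),
          Real.rpow_mul (by norm_num), Real.rpow_sub (by norm_num)]
        norm_num
        field_simp
      rw [← mul_assoc, e4]
      calc (2 : ℝ) ^ (-(2 * ((m : ℝ) - n))) * ∑ c ∈ idx n, coarse n μ n c ^ 2
          ≤ (2 : ℝ) ^ (-(2 * ((m : ℝ) - n))) * (2 : ℝ) ^ (-(s * n)) := by gcongr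
        _ = (2 : ℝ) ^ (-(2 * ((m : ℝ) - n)) + (-(s * n))) := by
            rw [Real.rpow_add (by norm_num)]
        _ ≤ _ := by
            apply Real.rpow_le_rpow_of_exponent_le (by norm_num)
            have : (n : ℝ) ≤ m := by exact_mod_cast hmn
            nlinarith
    · have e1 : ∑ D ∈ idx m, coarse n' μ' m D ^ 2 ≤
          ∑ D ∈ idx m, (16 : ℝ) ^ n * coarse n' γ m D ^ 2 := by
        refine Finset.sum_le_sum fun D hD => ?_
        rw [C1 m hmn hm]
        have a1 := h.le_one (par_mem hmn hD)
        have a0 := h.nonneg (par (m - n) D)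
        have : (μ (par (m - n) D) * (4 : ℝ) ^ n * coarse n' γ m D) ^ 2 =
          (μ (par (m - n) D)) ^ 2 * ((16 : ℝ) ^ n * coarse n' γ m D ^ 2) := by
          rw [show (16 : ℝ) = 4 ^ 2 by norm_num, ← pow_mul, mul_comm 2 n, pow_mul]; ring
        rw [this]
        have : (μ (par (m - n) D)) ^ 2 ≤ 1 := by nlinarith
        exact mul_le_of_le_one_left (by positivity) this
      refine e1.trans ?_
      rw [← Finset.mul_sum]
      calc (16 : ℝ) ^ n * ∑ D ∈ idx m, coarse n' γ m D ^ 2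
          ≤ (16 : ℝ) ^ n * (6 * (2 : ℝ) ^ (-(3 / 2 * m : ℝ))) := by gcongr; exact G2 m hm
        _ = ((16 : ℝ) ^ n * 6) * (2 : ℝ) ^ (-(3 / 2 * m : ℝ)) := by ring
        _ ≤ (2 : ℝ) ^ ((3 / 2 - s) * M) * (2 : ℝ) ^ (-(3 / 2 * m : ℝ)) := by gcongr
        _ = (2 : ℝ) ^ ((3 / 2 - s) * M + -(3 / 2 * m : ℝ)) := by
            rw [Real.rpow_add (by norm_num)]
        _ ≤ _ := by
            apply Real.rpow_le_rpow_of_exponent_le (by norm_num)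
            have : (M : ℝ) ≤ m := by exact_mod_cast hmM
            nlinarith
  · intro c hc hne
    simp only [hμ'] at hne
    constructor
    · intro h0; simp [h0] at hne
    · exact G3 c hc (by intro h0; simp [h0] at hne)


lemma sum_biUnion_le_aux {α β : Type*} [DecidableEq β] (T : Finset α) (Z : α → Finset β)
    (f : β → ℝ) (hf : ∀ b, 0 ≤ f b) :
    ∑ b ∈ T.biUnion Z, f b ≤ ∑ a ∈ T, ∑ b ∈ Z a, f b := by
  classical
  induction T using Finset.induction_on with
  | empty => simp
  | insert a T ha ih =>
    rw [Finset.biUnion_insert, Finset.sum_insert ha]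
    have := Finset.sum_union_inter (s₁ := Z a) (s₂ := T.biUnion Z) (f := f)
    have h2 : 0 ≤ ∑ b ∈ Z a ∩ T.biUnion Z, f b := Finset.sum_nonneg fun b _ => hf b
    linarith

/-- squares of level `m` near `p` -/
def near (m : ℕ) (p : ℝ × ℝ) : Finset (ℕ × ℕ) :=
  (Finset.Icc ⌈2 ^ m * p.1 - 3⌉₊ (⌈2 ^ m * p.1 - 3⌉₊ + 6)) ×ˢ
  (Finset.Icc ⌈2 ^ m * p.2 - 3⌉₊ (⌈2 ^ m * p.2 - 3⌉₊ + 6))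

lemma near_card (m : ℕ) (p : ℝ × ℝ) : (near m p).card = 49 := by
  rw [near, Finset.card_product, Nat.card_Icc, Nat.card_Icc]
  have : ∀ a : ℕ, a + 6 + 1 - a = 7 := fun a => by omega
  rw [this, this]

lemma mem_near_aux {m n : ℕ} (h : m ≤ n) {c : ℕ} {u : ℝ}
    (hc : |(c : ℝ) / 2 ^ n - u| < 2 / 2 ^ m) :
    c / 2 ^ (n - m) ∈ Finset.Icc ⌈2 ^ m * u - 3⌉₊ (⌈2 ^ m * u - 3⌉₊ + 6) := by
  have e : (2 : ℝ) ^ n = 2 ^ m * 2 ^ (n - m) := by rw [← pow_add]; congr 1; omega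
  have hp : (0 : ℝ) < 2 ^ m := by positivity
  have hq : (0 : ℝ) < 2 ^ (n - m) := by positivity
  have h1 : |(c : ℝ) / 2 ^ (n - m) - 2 ^ m * u| < 2 := by
    have : (c : ℝ) / 2 ^ (n - m) - 2 ^ m * u = 2 ^ m * ((c : ℝ) / 2 ^ n - u) := by
      rw [e]; field_simp
    rw [this, abs_mul, abs_of_pos hp]
    calc (2 : ℝ) ^ m * |(c : ℝ) / 2 ^ n - u| < 2 ^ m * (2 / 2 ^ m) := by gcongr
      _ = 2 := by field_simp
  have h2 : ((c / 2 ^ (n - m) : ℕ) : ℝ) ≤ (c : ℝ) / 2 ^ (n - m) := by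
    have := @Nat.cast_div_le ℝ _ _ _ c (2 ^ (n - m))
    push_cast at this; exact this
  have h3 : (c : ℝ) / 2 ^ (n - m) < ((c / 2 ^ (n - m) : ℕ) : ℝ) + 1 := by
    rw [div_lt_iff₀ hq]
    have := Nat.lt_div_mul_add (a := c) (b := 2 ^ (n - m)) (by positivity)
    have h' : (c : ℝ) < ((c / 2 ^ (n - m) : ℕ) : ℝ) * 2 ^ (n - m) + 2 ^ (n - m) := by
      exact_mod_cast this
    linarith
  rw [abs_lt] at h1
  rw [Finset.mem_Icc]
  constructor
  · rw [Nat.ceil_le]; linarith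
  · have := Nat.le_ceil (2 ^ m * u - 3)
    have h4 : ((c / 2 ^ (n - m) : ℕ) : ℝ) ≤ ((⌈2 ^ m * u - 3⌉₊ + 6 : ℕ) : ℝ) := by
      push_cast; linarith
    exact_mod_cast h4

lemma finite_stage {s t : ℝ} (hst : t < s) {n : ℕ} {μ : ℕ × ℕ → ℝ} (h : Good s n μ)
    (T : Finset ℕ) (m : ℕ → ℕ) (p : ℕ → ℝ × ℝ) (hm : ∀ i ∈ T, m i ≤ n)
    (hcov : ∀ c ∈ idx n, μ c ≠ 0 → ∃ i ∈ T, |(c.1 : ℝ) / 2 ^ n - (p i).1| < 2 / 2 ^ (m i) ∧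
      |(c.2 : ℝ) / 2 ^ n - (p i).2| < 2 / 2 ^ (m i)) :
    1 ≤ 49 * (1 - (2 : ℝ) ^ (-(s - t)))⁻¹ * ∑ i ∈ T, (2 : ℝ) ^ (-(t * m i)) := by
  classical
  set Z : ℕ → Finset (ℕ × (ℕ × ℕ)) := fun i =>
    (near (m i) (p i) ∩ idx (m i)).image (fun D => (m i, D)) with hZ
  set 𝒟 := T.biUnion Z with h𝒟
  set r : ℝ := (2 : ℝ) ^ (-(s - t)) with hr
  have hr1 : r < 1 := Real.rpow_lt_one_of_one_lt_of_neg (by norm_num) (by linarith)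
  have hr0 : 0 < r := by positivity
  set B := (1 - r)⁻¹ with hB
  have hBpos : 0 < B := inv_pos.2 (by linarith)
  -- mass bound
  have A1 : (1 : ℝ) ≤ ∑ E ∈ 𝒟, coarse n μ E.1 E.2 := by
    rw [← h.total]
    have : ∀ c ∈ idx n, μ c ≤ ∑ E ∈ 𝒟, if par (n - E.1) c = E.2 then μ c else 0 := by
      intro c hc
      by_cases h0 : μ c = 0
      · rw [h0]; simp
      obtain ⟨i, hi, h1, h2⟩ := hcov c hc h0
      have hE : (m i, par (n - m i) c) ∈ 𝒟 := by
        rw [h𝒟, Finset.mem_biUnion]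
        refine ⟨i, hi, ?_⟩
        rw [hZ, Finset.mem_image]
        refine ⟨par (n - m i) c, ?_, rfl⟩
        rw [Finset.mem_inter]
        refine ⟨?_, par_mem (hm i hi) hc⟩
        rw [near, Finset.mem_product]
        exact ⟨mem_near_aux (hm i hi) h1, mem_near_aux (hm i hi) h2⟩
      have := Finset.single_le_sum (f := fun E : ℕ × (ℕ × ℕ) =>
        if par (n - E.1) c = E.2 then μ c else 0) (s := 𝒟) (fun E _ => by
          split_ifs
          · exact h.nonneg c
          · exact le_rfl) hE
      simpa using this
    refine (Finset.sum_le_sum this).trans ?_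
    rw [Finset.sum_comm]
    refine Finset.sum_le_sum fun E _ => ?_
    rw [coarse, Finset.sum_filter]
  have hsub : 𝒟 ⊆ (Finset.range (n + 1)).biUnion (fun k => (idx k).image (fun D => (k, D))) := by
    intro E hE
    rw [h𝒟, Finset.mem_biUnion] at hE
    obtain ⟨i, hi, hE⟩ := hE
    rw [hZ, Finset.mem_image] at hE
    obtain ⟨D, hD, rfl⟩ := hE
    rw [Finset.mem_biUnion]
    exact ⟨m i, Finset.mem_range.2 (by have := hm i hi; omega),
      Finset.mem_image_of_mem _ (Finset.mem_inter.1 hD).2⟩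
  have A2 : ∑ E ∈ 𝒟, coarse n μ E.1 E.2 ^ 2 * (2 : ℝ) ^ (t * E.1) ≤ B := by
    refine (Finset.sum_le_sum_of_subset_of_nonneg hsub (fun E _ _ => by positivity)).trans ?_
    refine (sum_biUnion_le_aux _ _ _ (fun E => by positivity)).trans ?_
    have : ∀ k ∈ Finset.range (n + 1), ∑ E ∈ (idx k).image (fun D => (k, D)),
        coarse n μ E.1 E.2 ^ 2 * (2 : ℝ) ^ (t * E.1) ≤ r ^ k := by
      intro k hk
      rw [Finset.sum_image (by intro a _ b _ hab; exact (Prod.ext_iff.1 hab).2)]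
      dsimp only
      rw [← Finset.sum_mul]
      have := h.energy k (by rw [Finset.mem_range] at hk; omega)
      calc _ ≤ (2 : ℝ) ^ (-(s * k)) * (2 : ℝ) ^ (t * k) := by gcongr
        _ = (2 : ℝ) ^ (-(s - t) * k) := by
          rw [← Real.rpow_add (by norm_num)]; congr 1; ring
        _ = r ^ k := by rw [Real.rpow_mul (by norm_num), Real.rpow_natCast]
    refine (Finset.sum_le_sum this).trans ?_
    have hg := hasSum_geometric_of_lt_one hr0.le hr1
    exact sum_le_hasSum _ (fun k _ => by positivity) hg
  have A3 : ∑ E ∈ 𝒟, (2 : ℝ) ^ (-(t * E.1)) ≤ 49 * ∑ i ∈ T, (2 : ℝ) ^ (-(t * m i)) := by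
    refine (sum_biUnion_le_aux _ _ (fun E : ℕ × (ℕ × ℕ) => (2 : ℝ) ^ (-(t * E.1)))
      (fun E => by positivity)).trans ?_
    rw [Finset.mul_sum]
    refine Finset.sum_le_sum fun i _ => ?_
    rw [hZ]
    dsimp only
    rw [Finset.sum_image (by intro a _ b _ hab; exact (Prod.ext_iff.1 hab).2)]
    dsimp only
    rw [Finset.sum_const, nsmul_eq_mul]
    gcongr
    have : (near (m i) (p i) ∩ idx (m i)).card ≤ 49 := by
      rw [← near_card (m i) (p i)]; exact Finset.card_le_card Finset.inter_subset_left
    exact_mod_cast this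
  have A4 : ∀ E ∈ 𝒟, coarse n μ E.1 E.2 ≤ (B⁻¹ / 2) * (coarse n μ E.1 E.2 ^ 2 * (2 : ℝ) ^ (t * E.1))
      + (B / 2) * (2 : ℝ) ^ (-(t * E.1)) := by
    intro E _
    set a := coarse n μ E.1 E.2
    rw [Real.rpow_neg (by norm_num)]
    have hy : (0 : ℝ) < (2 : ℝ) ^ (t * E.1) := by positivity
    set y := (2 : ℝ) ^ (t * E.1)
    have : (B⁻¹ / 2) * (a ^ 2 * y) + (B / 2) * y⁻¹ - a = (a * y - B) ^ 2 / (2 * B * y) := by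
      field_simp; ring
    have h2 : 0 ≤ (a * y - B) ^ 2 / (2 * B * y) := by positivity
    linarith
  have A5 := Finset.sum_le_sum A4
  rw [Finset.sum_add_distrib, ← Finset.mul_sum, ← Finset.mul_sum] at A5
  have A6 : (B⁻¹ / 2) * ∑ E ∈ 𝒟, coarse n μ E.1 E.2 ^ 2 * (2 : ℝ) ^ (t * E.1) ≤ 1 / 2 := by
    calc _ ≤ (B⁻¹ / 2) * B := by gcongr
      _ = 1 / 2 := by field_simp
  have A7 : (B / 2) * ∑ E ∈ 𝒟, (2 : ℝ) ^ (-(t * E.1)) ≤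
      (B / 2) * (49 * ∑ i ∈ T, (2 : ℝ) ^ (-(t * m i))) := by gcongr
  nlinarith

lemma csq_par {n n' : ℕ} (h : n ≤ n') (c : ℕ × ℕ) : csq n' c ⊆ csq n (par (n' - n) c) := by
  have e : (2 : ℝ) ^ n' = 2 ^ n * 2 ^ (n' - n) := by rw [← pow_add]; congr 1; omega
  have key : ∀ a : ℕ, Set.Icc ((a : ℝ) / 2 ^ n') ((a + 1 : ℝ) / 2 ^ n') ⊆
      Set.Icc (((a / 2 ^ (n' - n) : ℕ) : ℝ) / 2 ^ n) ((((a / 2 ^ (n' - n) : ℕ) : ℝ) + 1) / 2 ^ n) := by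
    intro a
    apply Set.Icc_subset_Icc
    · rw [div_le_div_iff₀ (by positivity) (by positivity), e]
      have : ((a / 2 ^ (n' - n) : ℕ) : ℝ) * 2 ^ (n' - n) ≤ a := by
        exact_mod_cast Nat.div_mul_le_self a (2 ^ (n' - n))
      have hp : (0 : ℝ) < 2 ^ n := by positivity
      nlinarith
    · rw [div_le_div_iff₀ (by positivity) (by positivity), e]
      have : (a : ℝ) + 1 ≤ (((a / 2 ^ (n' - n) : ℕ) : ℝ) + 1) * 2 ^ (n' - n) := by
        have := Nat.lt_div_mul_add (a := a) (b := 2 ^ (n' - n)) (by positivity)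
        have h2 : a + 1 ≤ (a / 2 ^ (n' - n) + 1) * 2 ^ (n' - n) := by rw [add_mul]; omega
        exact_mod_cast h2
      have hp : (0 : ℝ) < 2 ^ n := by positivity
      nlinarith
  exact Set.prod_mono (key c.1) (key c.2)

lemma csq_compact (n : ℕ) (c : ℕ × ℕ) : IsCompact (csq n c) := isCompact_Icc.prod isCompact_Icc

lemma corner_mem (n : ℕ) (c : ℕ × ℕ) : ((c.1 : ℝ) / 2 ^ n, (c.2 : ℝ) / 2 ^ n) ∈ csq n c := by
  constructor
  · simp only [Set.mem_Icc, le_refl, true_and]; gcongr; linarith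
  · simp only [Set.mem_Icc, le_refl, true_and]; gcongr; linarith

/-- support -/
def supp (n : ℕ) (μ : ℕ × ℕ → ℝ) : Set (ℝ × ℝ) :=
  ⋃ c ∈ {c | c ∈ idx n ∧ μ c ≠ 0}, csq n c

lemma supp_compact (n : ℕ) (μ : ℕ × ℕ → ℝ) : IsCompact (supp n μ) := by
  refine Set.Finite.isCompact_biUnion ?_ (fun c _ => csq_compact n c)
  exact (idx n).finite_toSet.subset (fun c hc => hc.1)

lemma good_zero {s : ℝ} : Good s 0 (fun _ => 1) := by
  have h0 : idx 0 = {(0, 0)} := by decide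
  refine ⟨fun _ => zero_le_one, by simp [h0], ?_⟩
  intro m hm
  obtain rfl : m = 0 := by omega
  rw [h0, Finset.sum_singleton, coarse_self (by simp [h0])]
  simp

lemma mem_target {q : ℝ × ℝ} (h : ∀ k : ℕ, q ∈ Eset (5 - 1 / (k + 1)) k) :
    DualExpGeFive q.1 q.2 := by
  intro w hw
  obtain ⟨k0, hk0⟩ := exists_nat_one_div_lt (sub_pos.2 hw)
  intro hfin
  obtain ⟨b, hb⟩ := (hfin.image Prod.snd).bddAbove
  set k := max k0 (b.toNat + 1) with hk
  obtain ⟨x, y, hky, hy, hxy⟩ := h k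
  have hmem : ((x : ℤ), (y : ℤ)) ∈ {p : ℤ × ℤ | p ≠ 0 ∧
      distNearestInt (p.1 * q.1 + p.2 * q.2) ≤ ((|p.1| + |p.2| : ℤ) : ℝ) ^ (-w)} := by
    constructor
    · intro h0
      have : (y : ℤ) = 0 := (Prod.ext_iff.1 h0).2
      omega
    · have e : (((|(x : ℤ)| + |(y : ℤ)| : ℤ)) : ℝ) = (x : ℝ) + y := by
        rw [abs_of_nonneg (by positivity), abs_of_nonneg (by positivity)]; push_cast; rfl
      dsimp only
      rw [e]
      push_cast
      refine hxy.trans ?_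
      apply Real.rpow_le_rpow_of_exponent_le
      · have : (1 : ℝ) ≤ y := by exact_mod_cast hy
        have : (0 : ℝ) ≤ x := by positivity
        linarith
      · have : (1 : ℝ) / (k + 1) ≤ 1 / (k0 + 1) := by
          have : (k0 : ℝ) ≤ k := by exact_mod_cast le_max_left _ _
          gcongr
        linarith
  have h1 : (y : ℤ) ≤ b := hb ⟨_, hmem, rfl⟩
  have h2 : b.toNat + 1 ≤ k := le_max_right _ _
  omega

lemma cover_scale {d : ℝ} (hd : 0 < d) {t : Set (ℝ × ℝ)} (ht : Metric.ediam t ≤ 1) {ε : ℝ≥0∞}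
    (hε : 0 < ε) : ∃ (m : ℕ) (p : ℝ × ℝ), t ⊆ Metric.closedBall p (1 / 2 ^ m) ∧
      ENNReal.ofReal ((2 : ℝ) ^ (-(d * m))) ≤
        ENNReal.ofReal (2 ^ d) * (⨆ _ : t.Nonempty, Metric.ediam t ^ d) + ε := by
  have small : ∃ m : ℕ, ENNReal.ofReal ((2 : ℝ) ^ (-(d * m))) ≤ ε := by
    have h1 : Filter.Tendsto (fun m : ℕ => ENNReal.ofReal (((2 : ℝ) ^ (-d)) ^ m)) Filter.atTop
        (nhds (ENNReal.ofReal 0)) := by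
      apply ENNReal.tendsto_ofReal
      exact tendsto_pow_atTop_nhds_zero_of_lt_one (by positivity)
        (Real.rpow_lt_one_of_one_lt_of_neg (by norm_num) (by linarith))
    rw [ENNReal.ofReal_zero] at h1
    obtain ⟨m, hm⟩ := (h1.eventually (gt_mem_nhds hε)).exists
    refine ⟨m, ?_⟩
    rw [show -(d * (m : ℝ)) = -d * m by ring, Real.rpow_mul (by norm_num), Real.rpow_natCast]
    exact hm.le
  rcases t.eq_empty_or_nonempty with rfl | hne
  · obtain ⟨m, hm⟩ := small
    exact ⟨m, 0, by simp, hm.trans le_add_self⟩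
  obtain ⟨p, hp⟩ := hne
  have hsup : (⨆ _ : t.Nonempty, Metric.ediam t ^ d) = Metric.ediam t ^ d := by
    rw [iSup_pos ⟨p, hp⟩]
  have hfin : Metric.ediam t ≠ ∞ := (ht.trans_lt ENNReal.one_lt_top).ne
  rw [hsup]
  have sub : ∀ r : ℝ, (Metric.ediam t).toReal ≤ r → t ⊆ Metric.closedBall p r := by
    intro r hr q hq
    rw [Metric.mem_closedBall]
    refine le_trans ?_ hr
    rw [dist_edist]
    exact ENNReal.toReal_mono hfin (Metric.edist_le_ediam_of_mem hq hp)
  by_cases h0 : Metric.ediam t = 0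
  · obtain ⟨m, hm⟩ := small
    refine ⟨m, p, sub _ ?_, hm.trans le_add_self⟩
    rw [h0]; simp
  · have hpos : 0 < (Metric.ediam t).toReal := ENNReal.toReal_pos h0 hfin
    have hle : (Metric.ediam t).toReal ≤ 1 := by
      have := ENNReal.toReal_mono ENNReal.one_ne_top ht
      simpa using this
    obtain ⟨m, h1, h2⟩ := exists_nat_pow_near_of_lt_one hpos hle (y := (1 / 2 : ℝ))
      (by norm_num) (by norm_num)
    refine ⟨m, p, sub _ (by simpa using h2), le_trans ?_ le_self_add⟩
    rw [← ENNReal.ofReal_toReal hfin, ENNReal.ofReal_rpow_of_pos hpos, ← ENNReal.ofReal_mul (by positivity)]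
    apply ENNReal.ofReal_le_ofReal
    rw [← Real.mul_rpow (by norm_num) hpos.le,
      show -(d * (m : ℝ)) = -m * d by ring, Real.rpow_mul (by norm_num)]
    apply Real.rpow_le_rpow (by positivity) _ hd.le
    rw [Real.rpow_neg (by norm_num), Real.rpow_natCast]
    rw [pow_succ] at h1
    have : ((2 : ℝ) ^ m)⁻¹ = (1 / 2) ^ m := by simp
    linarith

theorem lower_bound (hG : LemG) (t : NNReal) (ht0 : 0 < t) (ht : (t : ℝ) < 3 / 2) :
    (t : ℝ≥0∞) ≤ dimH {p : ℝ × ℝ | DualExpGeFive p.1 p.2} := by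
  obtain ⟨s, hts, hs⟩ := exists_between ht
  -- construct the sequence
  have hstep : ∀ (k : ℕ) (P : {P : ℕ × (ℕ × ℕ → ℝ) // Good s P.1 P.2}),
      ∃ P' : {P : ℕ × (ℕ × ℕ → ℝ) // Good s P.1 P.2}, P.1.1 < P'.1.1 ∧
        ∀ c ∈ idx P'.1.1, P'.1.2 c ≠ 0 →
          P.1.2 (par (P'.1.1 - P.1.1) c) ≠ 0 ∧ csq P'.1.1 c ⊆ Eset (5 - 1 / (k + 1)) k := by
    intro k P
    have hk : (1 : ℝ) / (k + 1) ≤ 1 := by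
      rw [div_le_one (by positivity)]; have : (0 : ℝ) ≤ k := by positivity
      linarith
    have hk' : (0 : ℝ) < 1 / (k + 1) := by positivity
    obtain ⟨n', hn, μ', hμ, h⟩ := step hG hs P.2 (w := 5 - 1 / (k + 1)) (by linarith)
      (by linarith) k
    exact ⟨⟨(n', μ'), hμ⟩, hn, h⟩
  choose F hF1 hF2 using hstep
  set P : ℕ → {P : ℕ × (ℕ × ℕ → ℝ) // Good s P.1 P.2} :=
    fun k => Nat.rec ⟨(0, fun _ => 1), good_zero⟩ (fun k P => F k P) k with hP
  have hPs : ∀ k, P (k + 1) = F k (P k) := fun k => rfl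
  have hn : ∀ k, (P k).1.1 < (P (k + 1)).1.1 := fun k => hF1 k (P k)
  have hmono : StrictMono (fun k => (P k).1.1) := strictMono_nat_of_lt_succ hn
  set K : ℕ → Set (ℝ × ℝ) := fun k => supp (P k).1.1 (P k).1.2 with hK
  have hKc : ∀ k, IsCompact (K k) := fun k => supp_compact _ _
  have hKanti : Antitone K := by
    apply antitone_nat_of_succ_le
    intro k q hq
    simp only [hK, supp, Set.mem_iUnion, Set.mem_setOf_eq] at hq ⊢
    obtain ⟨c, ⟨hc, hne⟩, hq⟩ := hq
    exact ⟨par _ c, ⟨par_mem (hn k).le hc, (hF2 k (P k) c hc hne).1⟩, csq_par (hn k).le c hq⟩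
  have hKt : (⋂ k, K k) ⊆ {p : ℝ × ℝ | DualExpGeFive p.1 p.2} := by
    intro q hq
    apply mem_target
    intro k
    have := Set.mem_iInter.1 hq (k + 1)
    simp only [hK, supp, Set.mem_iUnion, Set.mem_setOf_eq] at this
    obtain ⟨c, ⟨hc, hne⟩, hq⟩ := this
    exact (hF2 k (P k) c hc hne).2 hq
  refine le_trans ?_ (dimH_mono hKt)
  apply le_dimH_of_hausdorffMeasure_ne_zero
  intro hzero
  set B : ℝ := (1 - (2 : ℝ) ^ (-(s - t)))⁻¹ with hB
  have hBpos : 0 < B := by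
    apply inv_pos.2
    have := Real.rpow_lt_one_of_one_lt_of_neg (x := 2) (by norm_num) (show -(s - t) < 0 by linarith)
    linarith
  set η : ℝ := 1 / (49 * B * 2) with hη
  have hηpos : 0 < η := by positivity
  -- cover
  obtain ⟨ε, hε0, hεs⟩ := ENNReal.exists_pos_sum_of_countable'
    (ε := ENNReal.ofReal (η / 2)) (by simpa using hηpos) ℕ
  have h2d : ENNReal.ofReal ((2 : ℝ) ^ (t : ℝ)) ≠ 0 := by
    simp only [ne_eq, ENNReal.ofReal_eq_zero, not_le]; positivity
  obtain ⟨T, hT1, hT2, hT3⟩ : ∃ T : ℕ → Set (ℝ × ℝ), (⋂ k, K k) ⊆ ⋃ n, T n ∧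
      (∀ n, Metric.ediam (T n) ≤ 1) ∧
      ENNReal.ofReal ((2 : ℝ) ^ (t : ℝ)) * ∑' n, (⨆ _ : (T n).Nonempty, Metric.ediam (T n) ^ (t : ℝ))
        < ENNReal.ofReal (η / 2) := by
    rw [Measure.hausdorffMeasure_apply] at hzero
    have h1 := le_iSup₂ (f := fun (r : ℝ≥0∞) (_ : 0 < r) =>
      ⨅ (t' : ℕ → Set (ℝ × ℝ)) (_ : (⋂ k, K k) ⊆ ⋃ n, t' n) (_ : ∀ n, Metric.ediam (t' n) ≤ r),
          ∑' n, ⨆ _ : (t' n).Nonempty, Metric.ediam (t' n) ^ (t : ℝ)) 1 zero_lt_one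
    rw [hzero] at h1
    have h2 : (0 : ℝ≥0∞) < ENNReal.ofReal (η / 2) / ENNReal.ofReal ((2 : ℝ) ^ (t : ℝ)) :=
      ENNReal.div_pos (by simpa using hηpos) ENNReal.ofReal_ne_top
    have h3 := h1.trans_lt h2
    simp only [iInf_lt_iff] at h3
    obtain ⟨T, h4, h5, h6⟩ := h3
    refine ⟨T, h4, h5, ?_⟩
    rw [mul_comm]
    exact (ENNReal.lt_div_iff_mul_lt (Or.inl h2d) (Or.inl ENNReal.ofReal_ne_top)).1 h6
  choose m p hmp1 hmp2 using fun n => cover_scale (d := t) (by exact_mod_cast ht0) (hT2 n) (hε0 n)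
  have htot : ∑' n, ENNReal.ofReal ((2 : ℝ) ^ (-((t : ℝ) * m n))) < ENNReal.ofReal η := by
    refine (ENNReal.tsum_le_tsum hmp2).trans_lt ?_
    rw [ENNReal.tsum_add, ENNReal.tsum_mul_left]
    calc _ < ENNReal.ofReal (η / 2) + ENNReal.ofReal (η / 2) := ENNReal.add_lt_add hT3 hεs
      _ = ENNReal.ofReal η := by
        rw [← ENNReal.ofReal_add (by positivity) (by positivity)]; congr 1; ring
  set U : ℕ → Set (ℝ × ℝ) := fun n => Metric.ball (p n) (2 / 2 ^ (m n)) with hU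
  have hTU : ∀ n, T n ⊆ U n := fun n => (hmp1 n).trans (Metric.closedBall_subset_ball (by
    gcongr; norm_num))
  have hUo : ∀ n, IsOpen (U n) := fun n => Metric.isOpen_ball
  obtain ⟨k, hk⟩ := exists_subset_nhds_of_isCompact (V := K) (U := ⋃ n, U n)
    hKanti.directed_ge hKc (by
      intro x hx
      refine (isOpen_iUnion hUo).mem_nhds ?_
      exact Set.iUnion_mono hTU (hT1 hx))
  obtain ⟨S, hS⟩ := (hKc k).elim_finite_subcover U hUo hk
  set k' := max k (S.sup m) with hk'
  have hmn : ∀ i ∈ S, m i ≤ (P k').1.1 := fun i hi =>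
    (Finset.le_sup hi).trans ((le_max_right _ _).trans (hmono.id_le k'))
  have hfin := finite_stage hts (P k').2 S m p hmn (by
    intro c hc hne
    have hmem : ((c.1 : ℝ) / 2 ^ (P k').1.1, (c.2 : ℝ) / 2 ^ (P k').1.1) ∈ K k' := by
      simp only [hK, supp, Set.mem_iUnion, Set.mem_setOf_eq]
      exact ⟨c, ⟨hc, hne⟩, corner_mem _ _⟩
    have h1 := hS (hKanti (le_max_left _ _) hmem)
    simp only [Set.mem_iUnion] at h1
    obtain ⟨i, hi, h2⟩ := h1
    refine ⟨i, hi, ?_⟩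
    rw [hU, Metric.mem_ball, Prod.dist_eq, max_lt_iff, Real.dist_eq, Real.dist_eq] at h2
    exact h2)
  have hsum : ∑ i ∈ S, (2 : ℝ) ^ (-((t : ℝ) * m i)) < η := by
    have h1 := (ENNReal.sum_le_tsum S).trans_lt htot
    rw [← ENNReal.ofReal_sum_of_nonneg (fun i _ => by positivity)] at h1
    exact (ENNReal.ofReal_lt_ofReal_iff hηpos).1 h1
  have : 49 * B * ∑ i ∈ S, (2 : ℝ) ^ (-((t : ℝ) * m i)) < 49 * B * η := by gcongr
  have e : 49 * B * η = 1 / 2 := by rw [hη]; field_simp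
  linarith


abbrev TT := UnitAddCircle

lemma mp_circle (t : ℝ) : MeasurePreserving (fun x : ℝ => (x : TT)) (volume.restrict (Set.Ico t (t + 1))) volume := by
  have := UnitAddCircle.measurePreserving_mk t
  rwa [Measure.restrict_congr_set Ico_ae_eq_Ioc.symm] at this

lemma vol_ball (c : TT) {δ : ℝ} (h : δ < 1 / 2) :
    volume (Metric.closedBall c δ) = ENNReal.ofReal (2 * δ) := by
  rw [AddCircle.volume_closedBall, min_eq_right (by linarith)]

def unitSq : Set (ℝ × ℝ) := Set.Ico 0 1 ×ˢ Set.Ico 0 1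

lemma mp_torus : MeasurePreserving (fun p : ℝ × ℝ => ((p.1 : TT), (p.2 : TT)))
    (volume.restrict unitSq) (volume : Measure (TT × TT)) := by
  have h := (mp_circle 0).prod (mp_circle 0)
  rw [zero_add, Measure.prod_restrict] at h
  exact h

def hom2 (x y x' y' : ℤ) : TT × TT →+ TT × TT where
  toFun p := (x • p.1 + y • p.2, x' • p.1 + y' • p.2)
  map_zero' := by simp
  map_add' p q := by ext <;> simp <;> abel

lemma mp_hom2 {x y x' y' : ℤ} (h : x * y' - x' * y ≠ 0) :
    MeasurePreserving (hom2 x y x' y') (volume : Measure (TT × TT)) volume := by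
  have hc : Continuous (hom2 x y x' y') := by
    show Continuous fun p : TT × TT => (x • p.1 + y • p.2, x' • p.1 + y' • p.2)
    fun_prop
  have : (volume : Measure (TT × TT)).IsAddHaarMeasure :=
    inferInstanceAs ((volume : Measure TT).prod (volume : Measure TT)).IsAddHaarMeasure
  refine AddMonoidHom.measurePreserving hc ?_ rfl
  rintro ⟨s, t⟩
  induction s using QuotientAddGroup.induction_on with | H s => ?_
  induction t using QuotientAddGroup.induction_on with | H t => ?_
  have h' : (x : ℝ) * y' - x' * y ≠ 0 := by exact_mod_cast h
  refine ⟨(((( s * y' - t * y) / (x * y' - x' * y) : ℝ) : TT), (((x * t - x' * s) / (x * y' - x' * y) : ℝ) : TT)), ?_⟩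
  ext
  · show x • (_ : TT) + y • (_ : TT) = _
    rw [← AddCircle.coe_zsmul, ← AddCircle.coe_zsmul, ← AddCircle.coe_add]
    congr 1
    simp only [zsmul_eq_mul]
    rw [mul_div_assoc', mul_div_assoc', ← add_div, div_eq_iff h']
    ring
  · show x' • (_ : TT) + y' • (_ : TT) = _
    rw [← AddCircle.coe_zsmul, ← AddCircle.coe_zsmul, ← AddCircle.coe_add]
    congr 1
    simp only [zsmul_eq_mul]
    rw [mul_div_assoc', mul_div_assoc', ← add_div, div_eq_iff h']
    ring

/-- strip -/
def strip (δ : ℝ) (x y : ℕ) : Set (ℝ × ℝ) :=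
  {p | ‖((x * p.1 + y * p.2 : ℝ) : TT)‖ ≤ δ}

lemma coe_lin (x y : ℕ) (p : ℝ × ℝ) : ((x * p.1 + y * p.2 : ℝ) : TT) = (x : ℤ) • (p.1 : TT) + (y : ℤ) • (p.2 : TT) := by
  rw [← AddCircle.coe_zsmul, ← AddCircle.coe_zsmul, ← AddCircle.coe_add]
  simp

lemma strip_meas (δ : ℝ) (x y : ℕ) : MeasurableSet (strip δ x y) := by
  have : IsClosed (strip δ x y) := by
    refine isClosed_le ?_ continuous_const
    refine continuous_norm.comp ((AddCircle.continuous_mk' 1).comp ?_)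
    fun_prop
  exact this.measurableSet

lemma vol_two {x y x' y' : ℕ} (h : (x : ℤ) * y' - x' * y ≠ 0) {δ : ℝ} (h0 : 0 ≤ δ) (hδ : δ < 1 / 2) (u : ℝ × ℝ) :
    volume (unitSq ∩ {p | p ∈ strip δ x y ∧ p + u ∈ strip δ x' y'}) = ENNReal.ofReal ((2 * δ) ^ 2) := by
  have h1 := (mp_hom2 h).comp mp_torus
  set B : Set (TT × TT) := Metric.closedBall 0 δ ×ˢ Metric.closedBall (-((x' * u.1 + y' * u.2 : ℝ) : TT)) δ
  have hB : MeasurableSet B := measurableSet_closedBall.prod measurableSet_closedBall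
  have h2 := h1.measure_preimage hB.nullMeasurableSet
  rw [Measure.restrict_apply (h1.measurable hB), Set.inter_comm] at h2
  have h3 : volume B = ENNReal.ofReal ((2 * δ) ^ 2) := by
    rw [show (volume : Measure (TT × TT)) = volume.prod volume from rfl, Measure.prod_prod, vol_ball _ hδ, vol_ball _ hδ, ← ENNReal.ofReal_mul (by linarith), sq]
  rw [← h3, ← h2]
  congr 1
  ext p
  refine and_congr_right fun _ => ?_
  show _ ↔ ((x : ℤ) • (p.1 : TT) + (y : ℤ) • (p.2 : TT), (x' : ℤ) • (p.1 : TT) + (y' : ℤ) • (p.2 : TT)) ∈ B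
  rw [← coe_lin, ← coe_lin]
  simp only [B, Set.mem_prod, Metric.mem_closedBall, dist_eq_norm, sub_zero, sub_neg_eq_add, ← AddCircle.coe_add]
  refine and_congr Iff.rfl ?_
  show ‖_‖ ≤ δ ↔ _
  rw [show ((x' : ℝ) * (p + u).1 + y' * (p + u).2) = x' * p.1 + y' * p.2 + (x' * u.1 + y' * u.2) by simp; ring]

lemma vol_one {x y : ℕ} (hy : y ≠ 0) {δ : ℝ} (hδ : δ < 1 / 2)  :
    volume (unitSq ∩ strip δ x y) = ENNReal.ofReal (2 * δ) := by
  have h1 := (mp_hom2 (x := 1) (y := 0) (x' := x) (y' := y) (by simpa using hy)).comp mp_torus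
  set B : Set (TT × TT) := Set.univ ×ˢ Metric.closedBall 0 δ
  have hB : MeasurableSet B := MeasurableSet.univ.prod measurableSet_closedBall
  have h2 := h1.measure_preimage hB.nullMeasurableSet
  rw [Measure.restrict_apply (h1.measurable hB), Set.inter_comm] at h2
  have h3 : volume B = ENNReal.ofReal (2 * δ) := by
    rw [show (volume : Measure (TT × TT)) = volume.prod volume from rfl, Measure.prod_prod, vol_ball _ hδ]
    simp
  rw [← h3, ← h2]
  congr 1
  ext p
  refine and_congr_right fun _ => ?_
  show _ ↔ (_, (x : ℤ) • (p.1 : TT) + (y : ℤ) • (p.2 : TT)) ∈ B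
  rw [← coe_lin]
  simp only [B, Set.mem_prod, Metric.mem_closedBall, dist_zero_right, Set.mem_univ, true_and]
  rfl

/-- slices -/
lemma vol_slice_unit (t : ℝ) (c : TT) {δ : ℝ} (hδ : δ < 1 / 2) :
    volume (Set.Ico t (t + 1) ∩ {u : ℝ | ‖(u : TT) + c‖ ≤ δ}) = ENNReal.ofReal (2 * δ) := by
  have h2 := (mp_circle t).measure_preimage (s := Metric.closedBall (-c) δ) measurableSet_closedBall.nullMeasurableSet
  rw [Measure.restrict_apply ((mp_circle t).measurable measurableSet_closedBall), Set.inter_comm, vol_ball _ hδ] at h2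
  rw [← h2]
  congr 1
  ext u
  simp [dist_eq_norm]

lemma vol_slice (t L : ℝ) (hL : 0 ≤ L) (c : TT) {δ : ℝ} (h0 : 0 ≤ δ) (hδ : δ < 1 / 2) :
    volume (Set.Ico t (t + L) ∩ {u : ℝ | ‖(u : TT) + c‖ ≤ δ}) ≤ ENNReal.ofReal ((L + 1) * (2 * δ)) := by
  have hsub : (Set.Ico t (t + L) ∩ {u : ℝ | ‖(u : TT) + c‖ ≤ δ}) ⊆
      ⋃ i ∈ Finset.range ⌈L⌉₊, (Set.Ico (t + i) (t + i + 1) ∩ {u : ℝ | ‖(u : TT) + c‖ ≤ δ}) := by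
    rintro u ⟨⟨h1, h2⟩, h3⟩
    simp only [Set.mem_iUnion]
    refine ⟨⌊u - t⌋₊, ?_, ⟨?_, ?_⟩, h3⟩
    · rw [Finset.mem_range, Nat.floor_lt (by linarith)]
      exact (by linarith : u - t < L).trans_le (Nat.le_ceil L)
    · linarith [Nat.floor_le (by linarith : 0 ≤ u - t)]
    · linarith [Nat.lt_floor_add_one (u - t)]
  refine (measure_mono hsub).trans ((measure_biUnion_finset_le _ _).trans ?_)
  simp only [vol_slice_unit _ c hδ, Finset.sum_const, Finset.card_range, nsmul_eq_mul]
  rw [ENNReal.ofReal_mul (p := L + 1) (by linarith)]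
  refine mul_le_mul_left ?_ _
  rw [← ENNReal.ofReal_natCast]
  exact ENNReal.ofReal_le_ofReal (Nat.ceil_lt_add_one hL).le

lemma vol_slice_y (s l : ℝ) (hl : 0 ≤ l) (y : ℝ) (hy : 0 < y) (c : TT) {δ : ℝ} (h0 : 0 ≤ δ) (hδ : δ < 1 / 2) :
    volume (Set.Ico s (s + l) ∩ {b : ℝ | ‖((y * b : ℝ) : TT) + c‖ ≤ δ}) ≤ ENNReal.ofReal ((l + 1 / y) * (2 * δ)) := by
  have : (Set.Ico s (s + l) ∩ {b : ℝ | ‖((y * b : ℝ) : TT) + c‖ ≤ δ}) = (fun b => y * b) ⁻¹' (Set.Ico (y * s) (y * s + y * l) ∩ {u : ℝ | ‖(u : TT) + c‖ ≤ δ}) := by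
    ext b
    simp only [Set.mem_inter_iff, Set.mem_preimage, Set.mem_Ico, ← mul_add, mul_le_mul_iff_right₀ hy, mul_lt_mul_iff_right₀ hy]
    rfl
  rw [this, Real.volume_preimage_mul_left hy.ne']
  refine (mul_le_mul_right (vol_slice _ _ (by positivity) c h0 hδ) _).trans ?_
  rw [← ENNReal.ofReal_mul (by positivity)]
  apply ENNReal.ofReal_le_ofReal
  rw [abs_of_pos (by positivity)]
  apply le_of_eq
  field_simp


def hsq (n : ℕ) (c : ℕ × ℕ) : Set (ℝ × ℝ) :=
  {p | (0 ≤ p.1 ∧ 0 ≤ p.2) ∧ ⌊(2 : ℝ) ^ n * p.1⌋₊ = c.1 ∧ ⌊(2 : ℝ) ^ n * p.2⌋₊ = c.2}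

lemma floor_iff (n c : ℕ) (a : ℝ) : (0 ≤ a ∧ ⌊(2 : ℝ) ^ n * a⌋₊ = c) ↔
    a ∈ Set.Ico ((c : ℝ) / 2 ^ n) ((c : ℝ) / 2 ^ n + 1 / 2 ^ n) := by
  have h2 : (0 : ℝ) < 2 ^ n := by positivity
  rw [Set.mem_Ico, ← add_div, div_le_iff₀' h2, lt_div_iff₀' h2]
  constructor
  · rintro ⟨h, rfl⟩
    exact ⟨Nat.floor_le (by positivity), Nat.lt_floor_add_one _⟩
  · rintro ⟨h, h'⟩
    have : 0 ≤ a := by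
      have : 0 ≤ (2 : ℝ) ^ n * a := le_trans (by positivity) h
      exact nonneg_of_mul_nonneg_right this h2
    exact ⟨this, (Nat.floor_eq_iff (by positivity)).2 ⟨h, h'⟩⟩

lemma hsq_eq (n : ℕ) (c : ℕ × ℕ) : hsq n c =
    Set.Ico ((c.1 : ℝ) / 2 ^ n) ((c.1 : ℝ) / 2 ^ n + 1 / 2 ^ n) ×ˢ
    Set.Ico ((c.2 : ℝ) / 2 ^ n) ((c.2 : ℝ) / 2 ^ n + 1 / 2 ^ n) := by
  ext p
  rw [Set.mem_prod, ← floor_iff, ← floor_iff]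
  simp only [hsq, Set.mem_ofPred_eq]
  tauto

lemma hsq_meas (n : ℕ) (c : ℕ × ℕ) : MeasurableSet (hsq n c) := by
  rw [hsq_eq]; exact measurableSet_Ico.prod measurableSet_Ico

lemma hsq_disj (n : ℕ) {c d : ℕ × ℕ} (h : c ≠ d) : Disjoint (hsq n c) (hsq n d) := by
  rw [Set.disjoint_left]
  rintro p ⟨_, h1, h2⟩ ⟨_, h3, h4⟩
  exact h (Prod.ext (h1.symm.trans h3) (h2.symm.trans h4))

lemma floor_par {m n : ℕ} (h : m ≤ n) (a : ℝ) :
    ⌊(2 : ℝ) ^ n * a⌋₊ / 2 ^ (n - m) = ⌊(2 : ℝ) ^ m * a⌋₊ := by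
  rw [← Nat.floor_div_natCast]
  congr 1
  push_cast
  rw [show (2 : ℝ) ^ n = 2 ^ m * 2 ^ (n - m) by rw [← pow_add]; congr 1; omega]
  field_simp

lemma hsq_union {m n : ℕ} (h : m ≤ n) {D : ℕ × ℕ} (hD : D ∈ idx m) :
    hsq m D = ⋃ c ∈ (idx n).filter (fun c => par (n - m) c = D), hsq n c := by
  ext p
  simp only [Set.mem_iUnion, Finset.mem_filter]
  constructor
  · rintro ⟨h0, h1, h2⟩
    rw [mem_idx] at hD
    have e : 2 ^ n = 2 ^ m * 2 ^ (n - m) := by rw [← pow_add]; congr 1; omega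
    have key : ∀ a : ℝ, ⌊(2 : ℝ) ^ m * a⌋₊ < 2 ^ m → ⌊(2 : ℝ) ^ n * a⌋₊ < 2 ^ n := by
      intro a ha
      rw [← floor_par h, Nat.div_lt_iff_lt_mul (by positivity), ← e] at ha
      exact ha
    refine ⟨(⌊(2 : ℝ) ^ n * p.1⌋₊, ⌊(2 : ℝ) ^ n * p.2⌋₊), ⟨mem_idx.2 ⟨key _ (h1 ▸ hD.1), key _ (h2 ▸ hD.2)⟩, ?_⟩, h0, rfl, rfl⟩
    simp only [par, floor_par h, h1, h2]
  · rintro ⟨c, ⟨_, rfl⟩, h0, h1, h2⟩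
    refine ⟨h0, ?_, ?_⟩
    · rw [← floor_par h, h1]; rfl
    · rw [← floor_par h, h2]; rfl

lemma hsq_zero : hsq 0 (0, 0) = unitSq := by
  rw [hsq_eq]; simp [unitSq]

lemma hsq_sub {m : ℕ} {D : ℕ × ℕ} (hD : D ∈ idx m) : hsq m D ⊆ unitSq := by
  rw [← hsq_zero, hsq_union (Nat.zero_le m) (D := (0, 0)) (by simp [idx])]
  refine Set.subset_biUnion_of_mem (u := fun c => hsq m c) ?_
  simp only [Finset.coe_filter, Set.mem_ofPred_eq, hD, true_and]
  rw [mem_idx] at hD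
  simp [par, Nat.div_eq_of_lt hD.1, Nat.div_eq_of_lt hD.2]

lemma hsq_sub_csq (n : ℕ) (c : ℕ × ℕ) : hsq n c ⊆ csq n c := by
  rw [hsq_eq]
  simp only [← add_div]
  exact Set.prod_mono Set.Ico_subset_Icc_self Set.Ico_subset_Icc_self

lemma hsq_vol (n : ℕ) (c : ℕ × ℕ) : volume (hsq n c) = ENNReal.ofReal ((1 / 2 ^ n) * (1 / 2 ^ n)) := by
  rw [hsq_eq, show (volume : Measure (ℝ × ℝ)) = volume.prod volume from rfl, Measure.prod_prod,
    Real.volume_Ico, Real.volume_Ico, ← ENNReal.ofReal_mul (by simp)]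
  simp

lemma hsq_fin (n : ℕ) (c : ℕ × ℕ) (S : Set (ℝ × ℝ)) : volume (S ∩ hsq n c) ≠ ⊤ :=
  measure_ne_top_of_subset Set.inter_subset_right (by rw [hsq_vol]; exact ENNReal.ofReal_ne_top)

def mass (S : Set (ℝ × ℝ)) (n : ℕ) (c : ℕ × ℕ) : ℝ := volume.real (S ∩ hsq n c)

lemma mass_nonneg (S : Set (ℝ × ℝ)) (n : ℕ) (c : ℕ × ℕ) : 0 ≤ mass S n c := measureReal_nonneg

lemma coarse_mass {S : Set (ℝ × ℝ)} (hS : MeasurableSet S) {m n : ℕ} (h : m ≤ n) {D : ℕ × ℕ}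
    (hD : D ∈ idx m) : coarse n (mass S n) m D = mass S m D := by
  unfold coarse
  conv_rhs => rw [mass, hsq_union h hD, Set.inter_iUnion₂]
  rw [measureReal_biUnion_finset (h := fun c _ => hsq_fin n c S)]
  · rfl
  · intro c _ d _ hcd
    exact (hsq_disj n hcd).mono Set.inter_subset_right Set.inter_subset_right
  · exact fun c _ => hS.inter (hsq_meas n c)

lemma mass_sum {S : Set (ℝ × ℝ)} (hS : MeasurableSet S) (m : ℕ) :
    ∑ D ∈ idx m, mass S m D = volume.real (unitSq ∩ S) := by
  rw [← coarse_sum (Nat.zero_le m), show idx 0 = {(0, 0)} by simp [idx], Finset.sum_singleton,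
    coarse_mass hS (Nat.zero_le m) (by simp [idx]), mass, hsq_zero, Set.inter_comm]

lemma F4 {x y : ℕ} (hy : y ≠ 0) {δ : ℝ} (h0 : 0 ≤ δ) (hδ : δ < 1 / 2) (m : ℕ) :
    ∑ D ∈ idx m, mass (strip δ x y) m D = 2 * δ := by
  rw [mass_sum (strip_meas _ _ _), Measure.real, vol_one hy hδ, ENNReal.toReal_ofReal (by linarith)]

lemma F2a (S : Set (ℝ × ℝ)) (m : ℕ) (D : ℕ × ℕ) : mass S m D ≤ (1 / 2 ^ m) * (1 / 2 ^ m) := by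
  refine ENNReal.toReal_le_of_le_ofReal (by positivity) ?_
  rw [← hsq_vol m D]
  exact measure_mono Set.inter_subset_right

lemma F2b {x y : ℕ} (hy : 0 < y) {δ : ℝ} (h0 : 0 ≤ δ) (hδ : δ < 1 / 2) (m : ℕ) (D : ℕ × ℕ) :
    mass (strip δ x y) m D ≤ (1 / 2 ^ m) * ((1 / 2 ^ m + 1 / y) * (2 * δ)) := by
  refine ENNReal.toReal_le_of_le_ofReal (by positivity) ?_
  rw [show (volume : Measure (ℝ × ℝ)) = volume.prod volume from rfl,
    Measure.prod_apply ((strip_meas _ _ _).inter (hsq_meas _ _))]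
  set I := Set.Ico ((D.1 : ℝ) / 2 ^ m) ((D.1 : ℝ) / 2 ^ m + 1 / 2 ^ m) with hI
  calc _ ≤ ∫⁻ a, I.indicator (fun _ => ENNReal.ofReal ((1 / 2 ^ m + 1 / y) * (2 * δ))) a := by
        refine lintegral_mono fun a => ?_
        by_cases ha : a ∈ I
        · rw [Set.indicator_of_mem ha]
          refine le_trans (measure_mono ?_) (vol_slice_y ((D.2 : ℝ) / 2 ^ m) (1 / 2 ^ m) (by positivity) y (by exact_mod_cast hy) ((x * a : ℝ) : TT) h0 hδ)
          intro b hb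
          rw [hsq_eq] at hb
          refine ⟨hb.2.2, ?_⟩
          have := hb.1
          simp only [strip, Set.mem_ofPred_eq] at this ⊢
          rwa [← AddCircle.coe_add, add_comm]
        · rw [Set.indicator_of_notMem ha]
          rw [nonpos_iff_eq_zero]
          convert measure_empty (μ := (volume : Measure ℝ))
          ext b
          rw [hsq_eq]
          simp only [Set.mem_preimage, Set.mem_inter_iff, Set.mem_prod, Set.mem_empty_iff_false, iff_false]
          exact fun h => ha h.2.1
    _ = _ := by
        rw [lintegral_indicator_const measurableSet_Ico, Real.volume_Ico, mul_comm, ← ENNReal.ofReal_mul (by simp)]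
        simp

lemma F3 {x y x' y' : ℕ} (h : (x : ℤ) * y' - x' * y ≠ 0) {δ : ℝ} (h0 : 0 ≤ δ) (hδ : δ < 1 / 2) (m : ℕ) :
    ∑ D ∈ idx m, mass (strip δ x y) m D * mass (strip δ x' y') m D ≤ (2 * δ) ^ 2 * (4 * (1 / 2 ^ m) ^ 2) := by
  set S := strip δ x y
  set S' := strip δ x' y'
  set vol2 : Measure (ℝ × ℝ) := volume
  set U : ℕ × ℕ → Set ((ℝ × ℝ) × (ℝ × ℝ)) := fun D => (S ∩ hsq m D) ×ˢ (S' ∩ hsq m D)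
  have hS : MeasurableSet S := strip_meas _ _ _
  have hS' : MeasurableSet S' := strip_meas _ _ _
  have hU : ∀ D, MeasurableSet (U D) := fun D => (hS.inter (hsq_meas m D)).prod (hS'.inter (hsq_meas m D))
  have e1 : ∀ D, mass S m D * mass S' m D = (vol2.prod vol2).real (U D) := by
    intro D
    rw [measureReal_prod_prod]
    rfl
  simp only [e1]
  have hfin : ∀ D ∈ idx m, (vol2.prod vol2) (U D) ≠ ⊤ := by
    intro D _
    rw [Measure.prod_prod]
    exact ENNReal.mul_ne_top (hsq_fin _ _ _) (hsq_fin _ _ _)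
  rw [← measureReal_biUnion_finset (h := hfin)]
  rotate_left
  · intro c _ d _ hcd
    refine Set.disjoint_left.2 ?_
    rintro ⟨p, q⟩ h1 h2
    exact (Set.disjoint_left.1 (hsq_disj m hcd)) h1.1.2 h2.1.2
  · exact fun D _ => hU D
  refine ENNReal.toReal_le_of_le_ofReal (by positivity) ?_
  set W : Set ((ℝ × ℝ) × (ℝ × ℝ)) := {z | (z.1 ∈ unitSq ∩ S ∧ z.2 ∈ S') ∧ dist z.2 z.1 ≤ 1 / 2 ^ m}
  have hunit : MeasurableSet unitSq := measurableSet_Ico.prod measurableSet_Ico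
  have hW : MeasurableSet W := by
    refine ((measurable_fst (hunit.inter hS)).inter (measurable_snd hS')).inter ?_
    exact measurableSet_le (measurable_snd.dist measurable_fst) measurable_const
  have hsub : (⋃ D ∈ idx m, U D) ⊆ W := by
    refine Set.iUnion₂_subset fun D hD => ?_
    rintro ⟨p, q⟩ ⟨hp, hq⟩
    refine ⟨⟨⟨hsq_sub hD hp.2, hp.1⟩, hq.1⟩, ?_⟩
    have h1 := hp.2
    have h2 := hq.2
    rw [hsq_eq] at h1 h2
    obtain ⟨⟨a1, a2⟩, a3, a4⟩ := h1
    obtain ⟨⟨b1, b2⟩, b3, b4⟩ := h2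
    show dist q p ≤ _
    rw [Prod.dist_eq, Real.dist_eq, Real.dist_eq]
    simp only at *
    refine max_le (abs_le.2 ⟨?_, ?_⟩) (abs_le.2 ⟨?_, ?_⟩) <;> linarith
  refine (measure_mono hsub).trans ?_
  have hsh := measurePreserving_prod_add vol2 vol2
  rw [← hsh.measure_preimage hW.nullMeasurableSet, Measure.prod_apply_symm (hsh.measurable hW)]
  calc _ ≤ ∫⁻ u, (Metric.closedBall (0 : ℝ × ℝ) (1 / 2 ^ m)).indicator (fun _ => ENNReal.ofReal ((2 * δ) ^ 2)) u ∂vol2 := by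
        refine lintegral_mono fun u => ?_
        by_cases hu : u ∈ Metric.closedBall (0 : ℝ × ℝ) (1 / 2 ^ m)
        · rw [Set.indicator_of_mem hu, ← vol_two h h0 hδ u]
          refine measure_mono fun p hp => ?_
          exact ⟨hp.1.1.1, hp.1.1.2, hp.1.2⟩
        · rw [Set.indicator_of_notMem hu, nonpos_iff_eq_zero]
          convert measure_empty (μ := vol2)
          ext p
          simp only [Set.mem_empty_iff_false, iff_false]
          intro hp
          apply hu
          have := hp.2
          simpa using this
    _ = _ := by
        rw [lintegral_indicator_const measurableSet_closedBall, ENNReal.ofReal_mul (by positivity)]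
        congr 1
        rw [show (0 : ℝ × ℝ) = (0, 0) from rfl, ← closedBall_prod_same, show vol2 = volume.prod volume from rfl, Measure.prod_prod, Real.volume_closedBall, ← ENNReal.ofReal_mul (by positivity)]
        congr 1
        ring

lemma F1 {x y : ℕ} (hy : 0 < y) {δ : ℝ} (h0 : 0 ≤ δ) (hδ : δ < 1 / 2) {m M : ℕ} (hm : m ≤ M) {D : ℕ × ℕ} (hD : D ∈ idx m) :
    mass (strip δ (2 ^ M * x) (2 ^ M * y)) m D = 2 * δ / 4 ^ m := by
  set S := strip δ (2 ^ M * x) (2 ^ M * y)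
  have h2 : (2 : ℝ) ^ M = 2 ^ m * 2 ^ (M - m) := by rw [← pow_add]; congr 1; omega
  have key : ∀ D : ℕ × ℕ, mass S m D = mass S m (0, 0) := by
    intro D
    unfold mass Measure.real
    congr 1
    rw [← measure_preimage_add volume (((D.1 : ℝ) / 2 ^ m, (D.2 : ℝ) / 2 ^ m) : ℝ × ℝ) (S ∩ hsq m D)]
    congr 1
    ext p
    rw [hsq_eq, hsq_eq]
    simp only [Set.mem_preimage, Set.mem_inter_iff, Set.mem_prod, Set.mem_Ico, Prod.fst_add, Prod.snd_add, le_add_iff_nonneg_right, add_lt_add_iff_left, Nat.cast_zero, zero_div, zero_add]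
    refine and_congr_left fun _ => ?_
    show ‖_‖ ≤ δ ↔ ‖_‖ ≤ δ
    have e : ((((2 ^ M * x : ℕ) : ℝ) * ((D.1 : ℝ) / 2 ^ m + p.1) + ((2 ^ M * y : ℕ) : ℝ) * ((D.2 : ℝ) / 2 ^ m + p.2) : ℝ) : TT)
        = ((((2 ^ M * x : ℕ) : ℝ) * p.1 + ((2 ^ M * y : ℕ) : ℝ) * p.2 : ℝ) : TT) := by
      have : (((2 ^ M * x : ℕ) : ℝ) * ((D.1 : ℝ) / 2 ^ m + p.1) + ((2 ^ M * y : ℕ) : ℝ) * ((D.2 : ℝ) / 2 ^ m + p.2) : ℝ) =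
        ((((2 ^ (M - m) * (x * D.1 + y * D.2) : ℕ) : ℤ)) : ℝ) + (((2 ^ M * x : ℕ) : ℝ) * p.1 + ((2 ^ M * y : ℕ) : ℝ) * p.2) := by
        push_cast
        rw [h2]
        field_simp
        ring
      rw [this, AddCircle.coe_add]
      have h3 : ((((2 ^ (M - m) * (x * D.1 + y * D.2) : ℕ) : ℤ) : ℝ) : TT) = 0 := by
        rw [AddCircle.coe_eq_zero_iff]
        exact ⟨_, by rw [zsmul_one]⟩
      rw [h3, zero_add]
    exact iff_of_eq (congrArg (fun t : TT => ‖t‖ ≤ δ) e)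
  have hsum := F4 (x := 2 ^ M * x) (y := 2 ^ M * y) (by positivity) h0 hδ m
  rw [Finset.sum_congr rfl (fun E _ => key E), Finset.sum_const, nsmul_eq_mul, ← key D] at hsum
  have hc : ((idx m).card : ℝ) = 4 ^ m := by
    simp only [idx, Finset.card_product, Finset.card_range]
    push_cast
    rw [← mul_pow]; norm_num
  rw [hc] at hsum
  rw [eq_div_iff (by positivity), ← hsum]; ring


lemma energy_ineq {l r d N Y : ℝ} (hr0 : 0 < r) (hr1 : r ≤ 1) (hl : l = r ^ 2) (hd : 0 < d)
    (hN : 1 ≤ N) (hY : 0 < Y) (h : 1 ≤ d * Y * N ^ 2) :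
    (1 / (d * N)) ^ 2 * (N * (d * (l * min l ((l + 1 / Y) * d))) + N ^ 2 * (d ^ 2 * (4 * l ^ 2))) ≤ 6 * (l * r) := by
  have e : (1 / (d * N)) ^ 2 * (N * (d * (l * min l ((l + 1 / Y) * d))) + N ^ 2 * (d ^ 2 * (4 * l ^ 2)))
      = l * (min l ((l + 1 / Y) * d) / (d * N)) + 4 * l ^ 2 := by
    field_simp
  have hlr : l ≤ r := by rw [hl]; nlinarith
  have hl0 : 0 < l := by rw [hl]; positivity
  have key : min l ((l + 1 / Y) * d) / (d * N) ≤ l + r := by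
    rcases le_total r (d * N) with h1 | h1
    · have : min l ((l + 1 / Y) * d) / (d * N) ≤ l / (d * N) := by gcongr; exact min_le_left _ _
      refine this.trans ?_
      rw [div_le_iff₀ (by positivity), hl]
      have : 0 ≤ r ^ 2 * (d * N) := by positivity
      nlinarith
    · have : min l ((l + 1 / Y) * d) / (d * N) ≤ ((l + 1 / Y) * d) / (d * N) := by
        gcongr; exact min_le_right _ _
      refine this.trans ?_
      have e2 : ((l + 1 / Y) * d) / (d * N) = l / N + 1 / (Y * N) := by field_simp
      rw [e2]
      have h2 : l / N ≤ l := div_le_self hl0.le hN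
      have h3 : 1 / (Y * N) ≤ d * N := by
        rw [div_le_iff₀ (by positivity)]; nlinarith
      linarith
  rw [e]
  have : l * (min l ((l + 1 / Y) * d) / (d * N)) ≤ l * (l + r) := by gcongr
  have : l * l ≤ l * r := by gcongr
  nlinarith

lemma energy (V : Finset (ℕ × ℕ)) (hV : V.Nonempty) (e : ℕ) (he : 0 < e) {δ Y : ℝ} (h0 : 0 < δ) (hδ : δ < 1 / 2)
    (hY : 0 < Y) (hVY : ∀ v ∈ V, Y ≤ ((e * v.2 : ℕ) : ℝ))
    (hdet : ∀ v ∈ V, ∀ v' ∈ V, v ≠ v' → v.1 * v'.2 ≠ v'.1 * v.2)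
    (hbig : 1 ≤ 2 * δ * Y * (V.card : ℝ) ^ 2) (m : ℕ) :
    ∑ D ∈ idx m, ((1 / (2 * δ * V.card)) * ∑ v ∈ V, mass (strip δ (e * v.1) (e * v.2)) m D) ^ 2 ≤
      6 * (2 : ℝ) ^ (-(3 / 2 * m : ℝ)) := by
  set A : ℕ × ℕ → ℕ × ℕ → ℝ := fun v D => mass (strip δ (e * v.1) (e * v.2)) m D
  set l : ℝ := 1 / 2 ^ m with hl
  set N : ℝ := (V.card : ℝ) with hN
  have hN1 : 1 ≤ N := by rw [hN]; exact_mod_cast hV.card_pos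
  set K := l * min l ((l + 1 / Y) * (2 * δ)) with hK
  have hl0 : 0 < l := by positivity
  have hAK : ∀ v ∈ V, ∀ D, A v D ≤ K := by
    intro v hv D
    have hy : 0 < ((e * v.2 : ℕ) : ℝ) := hY.trans_le (hVY v hv)
    rw [hK, mul_min_of_nonneg _ _ hl0.le]
    refine le_min (F2a _ _ _) ((F2b (by exact_mod_cast hy) h0.le hδ m D).trans ?_)
    have := hVY v hv
    gcongr
  have hdiag : ∀ v ∈ V, ∑ D ∈ idx m, A v D * A v D ≤ 2 * δ * K := by
    intro v hv
    have hy : 0 < ((e * v.2 : ℕ) : ℝ) := hY.trans_le (hVY v hv)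
    have : e * v.2 ≠ 0 := by intro h; rw [h] at hy; simp at hy
    rw [← F4 (x := e * v.1) this h0.le hδ m, Finset.sum_mul]
    exact Finset.sum_le_sum fun D _ => mul_le_mul_of_nonneg_left (hAK v hv D) (mass_nonneg _ _ _)
  have hoff : ∀ v ∈ V, ∀ v' ∈ V, v ≠ v' → ∑ D ∈ idx m, A v D * A v' D ≤ (2 * δ) ^ 2 * (4 * l ^ 2) := by
    intro v hv v' hv' hne
    refine F3 ?_ h0.le hδ m
    have := hdet v hv v' hv' hne
    push_cast
    intro h
    apply this
    have he' : (e : ℤ) ≠ 0 := by exact_mod_cast he.ne'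
    have h3 : (e : ℤ) * e * (v.1 * v'.2 - v'.1 * v.2) = 0 := by linear_combination h
    have h4 := (mul_eq_zero.1 h3).resolve_left (mul_ne_zero he' he')
    have : (v.1 : ℤ) * v'.2 = v'.1 * v.2 := by linarith
    exact_mod_cast this
  have hrow : ∀ v ∈ V, ∑ v' ∈ V, ∑ D ∈ idx m, A v D * A v' D ≤ 2 * δ * K + N * ((2 * δ) ^ 2 * (4 * l ^ 2)) := by
    intro v hv
    rw [← Finset.add_sum_erase _ _ hv]
    refine add_le_add (hdiag v hv) ?_
    refine (Finset.sum_le_card_nsmul _ _ _ fun v' hv' => hoff v hv v' (Finset.mem_of_mem_erase hv') (Finset.ne_of_mem_erase hv').symm).trans ?_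
    rw [nsmul_eq_mul]
    gcongr
    rw [hN]
    exact_mod_cast Finset.card_le_card (Finset.erase_subset _ _)
  have htot : ∑ D ∈ idx m, (∑ v ∈ V, A v D) ^ 2 ≤ N * (2 * δ * K) + N ^ 2 * ((2 * δ) ^ 2 * (4 * l ^ 2)) := by
    calc _ = ∑ v ∈ V, ∑ v' ∈ V, ∑ D ∈ idx m, A v D * A v' D := by
          simp_rw [sq, Finset.sum_mul_sum]
          rw [Finset.sum_comm]
          exact Finset.sum_congr rfl fun v _ => Finset.sum_comm
      _ ≤ N * (2 * δ * K + N * ((2 * δ) ^ 2 * (4 * l ^ 2))) := by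
          refine (Finset.sum_le_card_nsmul _ _ _ hrow).trans (le_of_eq ?_)
          rw [nsmul_eq_mul]
      _ = _ := by ring
  simp_rw [mul_pow]
  rw [← Finset.mul_sum]
  set r : ℝ := (2 : ℝ) ^ (-(1 / 2 * m : ℝ)) with hr
  have hr0 : 0 < r := by positivity
  have hr1 : r ≤ 1 := Real.rpow_le_one_of_one_le_of_nonpos (by norm_num) (by
    have : (0 : ℝ) ≤ m := by positivity
    linarith)
  have hlr : l = r ^ 2 := by
    rw [hl, hr, ← Real.rpow_natCast ((2 : ℝ) ^ _) 2, ← Real.rpow_mul (by norm_num), one_div, ← Real.rpow_natCast, ← Real.rpow_neg (by norm_num)]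
    congr 1
    push_cast; ring
  have hlr2 : (2 : ℝ) ^ (-(3 / 2 * m : ℝ)) = l * r := by
    rw [hl, hr, one_div, ← Real.rpow_natCast, ← Real.rpow_neg (by norm_num), ← Real.rpow_add (by norm_num)]
    congr 1
    ring
  rw [hlr2]
  refine (mul_le_mul_of_nonneg_left htot (by positivity)).trans ?_
  have := energy_ineq hr0 hr1 hlr (d := 2 * δ) (by linarith) hN1 hY hbig
  rw [hK]
  simpa only [mul_pow] using this

def vecs (Q : ℕ) : Finset (ℕ × ℕ) :=
  (Finset.Ioc 0 Q ×ˢ Finset.Ioc 0 Q).filter fun v => Nat.Coprime v.1 v.2 ∧ Q < 8 * v.2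

lemma sum_inv_sq (n : ℕ) (hn : 2 ≤ n) : ∑ d ∈ Finset.Icc 2 n, (1 : ℝ) / d ^ 2 ≤ 3 / 4 - 1 / n := by
  induction n, hn using Nat.le_induction with
  | base => norm_num
  | succ n hn ih =>
    rw [Finset.sum_Icc_succ_top (by omega)]
    have hn0 : (0 : ℝ) < n := by exact_mod_cast (by omega : 0 < n)
    have : (1 : ℝ) / ((n + 1 : ℕ) : ℝ) ^ 2 ≤ 1 / n - 1 / ((n + 1 : ℕ) : ℝ) := by
      push_cast
      rw [div_sub_div _ _ hn0.ne' (by positivity), div_le_div_iff₀ (by positivity) (by positivity)]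
      nlinarith
    linarith

lemma vecs_card (Q : ℕ) (hQ : 2 ≤ Q) : (Q : ℝ) ^ 2 / 8 ≤ ((vecs Q).card : ℝ) := by
  set T := Finset.Ioc 0 Q ×ˢ Finset.Ioc 0 Q with hT
  have hsub : T ⊆ vecs Q ∪ ((Finset.Icc 2 Q).biUnion fun d =>
      (Finset.Ioc 0 Q).filter (d ∣ ·) ×ˢ (Finset.Ioc 0 Q).filter (d ∣ ·)) ∪
      (Finset.Ioc 0 Q ×ˢ Finset.Ioc 0 (Q / 8)) := by
    rintro ⟨x, y⟩ hv
    simp only [hT, Finset.mem_product, Finset.mem_Ioc] at hv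
    simp only [Finset.mem_union, vecs, Finset.mem_filter, Finset.mem_product, Finset.mem_Ioc, Finset.mem_biUnion, Finset.mem_Icc]
    by_cases h1 : Nat.Coprime x y
    · by_cases h2 : Q < 8 * y
      · exact Or.inl (Or.inl ⟨hv, h1, h2⟩)
      · exact Or.inr ⟨hv.1, hv.2.1, by omega⟩
    · refine Or.inl (Or.inr ⟨Nat.gcd x y, ⟨?_, ?_⟩, ⟨hv.1, Nat.gcd_dvd_left _ _⟩, hv.2, Nat.gcd_dvd_right _ _⟩)
      · have : 0 < Nat.gcd x y := Nat.gcd_pos_of_pos_left _ hv.1.1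
        have : Nat.gcd x y ≠ 1 := h1
        omega
      · exact (Nat.gcd_le_left _ hv.1.1).trans hv.1.2
  have h1 := (Finset.card_le_card hsub).trans ((Finset.card_union_le _ _).trans (Nat.add_le_add_right ((Finset.card_union_le _ _).trans (Nat.add_le_add_left Finset.card_biUnion_le _)) _))
  simp only [hT, Finset.card_product, Nat.card_Ioc, Nat.Ioc_filter_dvd_card_eq_div, Nat.sub_zero] at h1
  have h2 : (Q : ℝ) * Q ≤ (vecs Q).card + ∑ d ∈ Finset.Icc 2 Q, ((Q / d : ℕ) : ℝ) * ((Q / d : ℕ) : ℝ) + Q * ((Q / 8 : ℕ) : ℝ) := by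
    exact_mod_cast h1
  have h3 : ∑ d ∈ Finset.Icc 2 Q, ((Q / d : ℕ) : ℝ) * ((Q / d : ℕ) : ℝ) ≤ Q ^ 2 * (3 / 4) := by
    calc _ ≤ ∑ d ∈ Finset.Icc 2 Q, (Q : ℝ) ^ 2 * (1 / d ^ 2) := by
          refine Finset.sum_le_sum fun d _ => ?_
          have : ((Q / d : ℕ) : ℝ) ≤ Q / d := Nat.cast_div_le
          calc _ ≤ (Q / d : ℝ) * (Q / d) := by gcongr
            _ = _ := by ring
      _ ≤ _ := by
          rw [← Finset.mul_sum]
          gcongr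
          refine (sum_inv_sq Q hQ).trans ?_
          have : (0 : ℝ) ≤ 1 / Q := by positivity
          linarith
  have h4 : ((Q / 8 : ℕ) : ℝ) ≤ Q / 8 := by exact_mod_cast Nat.cast_div_le (α := ℝ) (m := Q) (n := 8)
  have h5 : (Q : ℝ) * ((Q / 8 : ℕ) : ℝ) ≤ Q * (Q / 8) := by gcongr
  nlinarith

lemma vecs_det (Q : ℕ) : ∀ v ∈ vecs Q, ∀ v' ∈ vecs Q, v ≠ v' → v.1 * v'.2 ≠ v'.1 * v.2 := by
  rintro ⟨x, y⟩ hv ⟨x', y'⟩ hv' hne h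
  simp only [vecs, Finset.mem_filter, Finset.mem_product, Finset.mem_Ioc] at hv hv' h
  apply hne
  have h1 : x ∣ x' := by
    have : x ∣ x' * y := ⟨y', h.symm⟩
    exact hv.2.1.dvd_of_dvd_mul_right this
  have h2 : x' ∣ x := by
    have : x' ∣ x * y' := ⟨y, h⟩
    exact hv'.2.1.dvd_of_dvd_mul_right this
  have h3 := Nat.dvd_antisymm h1 h2
  subst h3
  have := Nat.eq_of_mul_eq_mul_left hv.1.1.1 h
  rw [this]

lemma exists_Q (M k : ℕ) {w : ℝ} (hw : w < 5) : ∃ Q : ℕ, 2 ≤ Q ∧ 8 * k ≤ Q ∧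
    512 ≤ ((2 : ℝ) ^ (M + 1) * Q) ^ (-w) * (Q : ℝ) ^ 5 := by
  have h1 : Filter.Tendsto (fun Q : ℕ => ((2 : ℝ) ^ (M + 1)) ^ (-w) * (Q : ℝ) ^ (5 - w)) Filter.atTop Filter.atTop :=
    ((tendsto_rpow_atTop (by linarith)).comp tendsto_natCast_atTop_atTop).const_mul_atTop (by positivity)
  obtain ⟨Q, h2, h3⟩ := ((h1.eventually_ge_atTop 512).and (Filter.eventually_ge_atTop (8 * k + 2))).exists
  refine ⟨Q, by omega, by omega, h2.trans (le_of_eq ?_)⟩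
  have hQ : (0 : ℝ) < Q := by exact_mod_cast (by omega : 0 < Q)
  rw [Real.mul_rpow (by positivity) hQ.le, mul_assoc]
  congr 1
  rw [← Real.rpow_natCast (Q : ℝ) 5, ← Real.rpow_add hQ]
  congr 1
  push_cast; ring

theorem lemG : LemG := by
  intro M w k hw0 hw
  obtain ⟨Q, hQ2, hQk, hQ⟩ := exists_Q M k hw
  have hQ0 : (2 : ℝ) ≤ Q := by exact_mod_cast hQ2
  set R : ℝ := (2 : ℝ) ^ (M + 1) * Q with hR
  have hR1 : 1 < R := by
    have : (1 : ℝ) ≤ 2 ^ (M + 1) := one_le_pow₀ (by norm_num)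
    nlinarith
  set δ : ℝ := R ^ (-w) / 2 with hδdef
  have hδ0 : 0 < δ := by positivity
  have hδ : δ < 1 / 2 := by
    have := Real.rpow_lt_one_of_one_lt_of_neg hR1 (by linarith : -w < 0)
    linarith
  obtain ⟨n₀, hn₀⟩ : ∃ n : ℕ, R * (1 / 2 ^ n) ≤ δ := by
    obtain ⟨n, hn⟩ := exists_pow_lt_of_lt_one (show 0 < δ / R by positivity) (show (1 / 2 : ℝ) < 1 by norm_num)
    refine ⟨n, ?_⟩
    rw [one_div_pow, lt_div_iff₀ (by positivity)] at hn
    linarith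
  set n' := max (M + 1) n₀ with hn'
  have hMn : M < n' := by omega
  have hn'δ : R * (1 / 2 ^ n') ≤ δ := by
    refine le_trans ?_ hn₀
    gcongr
    · norm_num
    · exact le_max_right _ _
  set V := vecs Q with hV
  have hcard := vecs_card Q hQ2
  have hVpos : 0 < (V.card : ℝ) := lt_of_lt_of_le (by positivity) hcard
  have hVne : V.Nonempty := Finset.card_pos.1 (by exact_mod_cast hVpos)
  have hVmem : ∀ v ∈ V, 0 < v.1 ∧ v.1 ≤ Q ∧ 0 < v.2 ∧ v.2 ≤ Q ∧ Q < 8 * v.2 := by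
    intro v hv
    simp only [hV, vecs, Finset.mem_filter, Finset.mem_product, Finset.mem_Ioc] at hv
    tauto
  have h2M : 1 ≤ 2 ^ M := Nat.one_le_two_pow
  set γ : ℕ → ℕ × ℕ → ℝ := fun n c => (1 / (2 * δ * V.card)) * ∑ v ∈ V, mass (strip δ (2 ^ M * v.1) (2 ^ M * v.2)) n c with hγ
  have hco : ∀ m ≤ n', ∀ D ∈ idx m, coarse n' (γ n') m D = γ m D := by
    intro m hm D hD
    simp only [hγ]
    unfold coarse
    rw [← Finset.mul_sum, Finset.sum_comm]
    congr 1
    refine Finset.sum_congr rfl fun v _ => ?_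
    exact coarse_mass (strip_meas _ _ _) hm hD
  refine ⟨n', hMn, γ n', ?_, ?_, ?_, ?_⟩
  · intro c
    exact mul_nonneg (by positivity) (Finset.sum_nonneg fun v _ => mass_nonneg _ _ _)
  · intro m hm D hD
    rw [hco m (by omega) D hD]
    simp only [hγ]
    rw [Finset.sum_congr rfl (fun v hv => F1 (hVmem v hv).2.2.1 hδ0.le hδ hm hD), Finset.sum_const, nsmul_eq_mul, Real.rpow_neg (by norm_num), Real.rpow_natCast]
    field_simp
  · intro m hm
    rw [Finset.sum_congr rfl (fun D hD => by rw [hco m hm D hD])]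
    refine energy V hVne (2 ^ M) (by positivity) hδ0 hδ (Y := Q / 8) (by positivity) ?_ (vecs_det Q) ?_ m
    · intro v hv
      have h1 : (Q : ℝ) ≤ 8 * v.2 := by exact_mod_cast (hVmem v hv).2.2.2.2.le
      have h2 : (v.2 : ℝ) ≤ ((2 ^ M * v.2 : ℕ) : ℝ) := by exact_mod_cast Nat.le_mul_of_pos_left _ h2M
      linarith
    · have : (2 * δ * (Q / 8) * ((Q : ℝ) ^ 2 / 8) ^ 2) ≤ 2 * δ * (Q / 8) * (V.card : ℝ) ^ 2 := by gcongr
      refine le_trans ?_ this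
      have e : 2 * δ * (Q / 8) * ((Q : ℝ) ^ 2 / 8) ^ 2 = R ^ (-w) * (Q : ℝ) ^ 5 / 512 := by
        rw [hδdef]; ring
      rw [e]; linarith
  · intro c hc hne q hq
    obtain ⟨v, hv, hm⟩ : ∃ v ∈ V, mass (strip δ (2 ^ M * v.1) (2 ^ M * v.2)) n' c ≠ 0 := by
      by_contra hcon
      push Not at hcon
      apply hne
      simp only [hγ]
      rw [Finset.sum_eq_zero hcon, mul_zero]
    obtain ⟨hv1, hv2, hv3, hv4, hv5⟩ := hVmem v hv
    have hnon : (strip δ (2 ^ M * v.1) (2 ^ M * v.2) ∩ hsq n' c).Nonempty := by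
      rw [Set.nonempty_iff_ne_empty]
      intro he
      apply hm
      rw [mass, he]; simp
    obtain ⟨p, hp, hpc⟩ := hnon
    replace hpc := hsq_sub_csq n' c hpc
    have hle : v.2 ≤ 2 ^ M * v.2 := Nat.le_mul_of_pos_left _ h2M
    refine ⟨2 ^ M * v.1, 2 ^ M * v.2, by omega, by omega, ?_⟩
    set x := 2 ^ M * v.1
    set y := 2 ^ M * v.2
    have hxy : ((x : ℝ) + y) ≤ R := by
      have : x + y ≤ 2 ^ (M + 1) * Q := by
        have k1 := Nat.mul_le_mul_left (2 ^ M) hv2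
        have k2 := Nat.mul_le_mul_left (2 ^ M) hv4
        have k3 : 2 ^ (M + 1) * Q = 2 ^ M * Q + 2 ^ M * Q := by ring
        show 2 ^ M * v.1 + 2 ^ M * v.2 ≤ _
        omega
      rw [hR]; exact_mod_cast this
    have hxy0 : (0 : ℝ) < (x : ℝ) + y := by
      have : 0 < x + y := by omega
      exact_mod_cast this
    refine le_trans ?_ (Real.rpow_le_rpow_of_nonpos hxy0 hxy (by linarith))
    rw [show distNearestInt (x * q.1 + y * q.2) = ‖((x * q.1 + y * q.2 : ℝ) : TT)‖ from (UnitAddCircle.norm_eq).symm]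
    have e : (x * q.1 + y * q.2 : ℝ) = (x * p.1 + y * p.2) + (x * (q.1 - p.1) + y * (q.2 - p.2)) := by ring
    rw [e, AddCircle.coe_add]
    have hnorm : ‖((x * (q.1 - p.1) + y * (q.2 - p.2) : ℝ) : TT)‖ ≤ |x * (q.1 - p.1) + y * (q.2 - p.2)| :=
      QuotientAddGroup.norm_mk_le_norm
    obtain ⟨⟨a1, a2⟩, a3, a4⟩ := hpc
    obtain ⟨⟨b1, b2⟩, b3, b4⟩ := hq
    simp only [add_div] at a2 a4 b2 b4
    have d1 : |q.1 - p.1| ≤ 1 / 2 ^ n' := abs_le.2 ⟨by linarith, by linarith⟩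
    have d2 : |q.2 - p.2| ≤ 1 / 2 ^ n' := abs_le.2 ⟨by linarith, by linarith⟩
    have hb : |x * (q.1 - p.1) + y * (q.2 - p.2)| ≤ δ := by
      calc _ ≤ |(x : ℝ) * (q.1 - p.1)| + |y * (q.2 - p.2)| := abs_add_le _ _
        _ = x * |q.1 - p.1| + y * |q.2 - p.2| := by
          rw [abs_mul, abs_mul, Nat.abs_cast, Nat.abs_cast]
        _ ≤ x * (1 / 2 ^ n') + y * (1 / 2 ^ n') := by gcongr
        _ = (x + y) * (1 / 2 ^ n') := by ring
        _ ≤ R * (1 / 2 ^ n') := by gcongr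
        _ ≤ δ := hn'δ
    have hp' : ‖((x * p.1 + y * p.2 : ℝ) : TT)‖ ≤ δ := hp
    calc _ ≤ _ := norm_add_le _ _
      _ ≤ δ + δ := add_le_add hp' (hnorm.trans hb)
      _ = R ^ (-w) := by rw [hδdef]; ring


lemma cantelli {d : ℝ} (hd : 0 < d) (T : ℕ → Set (ℝ × ℝ)) (E : Set (ℝ × ℝ))
    (hE : ∀ q ∈ E, {i | q ∈ T i}.Infinite) (hsum : ∑' i, Metric.ediam (T i) ^ d ≠ ⊤) :
    μH[d] E = 0 := by
  have htail := ENNReal.tendsto_sum_nat_add _ hsum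
  set tail : ℕ → ℝ≥0∞ := fun n => ∑' i, Metric.ediam (T (i + n)) ^ d
  have hr : Filter.Tendsto (fun n => tail n ^ (d⁻¹)) Filter.atTop (nhds 0) := by
    have := htail.ennrpow_const (d⁻¹)
    rwa [ENNReal.zero_rpow_of_pos (by positivity)] at this
  have h1 := Measure.hausdorffMeasure_le_liminf_tsum (β := ℕ) (ι := fun _ => ℕ) d E (fun n => tail n ^ (d⁻¹)) hr
    (fun n i => T (i + n)) (Filter.Eventually.of_forall fun n i => ?_) (Filter.Eventually.of_forall fun n => ?_)
  · refine le_antisymm (h1.trans (le_of_eq ?_)) zero_le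
    exact htail.liminf_eq
  · rw [ENNReal.le_rpow_inv_iff hd]
    exact ENNReal.le_tsum (f := fun i => Metric.ediam (T (i + n)) ^ d) i
  · intro q hq
    obtain ⟨i, hi, hin⟩ := (hE q hq).exists_gt n
    exact Set.mem_iUnion.2 ⟨i - n, by simpa [Nat.sub_add_cancel hin.le] using hi⟩

lemma cantelli' {ι : Type} [Denumerable ι] {d : ℝ} (hd : 0 < d) (T : ι → Set (ℝ × ℝ)) (E : Set (ℝ × ℝ))
    (hE : ∀ q ∈ E, {i | q ∈ T i}.Infinite) (hsum : ∑' i, Metric.ediam (T i) ^ d ≠ ⊤) :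
    μH[d] E = 0 := by
  set e := (Denumerable.eqv ι).symm
  refine cantelli hd (fun n => T (e n)) E (fun q hq => ?_) ?_
  · exact ((hE q hq).preimage (by rw [e.surjective.range_eq]; exact Set.subset_univ _) : (e ⁻¹' {i | q ∈ T i}).Infinite)
  · rwa [e.tsum_eq (fun i => Metric.ediam (T i) ^ d)]

lemma tsum_int_le {A : ℝ} (hA : 0 ≤ A) (f : ℤ → ℝ≥0∞) (c : ℝ≥0∞) (hf : ∀ z, f z ≤ c) (h0 : ∀ z : ℤ, A < |(z : ℝ)| → f z = 0) :
    ∑' z, f z ≤ ENNReal.ofReal (2 * A + 1) * c := by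
  rw [tsum_eq_sum (s := Finset.Icc (-⌊A⌋) ⌊A⌋)]
  · refine (Finset.sum_le_card_nsmul _ _ _ fun z _ => hf z).trans ?_
    rw [nsmul_eq_mul]
    refine mul_le_mul_left ?_ _
    rw [Int.card_Icc, ← ENNReal.ofReal_natCast]
    apply ENNReal.ofReal_le_ofReal
    have h1 : 0 ≤ ⌊A⌋ := Int.floor_nonneg.2 hA
    have h2 : (((⌊A⌋ + 1 - -⌊A⌋).toNat : ℕ) : ℝ) = ((⌊A⌋ + 1 - -⌊A⌋ : ℤ) : ℝ) := by
      rw [← Int.cast_natCast, Int.toNat_of_nonneg (by omega)]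
    rw [h2]
    push_cast
    linarith [Int.floor_le A]
  · intro z hz
    apply h0
    by_contra hcon
    apply hz
    rw [not_lt, abs_le] at hcon
    rw [Finset.mem_Icc]
    exact ⟨by
      rw [neg_le, Int.le_floor]; push_cast; linarith, Int.le_floor.2 hcon.2⟩

/-- pieces of the cover; index order is `y, x, z, j` -/
def piece (w : ℝ) (K : ℕ) (i : ℤ × ℤ × ℤ × ℤ) : Set (ℝ × ℝ) :=
  {q | i.1 ≠ 0 ∧ |(i.2.1 : ℝ)| ≤ |(i.1 : ℝ)| ∧ |(i.2.2.1 : ℝ)| ≤ (2 * K + 1) * |(i.1 : ℝ)| ∧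
    |(i.2.2.2 : ℝ)| ≤ (K + 1) * |(i.1 : ℝ)| ^ (w + 1) ∧
    |i.2.1 * q.1 + i.1 * q.2 - i.2.2.1| ≤ |(i.1 : ℝ)| ^ (-w) ∧
    q.1 ∈ Set.Icc (i.2.2.2 * |(i.1 : ℝ)| ^ (-(w + 1))) ((i.2.2.2 + 1) * |(i.1 : ℝ)| ^ (-(w + 1)))}

lemma piece_diam (w : ℝ) (K : ℕ) (i : ℤ × ℤ × ℤ × ℤ) :
    Metric.ediam (piece w K i) ≤ ENNReal.ofReal (3 * |(i.1 : ℝ)| ^ (-(w + 1))) := by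
  obtain ⟨y, x, z, j⟩ := i
  refine Metric.ediam_le ?_
  rintro p ⟨hy, hx, -, -, hp1, hp2, hp3⟩ q ⟨-, -, -, -, hq1, hq2, hq3⟩
  simp only at *
  have hy0 : 0 < |(y : ℝ)| := by positivity
  rw [edist_dist]
  apply ENNReal.ofReal_le_ofReal
  set ρ := |(y : ℝ)| ^ (-(w + 1)) with hρ
  have hρ0 : 0 < ρ := by positivity
  have e : |(y : ℝ)| ^ (-w) = |(y : ℝ)| * ρ := by
    rw [hρ]
    nth_rewrite 2 [← Real.rpow_one |(y : ℝ)|]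
    rw [← Real.rpow_add hy0]; congr 1; ring
  rw [e] at hp1 hq1
  have h1 : |p.1 - q.1| ≤ ρ := abs_le.2 ⟨by linarith, by linarith⟩
  have h2 : |p.2 - q.2| ≤ 3 * ρ := by
    have h3 : |(y : ℝ)| * |p.2 - q.2| ≤ |(y : ℝ)| * (3 * ρ) := by
      rw [← abs_mul]
      have e2 : (y : ℝ) * (p.2 - q.2) = (x * p.1 + y * p.2 - z) - (x * q.1 + y * q.2 - z) - x * (p.1 - q.1) := by ring
      rw [e2]
      have h4 : |(x : ℝ) * (p.1 - q.1)| ≤ |(y : ℝ)| * ρ := by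
        rw [abs_mul]; gcongr
      have := abs_sub ((x * p.1 + y * p.2 - z) - (x * q.1 + y * q.2 - z)) (x * (p.1 - q.1))
      have := abs_sub (x * p.1 + y * p.2 - z) (x * q.1 + y * q.2 - z)
      linarith
    exact le_of_mul_le_mul_left h3 hy0
  rw [Prod.dist_eq, Real.dist_eq, Real.dist_eq]
  exact max_le (by linarith) h2

/-- half of the exceptional set in a box -/
def halfE (w : ℝ) (K : ℕ) : Set (ℝ × ℝ) :=
  {q | |q.1| ≤ K ∧ |q.2| ≤ K ∧ {p : ℤ × ℤ | p.2 ≠ 0 ∧ |p.1| ≤ |p.2| ∧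
    distNearestInt (p.1 * q.1 + p.2 * q.2) ≤ |(p.2 : ℝ)| ^ (-w)}.Infinite}

lemma halfE_cover {w : ℝ} (hw : 0 < w) {K : ℕ} {q : ℝ × ℝ} (hq : q ∈ halfE w K) :
    {i | q ∈ piece w K i}.Infinite := by
  obtain ⟨h1, h2, h3⟩ := hq
  refine Set.Infinite.of_image (fun i => (i.2.1, i.1)) (h3.mono ?_)
  rintro ⟨x, y⟩ ⟨hy, hx, hd⟩
  simp only at hy hx hd
  set Y := |(y : ℝ)| with hY
  have hY1 : 1 ≤ Y := by
    rw [hY]; exact_mod_cast Int.one_le_abs hy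
  have hx' : |(x : ℝ)| ≤ Y := by rw [hY]; exact_mod_cast hx
  set ρ := Y ^ (-(w + 1)) with hρ
  have hρ0 : 0 < ρ := by positivity
  have hρi : Y ^ (w + 1) = 1 / ρ := by rw [hρ, Real.rpow_neg (by linarith)]; simp
  refine ⟨(y, x, round (x * q.1 + y * q.2), ⌊q.1 / ρ⌋), ⟨hy, hx', ?_, ?_, hd, ?_, ?_⟩, rfl⟩
  · simp only
    have a1 : |x * q.1 + y * q.2| ≤ 2 * K * Y := by
      calc _ ≤ |(x : ℝ) * q.1| + |y * q.2| := abs_add_le _ _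
        _ ≤ Y * K + Y * K := by rw [abs_mul, abs_mul]; gcongr
        _ = _ := by ring
    have a2 := abs_sub_round (x * q.1 + y * q.2)
    have a3 := abs_sub (x * q.1 + y * q.2) (x * q.1 + y * q.2 - round (x * q.1 + y * q.2))
    rw [sub_sub_cancel] at a3
    linarith
  · simp only
    rw [← hY, hρi]
    have a1 : |q.1 / ρ| ≤ K * (1 / ρ) := by
      rw [abs_div, abs_of_pos hρ0, mul_one_div]; gcongr
    have a2 : 1 ≤ 1 / ρ := by rw [← hρi]; exact Real.one_le_rpow hY1 (by linarith)
    have a3 := Int.floor_le (q.1 / ρ)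
    have a4 := Int.lt_floor_add_one (q.1 / ρ)
    rw [abs_le] at a1 ⊢
    constructor <;> linarith
  · simp only
    have a3 := Int.floor_le (q.1 / ρ)
    rwa [le_div_iff₀ hρ0] at a3
  · simp only
    have a4 := (Int.lt_floor_add_one (q.1 / ρ)).le
    rwa [div_le_iff₀ hρ0] at a4

lemma piece_sum {w d : ℝ} (hw : 0 < w) (hd : 0 < d) (hwd : 3 < (w + 1) * (d - 1)) (K : ℕ) :
    ∑' i, Metric.ediam (piece w K i) ^ d ≠ ⊤ := by
  set g : ℤ → ℝ := fun y => (3 * (4 * K + 3) * (2 * K + 3) * 3 ^ d) * |(y : ℝ)| ^ (2 - (w + 1) * (d - 1)) with hg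
  have hgs : Summable g := by
    apply Summable.mul_left
    have := Real.summable_abs_int_rpow (b := (w + 1) * (d - 1) - 2) (by linarith)
    simpa using this
  have hg0 : ∀ y, 0 ≤ g y := fun y => by positivity
  have key : ∀ y : ℤ, ∑' (j : ℤ × ℤ × ℤ), Metric.ediam (piece w K (y, j)) ^ d ≤ ENNReal.ofReal (g y) := by
    intro y
    by_cases hy : y = 0
    · have : ∀ j, piece w K (y, j) = ∅ := fun j => by
        ext q; simp [piece, hy]
      simp [this, ENNReal.zero_rpow_of_pos hd]
    set Y := |(y : ℝ)| with hY
    have hY1 : 1 ≤ Y := by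
      rw [hY]; exact_mod_cast Int.one_le_abs hy
    have hw1 : 1 ≤ Y ^ (w + 1) := Real.one_le_rpow hY1 (by linarith)
    set c := ENNReal.ofReal ((3 * Y ^ (-(w + 1))) ^ d) with hc
    have hle : ∀ j, Metric.ediam (piece w K (y, j)) ^ d ≤ c := by
      intro j
      rw [hc, ← ENNReal.ofReal_rpow_of_nonneg (by positivity) hd.le]
      exact ENNReal.rpow_le_rpow (piece_diam w K (y, j)) hd.le
    have hz : ∀ j, piece w K (y, j) = ∅ → Metric.ediam (piece w K (y, j)) ^ d = 0 := by
      intro j hj; rw [hj]; simp [ENNReal.zero_rpow_of_pos hd]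
    have s3 : ∀ x z, ∑' j, Metric.ediam (piece w K (y, x, z, j)) ^ d ≤ ENNReal.ofReal (2 * ((K + 1) * Y ^ (w + 1)) + 1) * c := by
      intro x z
      refine tsum_int_le (by positivity) _ _ (fun j => hle _) fun j hj => hz _ ?_
      ext q
      simp only [piece, Set.mem_ofPred_eq, Set.mem_empty_iff_false, iff_false]
      exact fun h => absurd h.2.2.2.1 (not_le.2 hj)
    have s2 : ∀ x, ∑' z, ∑' j, Metric.ediam (piece w K (y, x, z, j)) ^ d ≤ ENNReal.ofReal (2 * ((2 * K + 1) * Y) + 1) * (ENNReal.ofReal (2 * ((K + 1) * Y ^ (w + 1)) + 1) * c) := by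
      intro x
      refine tsum_int_le (by positivity) _ _ (fun z => s3 x z) fun z hj => ENNReal.tsum_eq_zero.2 fun j => hz _ ?_
      ext q
      simp only [piece, Set.mem_ofPred_eq, Set.mem_empty_iff_false, iff_false]
      exact fun h => absurd h.2.2.1 (not_le.2 hj)
    have s1 : ∑' x, ∑' z, ∑' j, Metric.ediam (piece w K (y, x, z, j)) ^ d ≤ ENNReal.ofReal (2 * Y + 1) * (ENNReal.ofReal (2 * ((2 * K + 1) * Y) + 1) * (ENNReal.ofReal (2 * ((K + 1) * Y ^ (w + 1)) + 1) * c)) := by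
      refine tsum_int_le (by positivity) _ _ (fun x => s2 x) fun x hj => ENNReal.tsum_eq_zero.2 fun z => ENNReal.tsum_eq_zero.2 fun j => hz _ ?_
      ext q
      simp only [piece, Set.mem_ofPred_eq, Set.mem_empty_iff_false, iff_false]
      exact fun h => absurd h.2.1 (not_le.2 hj)
    rw [ENNReal.tsum_prod']
    simp only [ENNReal.tsum_prod']
    refine s1.trans ?_
    rw [hc, ← ENNReal.ofReal_mul (by positivity), ← ENNReal.ofReal_mul (by positivity), ← ENNReal.ofReal_mul (by positivity)]
    apply ENNReal.ofReal_le_ofReal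
    have hY0 : 0 < Y := by linarith
    calc (2 * Y + 1) * ((2 * ((2 * K + 1) * Y) + 1) * ((2 * ((K + 1) * Y ^ (w + 1)) + 1) * (3 * Y ^ (-(w + 1))) ^ d))
        ≤ (3 * Y) * (((4 * K + 3) * Y) * (((2 * K + 3) * Y ^ (w + 1)) * (3 * Y ^ (-(w + 1))) ^ d)) := by
          gcongr <;> linarith
      _ = (3 * (4 * K + 3) * (2 * K + 3) * 3 ^ d) * (Y ^ (1 : ℝ) * Y ^ (1 : ℝ) * Y ^ (w + 1) * Y ^ (-(w + 1) * d)) := by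
          rw [Real.mul_rpow (by norm_num) (by positivity), ← Real.rpow_mul hY0.le, Real.rpow_one]
          ring
      _ = g y := by
          rw [hg, ← Real.rpow_add hY0, ← Real.rpow_add hY0, ← Real.rpow_add hY0]
          simp only
          congr 2
          ring
  rw [ENNReal.tsum_prod']
  refine ne_top_of_le_ne_top ?_ (ENNReal.tsum_le_tsum key)
  rw [← ENNReal.ofReal_tsum_of_nonneg hg0 hgs]
  exact ENNReal.ofReal_ne_top

lemma swap_isom : Isometry (Prod.swap : ℝ × ℝ → ℝ × ℝ) :=
  Isometry.of_dist_eq fun p q => by simp only [Prod.dist_eq, Prod.fst_swap, Prod.snd_swap, max_comm]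

lemma target_sub {w : ℝ} (hw0 : 0 < w) (hw : w < 5) :
    {p : ℝ × ℝ | DualExpGeFive p.1 p.2} ⊆ ⋃ K : ℕ, (halfE w K ∪ Prod.swap '' halfE w K) := by
  rintro ⟨a, b⟩ h
  have h' := h w hw
  simp only at h'
  obtain ⟨K, hK⟩ := exists_nat_ge (max |a| |b|)
  have ha := (le_max_left _ _).trans hK
  have hb := (le_max_right _ _).trans hK
  refine Set.mem_iUnion.2 ⟨K, ?_⟩
  have mono : ∀ x y : ℤ, y ≠ 0 → ((|x| + |y| : ℤ) : ℝ) ^ (-w) ≤ |(y : ℝ)| ^ (-w) := by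
    intro x y hy
    refine Real.rpow_le_rpow_of_nonpos (by positivity) ?_ (by linarith)
    push_cast
    linarith [abs_nonneg (x : ℝ)]
  have hsplit : {p : ℤ × ℤ | p ≠ 0 ∧ distNearestInt (p.1 * a + p.2 * b) ≤ ((|p.1| + |p.2| : ℤ) : ℝ) ^ (-w)} ⊆
    {p : ℤ × ℤ | p.2 ≠ 0 ∧ |p.1| ≤ |p.2| ∧ distNearestInt (p.1 * a + p.2 * b) ≤ |(p.2 : ℝ)| ^ (-w)} ∪
    Prod.swap '' {p : ℤ × ℤ | p.2 ≠ 0 ∧ |p.1| ≤ |p.2| ∧ distNearestInt (p.1 * b + p.2 * a) ≤ |(p.2 : ℝ)| ^ (-w)} := by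
    rintro ⟨x, y⟩ ⟨hne, hd⟩
    simp only at hd
    rcases le_total |x| |y| with hxy | hxy
    · left
      have hy : y ≠ 0 := by
        rintro rfl
        simp only [abs_zero, abs_nonpos_iff] at hxy
        exact hne (by rw [hxy]; rfl)
      exact ⟨hy, hxy, hd.trans (mono x y hy)⟩
    · right
      have hx : x ≠ 0 := by
        rintro rfl
        simp only [abs_zero, abs_nonpos_iff] at hxy
        exact hne (by rw [hxy]; rfl)
      refine ⟨(y, x), ⟨hx, hxy, ?_⟩, rfl⟩
      simp only
      rw [add_comm]
      refine hd.trans ?_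
      rw [add_comm]
      exact mono y x hx
  rcases Set.infinite_union.1 (h'.mono hsplit) with h1 | h1
  · exact Or.inl ⟨ha, hb, h1⟩
  · exact Or.inr ⟨(b, a), ⟨hb, ha, h1.of_image _⟩, rfl⟩

theorem upper_bound (d : NNReal) (hd : 3 / 2 < (d : ℝ)) :
    dimH {p : ℝ × ℝ | DualExpGeFive p.1 p.2} ≤ d := by
  obtain ⟨w, hw0, hw, hwd⟩ : ∃ w : ℝ, 0 < w ∧ w < 5 ∧ 3 < (w + 1) * ((d : ℝ) - 1) := by
    have hd1 : 0 < (d : ℝ) - 1 := by linarith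
    have h1 : 3 / ((d : ℝ) - 1) - 1 < 5 := by
      rw [sub_lt_iff_lt_add, div_lt_iff₀ hd1]; linarith
    obtain ⟨w, h2, h3⟩ := exists_between (max_lt h1 (by norm_num : (0 : ℝ) < 5))
    rw [max_lt_iff] at h2
    refine ⟨w, h2.2, h3, ?_⟩
    have := h2.1
    rwa [sub_lt_iff_lt_add, div_lt_iff₀ hd1] at this
  have hhalf : ∀ K, dimH (halfE w K) ≤ d := by
    intro K
    refine dimH_le_of_hausdorffMeasure_ne_top ?_
    rw [cantelli' (by linarith : (0 : ℝ) < d) (piece w K) (halfE w K) (fun q hq => halfE_cover hw0 hq)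
      (piece_sum hw0 (by linarith) hwd K)]
    simp
  refine (dimH_mono (target_sub hw0 hw)).trans ?_
  rw [dimH_iUnion]
  refine iSup_le fun K => ?_
  rw [dimH_union, swap_isom.dimH_image, max_self]
  exact hhalf K

theorem final : dimH {p : ℝ × ℝ | DualExpGeFive p.1 p.2} = (3 / 2 : ℝ≥0∞) := by
  have e : (3 / 2 : ℝ≥0∞) = ((3 / 2 : NNReal) : ℝ≥0∞) := by
    rw [ENNReal.coe_div (by norm_num)]; norm_num
  rw [e]
  apply le_antisymm
  · by_contra hcon
    obtain ⟨r, h1, h2⟩ := ENNReal.lt_iff_exists_nnreal_btwn.1 (not_le.1 hcon)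
    refine absurd (upper_bound r ?_) (not_le.2 h2)
    have := ENNReal.coe_lt_coe.1 h1
    exact_mod_cast this
  · by_contra hcon
    obtain ⟨r, h1, h2⟩ := ENNReal.lt_iff_exists_nnreal_btwn.1 (not_le.1 hcon)
    have h3 := ENNReal.coe_lt_coe.1 h2
    refine absurd (lower_bound lemG r ?_ (by exact_mod_cast h3)) (not_le.2 h1)
    exact ENNReal.coe_pos.1 (zero_le.trans_lt h1)

/-- **The exceptional set for the dual exponent has Hausdorff dimension 3/2**
(Chow–Yang, §1.2). -/
theorem dimH_dual_exceptional_set :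
    dimH {p : ℝ × ℝ | DualExpGeFive p.1 p.2} = (3 / 2 : ℝ≥0∞) := by
  exact final

end
end
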